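/- Let R = [[R₁,0],[C,R₂]] be a d×d expanding integer matrix with R₁ ∈ M_r(ℤ) and R₂ ∈ M_{d−r}(ℤ) expanding, let N₂ = |det R₂|, and let B = {(u_i, d_{i,j})ᵀ : 1 ≤ i ≤ N₁, 1 ≤ j ≤ N₂} ⊂ ℤ^d, where u₁,…,u_{N₁} ∈ ℤ^r are distinct and, for each 1 ≤ i ≤ N₁, the set {d_{i,j} : 1 ≤ j ≤ N₂} ⊂ ℤ^{d−r} is a complete set of representatives (mod R₂(ℤ^{d−r})). Then there exists a full-rank lattice Γ₂ ⊂ ℝ^{d−r} such that, for P₁-almost every ω = (i₁ i₂ …) ∈ {1,…,N₁}^ℕ, the exponentials {e^{2πi⟨γ,y⟩} : γ ∈ Γ₂} form an orthonormal basis of L²(μ_ω²); that is, Γ₂ is a spectrum for the measure μ_x² for μ₁-almost every x. -/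

import Mathlib

open MeasureTheory Matrix Filter
open scoped BigOperators Classical

noncomputable section

variable {ι : Type*}

/-- Cast an integer matrix to a real matrix. -/
def intMatCast [Fintype ι] [DecidableEq ι] (R : Matrix ι ι ℤ) : Matrix ι ι ℝ :=
  R.map (Int.cast : ℤ → ℝ)

/-- Cast an integer vector to a real vector. -/
def intVecCast (v : ι → ℤ) : ι → ℝ := fun i => (v i : ℝ)

/-- Standard inner product on `ι → ℝ`. -/
def rdot [Fintype ι] (x y : ι → ℝ) : ℝ := ∑ i, x i * y i

/-- The exponential `e^{2πi⟨x,y⟩}`. -/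
def expv [Fintype ι] (x y : ι → ℝ) : ℂ :=
  Complex.exp (2 * (Real.pi : ℂ) * Complex.I * (rdot x y : ℝ))

/-- An integer matrix is expanding if all of its (complex) eigenvalues have modulus
strictly greater than `1`. -/
def IsExpanding [Fintype ι] [DecidableEq ι] (R : Matrix ι ι ℤ) : Prop :=
  ∀ z ∈ spectrum ℂ (R.map (Int.cast : ℤ → ℂ)), 1 < ‖z‖

/-- `(R,B,L)` is a Hadamard triple: `#B = #L` and the matrix
`(1/√N)(e^{2πi⟨R⁻¹b,ℓ⟩})_{ℓ∈L,b∈B}` is unitary, expressed via orthonormality of columns. -/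
def IsHadamardTriple [Fintype ι] [DecidableEq ι] (R : Matrix ι ι ℤ)
    (B L : Finset (ι → ℤ)) : Prop :=
  B.card = L.card ∧
  ∀ b ∈ B, ∀ b' ∈ B,
    (B.card : ℂ)⁻¹ * ∑ l ∈ L,
      expv ((intMatCast R)⁻¹.mulVec (intVecCast b)) (intVecCast l) *
        (starRingEnd ℂ) (expv ((intMatCast R)⁻¹.mulVec (intVecCast b')) (intVecCast l)) =
    if b = b' then 1 else 0

/-- `μ` is the self-affine measure `μ(R,B)`: a compactly supported Borel probability
measure satisfying `μ(E) = (1/N) ∑_{b∈B} μ(τ_b⁻¹(E))` where `τ_b(x) = R⁻¹(x+b)`. -/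
def IsSelfAffineMeasure [Fintype ι] [DecidableEq ι] (R : Matrix ι ι ℤ)
    (B : Finset (ι → ℤ)) (μ : Measure (ι → ℝ)) : Prop :=
  IsProbabilityMeasure μ ∧ (∃ K : Set (ι → ℝ), IsCompact K ∧ μ Kᶜ = 0) ∧
  ∀ E : Set (ι → ℝ), MeasurableSet E →
    μ E = (B.card : ENNReal)⁻¹ *
      ∑ b ∈ B, μ ((fun x => (intMatCast R)⁻¹.mulVec (x + intVecCast b)) ⁻¹' E)

/-- `Λ` is a spectrum for `μ`: it is countable and the exponentials `e^{2πi⟨λ,·⟩}`, `λ ∈ Λ`,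
form an orthonormal basis of `L²(μ)` (orthonormal and total). -/
def IsSpectrum [Fintype ι] [DecidableEq ι] (μ : Measure (ι → ℝ)) (Λ : Set (ι → ℝ)) : Prop :=
  Λ.Countable ∧
  (∀ l ∈ Λ, ∀ l' ∈ Λ,
    ∫ x, expv l x * (starRingEnd ℂ) (expv l' x) ∂μ = if l = l' then 1 else 0) ∧
  (∀ f : Lp ℂ 2 μ, (∀ l ∈ Λ, ∫ x, (starRingEnd ℂ) (expv l x) * f x ∂μ = 0) → f = 0)

/-- The Fourier transform `μ̂(ξ) = ∫ e^{-2πi⟨ξ,x⟩} dμ(x)`. -/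
def ftMeasure [Fintype ι] (μ : Measure (ι → ℝ)) (ξ : ι → ℝ) : ℂ :=
  ∫ x, Complex.exp (-(2 * (Real.pi : ℂ) * Complex.I * (rdot ξ x : ℝ))) ∂μ

/-- `u_B(x) = |(1/N) ∑_{b∈B} e^{2πi⟨b,x⟩}|²`. -/
def uB [Fintype ι] (B : Finset (ι → ℤ)) (x : ι → ℝ) : ℝ :=
  ‖(B.card : ℂ)⁻¹ * ∑ b ∈ B, expv (intVecCast b) x‖ ^ 2

/-- `𝒵 = {ξ : μ̂(ξ + k) = 0 for all k ∈ ℤ^d}`. -/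
def Zset [Fintype ι] (μ : Measure (ι → ℝ)) : Set (ι → ℝ) :=
  {ξ | ∀ k : ι → ℤ, ftMeasure μ (ξ + intVecCast k) = 0}

/-- `ℤ[R,B]`: the smallest `R`-invariant subgroup of `ℤ^d` containing all `R^j b`. -/
def ZRB [Fintype ι] [DecidableEq ι] (R : Matrix ι ι ℤ) (B : Finset (ι → ℤ)) :
    AddSubgroup (ι → ℤ) :=
  AddSubgroup.closure {v | ∃ (j : ℕ) (b : ι → ℤ), b ∈ B ∧ v = (R ^ j).mulVec b}

/-- `𝓛` is a complete set of representatives modulo `S(ℤ^d)`. -/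
def IsCompleteResidueSet [Fintype ι] [DecidableEq ι] (S : Matrix ι ι ℤ)
    (𝓛 : Finset (ι → ℤ)) : Prop :=
  ∀ v : ι → ℤ, ∃! l, l ∈ 𝓛 ∧ ∃ k : ι → ℤ, v - l = S.mulVec k


open scoped ENNReal

set_option linter.unusedSectionVars false
set_option linter.unusedVariables false
set_option linter.style.haveILetI false

namespace FM

section UMsec
variable {J J1 J2 : Type} [Fintype J] [Nonempty J] [MeasurableSpace J] [DiscreteMeasurableSpace J]
  [Fintype J1] [Nonempty J1] [MeasurableSpace J1] [DiscreteMeasurableSpace J1]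
  [Fintype J2] [Nonempty J2] [MeasurableSpace J2] [DiscreteMeasurableSpace J2]

/-- uniform measure on a finite type -/
def uni (J : Type) [Fintype J] [MeasurableSpace J] : Measure J :=
  (Fintype.card J : ℝ≥0∞)⁻¹ • Measure.count

lemma uni_apply (s : Set J) : uni J s = (Fintype.card J : ℝ≥0∞)⁻¹ * (s.ncard : ℝ≥0∞) := by
  have h := Measure.count_apply_finite s s.toFinite
  simp only [uni, Measure.smul_apply, smul_eq_mul, h]
  rw [Set.ncard_eq_toFinset_card s s.toFinite]

instance : IsProbabilityMeasure (uni J) := ⟨by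
  rw [uni_apply, Set.ncard_univ, Nat.card_eq_fintype_card]
  exact ENNReal.inv_mul_cancel (by simp) (by simp)⟩

lemma uni_singleton (a : J) : uni J {a} = (Fintype.card J : ℝ≥0∞)⁻¹ := by
  rw [uni_apply]; simp

/-- i.i.d. uniform sequences -/
def UM (J : Type) [Fintype J] [Nonempty J] [MeasurableSpace J] [DiscreteMeasurableSpace J] :
    Measure (ℕ → J) := Measure.infinitePi (fun _ => uni J)

instance : IsProbabilityMeasure (UM J) := by unfold UM; infer_instance

lemma UM_pi (s : Finset ℕ) (t : ℕ → Set J) :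
    UM J (Set.pi s t) = ∏ k ∈ s, uni J (t k) :=
  Measure.infinitePi_pi _ (fun _ _ => .of_discrete)

lemma UM_cyl (n : ℕ) (c : Fin n → J) :
    UM J {ω | ∀ i : Fin n, ω i = c i} = (Fintype.card J : ℝ≥0∞)⁻¹ ^ n := by
  have : {ω : ℕ → J | ∀ i : Fin n, ω i = c i} =
      Set.pi (Finset.range n : Finset ℕ) (fun k => if h : k < n then {c ⟨k, h⟩} else Set.univ) := by
    ext ω
    simp only [Set.mem_ofPred_eq, Set.mem_pi, Finset.coe_range, Set.mem_Iio]
    constructor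
    · intro h k hk
      simp [hk, h ⟨k, hk⟩]
    · intro h i
      have := h i i.2
      simpa using this
  rw [this, UM_pi]
  rw [Finset.prod_congr rfl (g := fun _ => (Fintype.card J : ℝ≥0∞)⁻¹)]
  · simp
  · intro k hk
    simp [Finset.mem_range.1 hk, uni_singleton]

lemma UM_ext (μ : Measure (ℕ → J)) [IsProbabilityMeasure μ]
    (h : ∀ (n : ℕ) (c : Fin n → J),
      μ {ω | ∀ i : Fin n, ω i = c i} = (Fintype.card J : ℝ≥0∞)⁻¹ ^ n) : μ = UM J := by
  have hm : ∀ n : ℕ, Measurable (fun (ω : ℕ → J) (i : Fin n) => ω i) := fun n => by fun_prop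
  have key : ∀ n : ℕ, μ.map (fun (ω : ℕ → J) (i : Fin n) => ω i) =
      (UM J).map (fun (ω : ℕ → J) (i : Fin n) => ω i) := by
    intro n
    apply Measure.ext_of_singleton
    intro c
    rw [Measure.map_apply (hm n) (measurableSet_singleton c),
      Measure.map_apply (hm n) (measurableSet_singleton c)]
    have : (fun (ω : ℕ → J) (i : Fin n) => ω i) ⁻¹' {c} = {ω | ∀ i : Fin n, ω i = c i} := by
      ext ω; simp [funext_iff]
    rw [this, h, UM_cyl]
  unfold UM
  apply Measure.eq_infinitePi
  intro s t _
  obtain ⟨n, hn⟩ : ∃ n : ℕ, ∀ k ∈ s, k < n := ⟨s.sup id + 1, fun k hk =>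
    Nat.lt_succ_of_le (Finset.le_sup (f := id) hk)⟩
  rw [← UM_pi s t]
  have : Set.pi (s : Set ℕ) t = (fun (ω : ℕ → J) (i : Fin n) => ω i) ⁻¹'
      {c | ∀ i : Fin n, (i : ℕ) ∈ s → c i ∈ t i} := by
    ext ω
    simp only [Set.mem_pi, Set.mem_preimage, Set.mem_ofPred_eq, Finset.mem_coe]
    exact ⟨fun h i hi => h i hi, fun h k hk => h ⟨k, hn k hk⟩ hk⟩
  rw [this, ← Measure.map_apply (hm n) .of_discrete, key, Measure.map_apply (hm n) .of_discrete]

/-- zip of two iid sequences -/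
def zipE (J1 J2 : Type) [MeasurableSpace J1] [MeasurableSpace J2] :
    ((ℕ → J1) × (ℕ → J2)) ≃ᵐ (ℕ → J1 × J2) where
  toFun p k := (p.1 k, p.2 k)
  invFun w := (fun k => (w k).1, fun k => (w k).2)
  left_inv _ := rfl
  right_inv _ := rfl
  measurable_toFun := by simp only [Equiv.coe_fn_mk]; fun_prop
  measurable_invFun := by simp only [Equiv.coe_fn_symm_mk]; fun_prop

lemma zipE_mp : MeasurePreserving (zipE J1 J2) ((UM J1).prod (UM J2)) (UM (J1 × J2)) := by
  refine ⟨(zipE J1 J2).measurable, ?_⟩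
  have : IsProbabilityMeasure (((UM J1).prod (UM J2)).map (zipE J1 J2)) :=
    Measure.isProbabilityMeasure_map (zipE J1 J2).measurable.aemeasurable
  apply UM_ext
  intro n c
  rw [(zipE J1 J2).map_apply]
  have : (zipE J1 J2) ⁻¹' {ω | ∀ i : Fin n, ω i = c i} =
      {ω : ℕ → J1 | ∀ i : Fin n, ω i = (c i).1} ×ˢ {ω : ℕ → J2 | ∀ i : Fin n, ω i = (c i).2} := by
    ext ⟨a, b⟩
    simp only [Set.mem_preimage, Set.mem_ofPred_eq, Set.mem_prod, ← forall_and]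
    exact forall_congr' fun i => Prod.ext_iff
  rw [this, Measure.prod_prod, UM_cyl, UM_cyl, ← mul_pow, Fintype.card_prod, Nat.cast_mul,
    ENNReal.mul_inv (by simp) (by simp)]

/-- coordinatewise relabelling -/
def relE {J1 J2 : Type} [MeasurableSpace J1] [MeasurableSpace J2] [DiscreteMeasurableSpace J1]
    [DiscreteMeasurableSpace J2] (e : ℕ → J1 ≃ J2) : (ℕ → J1) ≃ᵐ (ℕ → J2) where
  toFun p k := e k (p k)
  invFun w k := (e k).symm (w k)
  left_inv _ := by simp
  right_inv _ := by simp
  measurable_toFun := by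
    simp only [Equiv.coe_fn_mk]
    exact measurable_pi_lambda _ fun k => (Measurable.of_discrete (f := e k)).comp (measurable_pi_apply k)
  measurable_invFun := by
    simp only [Equiv.coe_fn_symm_mk]
    exact measurable_pi_lambda _ fun k =>
      (Measurable.of_discrete (f := (e k).symm)).comp (measurable_pi_apply k)

lemma relE_mp (e : ℕ → J1 ≃ J2) : MeasurePreserving (relE e) (UM J1) (UM J2) := by
  refine ⟨(relE e).measurable, ?_⟩
  have : IsProbabilityMeasure ((UM J1).map (relE e)) :=
    Measure.isProbabilityMeasure_map (relE e).measurable.aemeasurable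
  apply UM_ext
  intro n c
  rw [(relE e).map_apply]
  have : (relE e) ⁻¹' {ω | ∀ i : Fin n, ω i = c i} =
      {ω : ℕ → J1 | ∀ i : Fin n, ω i = (e i).symm (c i)} := by
    ext a
    simp only [Set.mem_preimage, Set.mem_ofPred_eq]
    exact forall_congr' fun i => by
      show e i (a i) = c i ↔ _
      rw [Equiv.eq_symm_apply]
  rw [this, UM_cyl, Fintype.card_congr (e 0)]

/-- grouping into blocks of length `m` -/
def blkE (m : ℕ) [NeZero m] (J : Type) [MeasurableSpace J] : (ℕ → J) ≃ᵐ (ℕ → Fin m → J) where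
  toFun p q r := p (q * m + r)
  invFun w k := w (k / m) (Fin.ofNat m k)
  left_inv p := by
    funext k
    show p (k / m * m + (k % m)) = p k
    rw [Nat.div_add_mod']
  right_inv w := by
    funext q r
    have := (Nat.divModEquiv m).right_inv (q, r)
    simp only [Nat.divModEquiv, Prod.ext_iff] at this
    show w ((q * m + r) / m) (Fin.ofNat m (q * m + r)) = w q r
    rw [this.1, this.2]
  measurable_toFun := by simp only [Equiv.coe_fn_mk]; fun_prop
  measurable_invFun := by
    simp only [Equiv.coe_fn_symm_mk]
    fun_prop

lemma blkE_mp (m : ℕ) [NeZero m] : MeasurePreserving (blkE m J) (UM J) (UM (Fin m → J)) := by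
  refine ⟨(blkE m J).measurable, ?_⟩
  have : IsProbabilityMeasure ((UM J).map (blkE m J)) :=
    Measure.isProbabilityMeasure_map (blkE m J).measurable.aemeasurable
  apply UM_ext
  intro n c
  rw [(blkE m J).map_apply]
  have : (blkE m J) ⁻¹' {ω | ∀ i : Fin n, ω i = c i} =
      {ω : ℕ → J | ∀ i : Fin (n * m), ω i = c (finProdFinEquiv.symm i).1 (finProdFinEquiv.symm i).2} := by
    ext a
    simp only [Set.mem_preimage, Set.mem_ofPred_eq]
    constructor
    · intro h i
      obtain ⟨⟨q, r⟩, rfl⟩ := finProdFinEquiv.surjective i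
      rw [Equiv.symm_apply_apply, ← h q]
      show a _ = a _
      congr 1
      simp [finProdFinEquiv]; ring
    · intro h q
      funext r
      have := h (finProdFinEquiv (q, r))
      rw [Equiv.symm_apply_apply] at this
      rw [← this]
      show a _ = a _
      congr 1
      simp [finProdFinEquiv]; ring
  rw [this, UM_cyl, Fintype.card_fun, Fintype.card_fin, mul_comm, pow_mul, Nat.cast_pow,
    ENNReal.inv_pow]

/-- each letter appears infinitely often -/
lemma letter_io (a : J) : ∀ᵐ x ∂UM J, ∀ q, ∃ p ≥ q, x p = a := by
  rw [ae_all_iff]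
  intro q
  rw [ae_iff]
  set ρ : ℝ≥0∞ := uni J {a}ᶜ with hρ
  have hρ1 : ρ < 1 := by
    rw [hρ, prob_compl_eq_one_sub .of_discrete, uni_singleton]
    exact ENNReal.sub_lt_self (by simp) (by simp) (by simp)
  have hb : ∀ n : ℕ, UM J {x | ¬ ∃ p ≥ q, x p = a} ≤ ρ ^ n := by
    intro n
    have : {x : ℕ → J | ¬ ∃ p ≥ q, x p = a} ⊆
        Set.pi (Finset.Ico q (q + n) : Finset ℕ) (fun _ => {a}ᶜ) := by
      intro x hx k hk
      simp only [Finset.coe_Ico, Set.mem_Ico] at hk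
      intro hxa
      exact hx ⟨k, hk.1, hxa⟩
    refine (measure_mono this).trans ?_
    rw [UM_pi]; simp [hρ]
  exact le_antisymm (ge_of_tendsto' (ENNReal.tendsto_pow_atTop_nhds_zero_of_lt_one hρ1) hb) bot_le

/-- each word appears infinitely often -/
lemma word_io (t : ℕ) [NeZero t] (W : Fin t → J) :
    ∀ᵐ x ∂UM J, ∀ q, ∃ p ≥ q, ∀ r : Fin t, x (p + r) = W r := by
  have h := (blkE_mp (J := J) t).quasiMeasurePreserving.ae (letter_io W)
  filter_upwards [h] with x hx q
  obtain ⟨p, hp, h2⟩ := hx q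
  refine ⟨p * t, hp.le.trans (Nat.le_mul_of_pos_right _ (NeZero.pos t)), fun r => ?_⟩
  exact congrFun h2 r

end UMsec
end FM

namespace FM

/-- completeness of a family of functions -/
def Compl {Ω Z : Type} [MeasurableSpace Ω] (μ : Measure Ω) (e : Z → Ω → ℂ) : Prop :=
  ∀ F : Ω → ℂ, Integrable F μ → (∀ z, ∫ x, e z x * F x ∂μ = 0) → F =ᵐ[μ] 0

lemma Compl.of_mp {Ω Ω' Z Z' : Type} [MeasurableSpace Ω] [MeasurableSpace Ω'] {μ : Measure Ω}
    {μ' : Measure Ω'} (Φ : Ω' ≃ᵐ Ω) (hΦ : MeasurePreserving Φ μ' μ) {e : Z → Ω → ℂ}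
    {e' : Z' → Ω' → ℂ} (s : Z' → Z) (he : ∀ z x, e' z x = e (s z) (Φ x)) (h : Compl μ' e') :
    Compl μ e := by
  intro F hF hz
  have h1 : (F ∘ Φ) =ᵐ[μ'] 0 := by
    apply h _ ((hΦ.integrable_comp_emb Φ.measurableEmbedding).2 hF)
    intro z
    rw [← hz (s z), ← hΦ.integral_comp Φ.measurableEmbedding]
    simp [he]
  have h2 := (MeasurePreserving.symm Φ hΦ).quasiMeasurePreserving.ae h1
  filter_upwards [h2] with x hx
  simpa using hx

lemma glue {Ω1 Ω2 Z1 Z2 : Type} [MeasurableSpace Ω1] [MeasurableSpace Ω2] [Countable Z2]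
    (μ1 : Measure Ω1) (μ2 : Measure Ω2) [IsProbabilityMeasure μ1] [IsProbabilityMeasure μ2]
    (e1 : Z1 → Ω1 → ℂ) (sh : Z2 → Ω1 → ℂ) (e2 : Z2 → Ω1 → Ω2 → ℂ)
    (m1 : ∀ z, Measurable (e1 z)) (ms : ∀ z, Measurable (sh z))
    (m2 : ∀ z, Measurable (fun p : Ω1 × Ω2 => e2 z p.1 p.2))
    (n1 : ∀ z x, ‖e1 z x‖ = 1) (ns : ∀ z x, ‖sh z x‖ = 1) (n2 : ∀ z x y, ‖e2 z x y‖ = 1)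
    (h1 : Compl μ1 e1) (h2 : ∀ᵐ x ∂μ1, Compl μ2 (fun z => e2 z x)) :
    Compl (μ1.prod μ2)
      (fun (z : Z1 × Z2) (p : Ω1 × Ω2) => e1 z.1 p.1 * sh z.2 p.1 * e2 z.2 p.1 p.2) := by
  intro F hF hz
  have i2 : ∀ z, Integrable (fun p : Ω1 × Ω2 => sh z p.1 * e2 z p.1 p.2 * F p) (μ1.prod μ2) := by
    intro z
    refine hF.bdd_mul (c := 1)
      (((ms z).comp measurable_fst).mul (m2 z)).aestronglyMeasurable ?_
    exact .of_forall fun p => by simp [ns, n2]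
  have i3 : ∀ z1 z, Integrable (fun p : Ω1 × Ω2 => e1 z1 p.1 * (sh z p.1 * e2 z p.1 p.2 * F p))
      (μ1.prod μ2) := by
    intro z1 z
    refine (i2 z).bdd_mul (c := 1) ((m1 z1).comp measurable_fst).aestronglyMeasurable ?_
    exact .of_forall fun p => by simp [n1]
  have hH : ∀ z, ∀ᵐ x ∂μ1, ∫ y, sh z x * e2 z x y * F (x, y) ∂μ2 = 0 := by
    intro z
    refine h1 _ (i2 z).integral_prod_left ?_
    intro z1
    have := hz (z1, z)
    simp only [mul_assoc] at this
    have i3' := i3 z1 z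
    simp only [mul_assoc] at i3'
    rw [integral_prod _ i3'] at this
    rw [← this]
    refine integral_congr_ae (.of_forall fun x => ?_)
    simp only [mul_assoc]
    simp only [integral_const_mul]
  have hH' := ae_all_iff.2 hH
  have hFx : ∀ᵐ x ∂μ1, Integrable (fun y => F (x, y)) μ2 := hF.prod_right_ae
  have hfin : ∀ᵐ x ∂μ1, ∀ᵐ y ∂μ2, F (x, y) = 0 := by
    filter_upwards [hH', hFx, h2] with x hx hFx hc
    refine hc _ hFx ?_
    intro z
    have := hx z
    simp only [mul_assoc] at this
    rw [integral_const_mul] at this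
    rcases mul_eq_zero.1 this with h0 | h0
    · have := ns z x; rw [h0] at this; simp at this
    · exact h0
  have h0 : ∀ᵐ x ∂μ1, ∫ y, ‖F (x, y)‖ ∂μ2 = 0 := by
    filter_upwards [hfin] with x hx
    rw [integral_congr_ae (g := fun _ => 0)]
    · simp
    · filter_upwards [hx] with y hy; simp [hy]
  have h00 : ∫ p, ‖F p‖ ∂(μ1.prod μ2) = 0 := by
    rw [integral_prod _ hF.norm, integral_congr_ae h0]; simp
  have := (integral_eq_zero_iff_of_nonneg (fun _ => norm_nonneg _) hF.norm).1 h00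
  filter_upwards [this] with p hp
  simpa using hp

/-- real dual -/
abbrev Du (L : Type) [AddCommGroup L] := L →ₗ[ℤ] ℝ

/-- the additive character -/
def ee (x : ℝ) : ℂ := (Real.fourierChar x : ℂ)

lemma ee_add (x y : ℝ) : ee (x + y) = ee x * ee y := by simp [ee, AddChar.map_add_eq_mul]
lemma ee_zero : ee 0 = 1 := by simp [ee]
lemma ee_norm (x : ℝ) : ‖ee x‖ = 1 := Circle.norm_coe _
lemma ee_ne (x : ℝ) : ee x ≠ 0 := by simp [ee]
lemma ee_meas : Measurable ee := by
  unfold ee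
  exact (continuous_subtype_val.comp Real.continuous_fourierChar).measurable

variable {L : Type} [AddCommGroup L]

/-- the phase -/
def theta {L : Type} [AddCommGroup L] {I J : Type} (T : Du L →ₗ[ℝ] Du L) (D : I → J → L)
    (γ : Du L) (ω : ℕ → I) (j : ℕ → J) : ℝ := ∑' k, (T ^ (k + 1)) γ (D (ω k) (j k))

/-- lattice vector -/
def lat {V ι : Type} [AddCommGroup V] [Module ℝ V] [Fintype ι] (b : ι → V) (z : ι → ℤ) : V :=
  ∑ a, (z a : ℝ) • b a

/-- summability of orbits -/
def SumT (T : Du L →ₗ[ℝ] Du L) : Prop := ∀ γ l, Summable (fun k : ℕ => |(T ^ k) γ l|)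

section
variable {I J J1 J2 : Type} [Fintype I] [Nonempty I] [MeasurableSpace I] [DiscreteMeasurableSpace I]
  [Fintype J] [Nonempty J] [MeasurableSpace J] [DiscreteMeasurableSpace J]
  [Fintype J1] [Nonempty J1] [MeasurableSpace J1] [DiscreteMeasurableSpace J1]
  [Fintype J2] [Nonempty J2] [MeasurableSpace J2] [DiscreteMeasurableSpace J2]

/-- size of a functional on the digits -/
def mx {I J : Type} [Fintype I] [Fintype J] (D : I → J → L) (γ : Du L) : ℝ :=
  ∑ i, ∑ j, |γ (D i j)|

lemma le_mx (D : I → J → L) (γ : Du L) (i : I) (j : J) : |γ (D i j)| ≤ mx D γ := by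
  unfold mx
  refine le_trans ?_ (Finset.single_le_sum (f := fun i => ∑ j, |γ (D i j)|)
    (fun i _ => Finset.sum_nonneg fun j _ => abs_nonneg _) (Finset.mem_univ i))
  exact Finset.single_le_sum (f := fun j => |γ (D i j)|) (fun j _ => abs_nonneg _)
    (Finset.mem_univ j)

lemma mx_summable {T : Du L →ₗ[ℝ] Du L} (hS : SumT T) (D : I → J → L) (γ : Du L) :
    Summable (fun k => mx D ((T ^ (k + 1)) γ)) := by
  unfold mx
  refine summable_sum fun i _ => summable_sum fun j _ => ?_
  exact (summable_nat_add_iff (f := fun k => |(T ^ k) γ (D i j)|) 1).2 (hS γ (D i j))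

/-- bound for the phase -/
def Bd {I J : Type} [Fintype I] [Fintype J] (T : Du L →ₗ[ℝ] Du L) (D : I → J → L) (γ : Du L) : ℝ :=
  ∑' k, mx D ((T ^ (k + 1)) γ)

lemma theta_summable {T : Du L →ₗ[ℝ] Du L} (hS : SumT T) (D : I → J → L) (γ : Du L)
    (ω : ℕ → I) (j : ℕ → J) : Summable (fun k => (T ^ (k + 1)) γ (D (ω k) (j k))) :=
  Summable.of_norm_bounded (mx_summable hS D γ) fun k => le_mx D _ _ _

lemma theta_bound {T : Du L →ₗ[ℝ] Du L} (hS : SumT T) (D : I → J → L) (γ : Du L)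
    (ω : ℕ → I) (j : ℕ → J) : |theta T D γ ω j| ≤ Bd T D γ := by
  rw [← Real.norm_eq_abs]
  exact tsum_of_norm_bounded (mx_summable hS D γ).hasSum fun k => le_mx D _ _ _

lemma theta_add {T : Du L →ₗ[ℝ] Du L} (hS : SumT T) (D : I → J → L) (γ γ' : Du L)
    (ω : ℕ → I) (j : ℕ → J) : theta T D (γ + γ') ω j = theta T D γ ω j + theta T D γ' ω j := by
  unfold theta
  rw [← (theta_summable hS D γ ω j).tsum_add (theta_summable hS D γ' ω j)]
  simp

lemma theta_smul {T : Du L →ₗ[ℝ] Du L} (D : I → J → L) (c : ℝ) (γ : Du L)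
    (ω : ℕ → I) (j : ℕ → J) : theta T D (c • γ) ω j = c * theta T D γ ω j := by
  unfold theta
  rw [← tsum_mul_left]
  simp

lemma theta_zero {T : Du L →ₗ[ℝ] Du L} (D : I → J → L)
    (ω : ℕ → I) (j : ℕ → J) : theta T D 0 ω j = 0 := by
  simp [theta]

lemma theta_sum {ι : Type} {T : Du L →ₗ[ℝ] Du L} (hS : SumT T) (D : I → J → L) (s : Finset ι)
    (γ : ι → Du L) (ω : ℕ → I) (j : ℕ → J) :
    theta T D (∑ a ∈ s, γ a) ω j = ∑ a ∈ s, theta T D (γ a) ω j := by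
  induction s using Finset.induction_on with
  | empty => simp [theta_zero]
  | insert a s ha ih => rw [Finset.sum_insert ha, Finset.sum_insert ha, theta_add hS, ih]

lemma theta_meas {T : Du L →ₗ[ℝ] Du L} (hS : SumT T) (D : I → J → L) (γ : Du L) :
    Measurable (fun p : (ℕ → I) × (ℕ → J) => theta T D γ p.1 p.2) := by
  have hterm : ∀ k : ℕ, Measurable (fun p : (ℕ → I) × (ℕ → J) =>
      (T ^ (k + 1)) γ (D (p.1 k) (p.2 k))) := by
    intro k
    have h1 : Measurable (fun p : (ℕ → I) × (ℕ → J) => (p.1 k, p.2 k)) := by fun_prop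
    exact (Measurable.of_discrete (f := fun q : I × J => (T ^ (k + 1)) γ (D q.1 q.2))).comp h1
  refine measurable_of_tendsto_metrizable (f := fun (n : ℕ) (p : (ℕ → I) × (ℕ → J)) =>
    ∑ k ∈ Finset.range n, (T ^ (k + 1)) γ (D (p.1 k) (p.2 k))) ?_ ?_
  · intro n
    exact Finset.measurable_fun_sum _ fun k _ => hterm k
  · rw [tendsto_pi_nhds]
    intro p
    exact (theta_summable hS D γ p.1 p.2).hasSum.tendsto_sum_nat

lemma theta_meas' {T : Du L →ₗ[ℝ] Du L} (hS : SumT T) (D : I → J → L) (γ : Du L) (ω : ℕ → I) :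
    Measurable (fun j : ℕ → J => theta T D γ ω j) :=
  (theta_meas hS D γ).comp (measurable_const.prodMk measurable_id)

/-- The conclusion: a lattice which is a common spectrum. -/
def Concl {L : Type} [AddCommGroup L] {I J : Type} [Fintype I] [Nonempty I] [MeasurableSpace I]
    [DiscreteMeasurableSpace I] [Fintype J] [Nonempty J] [MeasurableSpace J]
    [DiscreteMeasurableSpace J] (T : Du L →ₗ[ℝ] Du L) (D : I → J → L) : Prop :=
  ∃ (ι : Type) (_ : Fintype ι) (b : Module.Basis ι ℝ (Du L)),
    (∀ (ω : ℕ → I) (z : ι → ℤ), z ≠ 0 → ∫ j, ee (theta T D (lat b z) ω j) ∂(UM J) = 0) ∧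
    ∀ᵐ ω ∂(UM I), Compl (UM J) (fun (z : ι → ℤ) (j : ℕ → J) => ee (theta T D (lat b z) ω j))

end

end FM

namespace FM

/-- pull back of functionals -/
def pst {L M : Type} [AddCommGroup L] [AddCommGroup M] (f : L →ₗ[ℤ] M) : Du M →ₗ[ℝ] Du L where
  toFun γ := γ ∘ₗ f
  map_add' _ _ := rfl
  map_smul' _ _ := rfl

@[simp] lemma pst_apply {L M : Type} [AddCommGroup L] [AddCommGroup M] (f : L →ₗ[ℤ] M) (γ : Du M)
    (l : L) : pst f γ l = γ (f l) := rfl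

lemma pst_pow {L M : Type} [AddCommGroup L] [AddCommGroup M] (f : L →ₗ[ℤ] M)
    (T : Du L →ₗ[ℝ] Du L) (T' : Du M →ₗ[ℝ] Du M) (h : ∀ γ, T (pst f γ) = pst f (T' γ)) (k : ℕ)
    (γ : Du M) : (T ^ k) (pst f γ) = pst f ((T' ^ k) γ) := by
  induction k generalizing γ with
  | zero => simp
  | succ k ih => rw [pow_succ, pow_succ, Module.End.mul_apply, Module.End.mul_apply, h, ih]

lemma lat_map {V W ι : Type} [AddCommGroup V] [Module ℝ V] [AddCommGroup W] [Module ℝ W] [Fintype ι]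
    (f : V →ₗ[ℝ] W) (b : ι → V) (z : ι → ℤ) : f (lat b z) = lat (fun a => f (b a)) z := by
  simp [lat, map_sum]

section
variable {L Q B : Type} [AddCommGroup L] [AddCommGroup Q] [AddCommGroup B]
  {I J J1 J2 : Type} [Fintype I] [Nonempty I] [MeasurableSpace I] [DiscreteMeasurableSpace I]
  [Fintype J] [Nonempty J] [MeasurableSpace J] [DiscreteMeasurableSpace J]
  [Fintype J1] [Nonempty J1] [MeasurableSpace J1] [DiscreteMeasurableSpace J1]
  [Fintype J2] [Nonempty J2] [MeasurableSpace J2] [DiscreteMeasurableSpace J2]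

lemma concl_glue (π : L →ₗ[ℤ] Q) (i : B →ₗ[ℤ] L)
    (T : Du L →ₗ[ℝ] Du L) (TQ : Du Q →ₗ[ℝ] Du Q) (TB : Du B →ₗ[ℝ] Du B)
    (hS : SumT T) (hSQ : SumT TQ) (hSB : SumT TB)
    (hTQ : ∀ γ, T (pst π γ) = pst π (TQ γ)) (hTB : ∀ γ, TB (pst i γ) = pst i (T γ))
    (hπi : ∀ b, π (i b) = 0) (hinj : Function.Injective (pst π)) (hsurj : Function.Surjective (pst i))
    (hex : ∀ γ, pst i γ = 0 → ∃ γ', pst π γ' = γ)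
    (D : I → J → L) (DQ : I → J1 → Q) (rr : I → J1 → L) (DB : I × J1 → J2 → B)
    (ε : I → J1 × J2 ≃ J) (hr : ∀ a c, π (rr a c) = DQ a c)
    (hD : ∀ a c β, D a (ε a (c, β)) = rr a c + i (DB (a, c) β))
    (cQ : Concl TQ DQ) (cB : Concl TB DB) : Concl T D := by
  obtain ⟨ι1, _, b1, hO1, hC1⟩ := cQ
  obtain ⟨ι2, _, b2, hO2, hC2⟩ := cB
  obtain ⟨s, hs⟩ := (pst i).exists_rightInverse_of_surjective (LinearMap.range_eq_top.2 hsurj)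
  have hs' : ∀ γ, pst i (s γ) = γ := fun γ => LinearMap.congr_fun hs γ
  have hip : ∀ γ, pst i (pst π γ) = 0 := by
    intro γ; ext b; simp [hπi]
  have hbij : Function.Bijective ((pst π).coprod s) := by
    constructor
    · rw [← LinearMap.ker_eq_bot, LinearMap.ker_eq_bot']
      rintro ⟨g1, g2⟩ h
      simp only [LinearMap.coprod_apply] at h
      have h2 := congrArg (pst i) h
      rw [map_add, hip, hs', map_zero, zero_add] at h2
      subst h2
      rw [map_zero, add_zero, ← map_zero (pst π)] at h
      rw [hinj h]; rfl
    · intro γ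
      obtain ⟨g1, h1⟩ := hex (γ - s (pst i γ)) (by rw [map_sub, hs', sub_self])
      exact ⟨(g1, pst i γ), by simp [LinearMap.coprod_apply, h1]⟩
  let b : Module.Basis (ι1 ⊕ ι2) ℝ (Du L) := (b1.prod b2).map (LinearEquiv.ofBijective _ hbij)
  have hlat : ∀ z : ι1 ⊕ ι2 → ℤ, lat b z =
      pst π (lat b1 (z ∘ Sum.inl)) + s (lat b2 (z ∘ Sum.inr)) := by
    intro z
    rw [lat_map, lat_map]
    simp [lat, b, Module.Basis.map_apply]
  have hTQk := pst_pow π T TQ hTQ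
  have hTBk := pst_pow i TB T hTB
  have hth : ∀ (g1 : Du Q) (g2 : Du B) (ω : ℕ → I) (x : ℕ → J1) (y : ℕ → J2),
      theta T D (pst π g1 + s g2) ω (fun k => ε (ω k) (x k, y k)) =
      theta TQ DQ g1 ω x + theta T rr (s g2) ω x + theta TB DB g2 (fun k => (ω k, x k)) y := by
    intro g1 g2 ω x y
    unfold theta
    rw [← (theta_summable hSQ DQ g1 ω x).tsum_add (theta_summable hS rr (s g2) ω x),
      ← ((theta_summable hSQ DQ g1 ω x).add (theta_summable hS rr (s g2) ω x)).tsum_add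
        (theta_summable hSB DB g2 (fun k => (ω k, x k)) y)]
    congr 1; funext k
    have h1 : (TB ^ (k + 1)) g2 = pst i ((T ^ (k + 1)) (s g2)) := by rw [← hTBk, hs']
    rw [hD, map_add, map_add, hTQk, h1, LinearMap.add_apply, LinearMap.add_apply]
    simp only [pst_apply, hπi, hr, map_zero]
    ring
  have hee : ∀ (z : ι1 ⊕ ι2 → ℤ) (ω : ℕ → I) (x : ℕ → J1) (y : ℕ → J2),
      ee (theta T D (lat b z) ω (fun k => ε (ω k) (x k, y k))) =
      ee (theta TQ DQ (lat b1 (z ∘ Sum.inl)) ω x) * ee (theta T rr (s (lat b2 (z ∘ Sum.inr))) ω x) *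
      ee (theta TB DB (lat b2 (z ∘ Sum.inr)) (fun k => (ω k, x k)) y) := by
    intro z ω x y
    rw [hlat, hth, ee_add, ee_add]
  let Φ : (ℕ → I) → ((ℕ → J1) × (ℕ → J2)) ≃ᵐ (ℕ → J) := fun ω =>
    (zipE J1 J2).trans (relE fun k => ε (ω k))
  have hΦ : ∀ ω, MeasurePreserving (Φ ω) ((UM J1).prod (UM J2)) (UM J) := fun ω =>
    zipE_mp.trans (relE_mp _)
  have hΦa : ∀ ω p, Φ ω p = fun k => ε (ω k) (p.1 k, p.2 k) := fun _ _ => rfl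
  refine ⟨ι1 ⊕ ι2, inferInstance, b, ?_, ?_⟩
  · intro ω z hz
    rw [← (hΦ ω).integral_comp (Φ ω).measurableEmbedding]
    simp only [hΦa, hee]
    rw [integral_prod]
    · by_cases h2 : z ∘ Sum.inr = 0
      · have h1 : z ∘ Sum.inl ≠ 0 := by
          intro h1
          apply hz
          funext a
          rcases a with a | a
          · exact congrFun h1 a
          · exact congrFun h2 a
        have hl0 : lat b2 (0 : ι2 → ℤ) = 0 := by simp [lat]
        simp only [h2, hl0, map_zero, theta_zero, ee_zero, mul_one]
        simp only [integral_const, probReal_univ, one_smul]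
        exact hO1 ω _ h1
      · simp only [integral_const_mul, hO2 _ _ h2, mul_zero, integral_zero]
    · refine Integrable.of_bound (C := 1) ?_ (.of_forall fun p => by simp [ee_norm])
      refine Measurable.aestronglyMeasurable ?_
      refine ((ee_meas.comp ((theta_meas' hSQ DQ _ ω).comp measurable_fst)).mul
        (ee_meas.comp ((theta_meas' hS rr _ ω).comp measurable_fst))).mul
        (ee_meas.comp ?_)
      exact (theta_meas hSB DB _).comp (by fun_prop : Measurable (fun p : (ℕ → J1) × (ℕ → J2) =>
        ((fun k => (ω k, p.1 k), p.2) : (ℕ → I × J1) × (ℕ → J2))))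
  · have hC2' := (zipE_mp (J1 := I) (J2 := J1)).quasiMeasurePreserving.ae hC2
    have hC2'' := Measure.ae_ae_of_ae_prod hC2'
    filter_upwards [hC1, hC2''] with ω h1 h2
    refine Compl.of_mp (Φ ω) (hΦ ω) (fun z : (ι1 → ℤ) × (ι2 → ℤ) => Sum.elim z.1 z.2) ?_
      (glue (UM J1) (UM J2) _ (fun z x => ee (theta T rr (s (lat b2 z)) ω x))
        (fun z x y => ee (theta TB DB (lat b2 z) (fun k => (ω k, x k)) y))
        ?_ ?_ ?_ (fun _ _ => ee_norm _) (fun _ _ => ee_norm _) (fun _ _ _ => ee_norm _) h1 h2)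
    · rintro ⟨z1, z2⟩ ⟨x, y⟩
      rw [hΦa, hee]
      simp
    · intro z; exact ee_meas.comp (theta_meas' hSQ DQ _ ω)
    · intro z; exact ee_meas.comp (theta_meas' hS rr _ ω)
    · intro z
      exact ee_meas.comp ((theta_meas hSB DB _).comp
        (by fun_prop : Measurable (fun p : (ℕ → J1) × (ℕ → J2) =>
        ((fun k => (ω k, p.1 k), p.2) : (ℕ → I × J1) × (ℕ → J2)))))
end
end FM

namespace FM

/-- digit systems -/
structure IsSys {L : Type} [AddCommGroup L] {I J : Type} (R : L →ₗ[ℤ] L) (T : Du L →ₗ[ℝ] Du L)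
    (D : I → J → L) : Prop where
  hT : ∀ γ, pst R (T γ) = γ
  hT' : ∀ γ, T (pst R γ) = γ
  hS : SumT T
  hD : ∀ i l, ∃! j, ∃ k, l - D i j = R k

instance du_finite {L : Type} [AddCommGroup L] [Module.Finite ℤ L] : Module.Finite ℝ (Du L) := by
  obtain ⟨n, f, hf⟩ := Module.Finite.exists_fin' ℤ L
  let g : Du L →ₗ[ℝ] (Fin n → ℝ) :=
    { toFun := fun γ a => γ (f (Pi.single a 1))
      map_add' := fun _ _ => rfl
      map_smul' := fun _ _ => rfl }
  refine Module.Finite.of_injective g ?_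
  rw [← LinearMap.ker_eq_bot, LinearMap.ker_eq_bot']
  intro γ hγ
  have h0 : γ ∘ₗ f = 0 := by
    refine (Pi.basisFun ℤ (Fin n)).ext fun a => ?_
    have := congrFun hγ a
    simp only [Pi.basisFun_apply, LinearMap.comp_apply]
    exact this
  ext l
  obtain ⟨x, rfl⟩ := hf l
  exact LinearMap.congr_fun h0 x

lemma pst_surj {B L : Type} [AddCommGroup L] [AddCommGroup B] (i : B →ₗ[ℤ] L)
    (hi : Function.Injective i) : Function.Surjective (pst i) := by
  intro γ
  have : DivisibleBy ℝ ℤ := 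
    { div := fun x n => (n : ℝ)⁻¹ * x
      div_zero := fun x => by simp
      div_cancel := fun {n} x hn => by
        have : (n : ℝ) ≠ 0 := by exact_mod_cast hn
        simp only [zsmul_eq_mul]
        field_simp }
  obtain ⟨h, hh⟩ := (Module.Baer.of_divisible ℝ).extension_property i hi γ
  exact ⟨h, hh⟩

section
variable {L Q B : Type} [AddCommGroup L] [AddCommGroup Q] [AddCommGroup B] [Module.Finite ℤ L]
  {I J : Type} [Fintype I] [Nonempty I] [MeasurableSpace I] [DiscreteMeasurableSpace I]
  [Fintype J] [Nonempty J] [MeasurableSpace J] [DiscreteMeasurableSpace J]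

lemma inv_exists {M : Type} [AddCommGroup M] [Module.Finite ℤ M] (R : M →ₗ[ℤ] M)
    (h : Function.Surjective (pst R) ∨ Function.Injective (pst R)) :
    ∃ T : Du M →ₗ[ℝ] Du M, (∀ γ, pst R (T γ) = γ) ∧ (∀ γ, T (pst R γ) = γ) := by
  have hb : Function.Bijective (pst R) := by
    rcases h with h | h
    · exact ⟨LinearMap.injective_iff_surjective.2 h, h⟩
    · exact ⟨h, LinearMap.injective_iff_surjective.1 h⟩
  let e := LinearEquiv.ofBijective _ hb
  exact ⟨e.symm.toLinearMap, fun γ => e.apply_symm_apply γ, fun γ => e.symm_apply_apply γ⟩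

lemma concl_QP {R : L →ₗ[ℤ] L} {T : Du L →ₗ[ℝ] Du L} {D : I → J → L} (h : IsSys R T D)
    (π : L →ₗ[ℤ] Q) (i : B →ₗ[ℤ] L) (hπ : Function.Surjective π) (hi : Function.Injective i)
    (hπi : ∀ b, π (i b) = 0) (hex : ∀ l, π l = 0 → ∃ b, i b = l)
    (RB : B →ₗ[ℤ] B) (hRB : ∀ b, i (RB b) = R (i b))
    (RQ : Q →ₗ[ℤ] Q) (hRQ : ∀ l, RQ (π l) = π (R l))
    (sat : ∀ l, π (R l) = 0 → π l = 0)
    (QP : ∀ a j j', (∃ k, π (D a j) - π (D a j') = RQ k) → π (D a j) = π (D a j'))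
    (HQ : ∀ (J1 : Type) [Fintype J1] [Nonempty J1] [MeasurableSpace J1] [DiscreteMeasurableSpace J1]
      (TQ : Du Q →ₗ[ℝ] Du Q) (DQ : I → J1 → Q), IsSys RQ TQ DQ → Concl TQ DQ)
    (HB : ∀ (J1 J2 : Type) [Fintype J1] [Nonempty J1] [MeasurableSpace J1]
      [DiscreteMeasurableSpace J1]
      [Fintype J2] [Nonempty J2] [MeasurableSpace J2] [DiscreteMeasurableSpace J2]
      (TB : Du B →ₗ[ℝ] Du B) (DB : I × J1 → J2 → B), IsSys RB TB DB →
      (∀ a j j', π (D a j) = π (D a j') → ∃ p β β', i (DB p β - DB p β') = D a j - D a j') →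
      Concl TB DB) : Concl T D := by
  have : Module.Finite ℤ Q := Module.Finite.of_surjective π hπ
  have : Module.Finite ℤ B := Module.Finite.of_injective i hi
  -- the maps T
  have hsurj := pst_surj i hi
  have hinj : Function.Injective (pst π) := by
    intro g g' hg
    ext q
    obtain ⟨l, rfl⟩ := hπ q
    exact LinearMap.congr_fun hg l
  have cB : ∀ γ, pst i (pst R γ) = pst RB (pst i γ) := by
    intro γ; ext b; simp [hRB]
  have cQ : ∀ γ, pst R (pst π γ) = pst π (pst RQ γ) := by
    intro γ; ext b; simp [hRQ]
  obtain ⟨TB, hB1, hB2⟩ := inv_exists RB (Or.inl (by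
    intro g
    obtain ⟨g', rfl⟩ := hsurj g
    exact ⟨pst i (T g'), by rw [← cB, h.hT]⟩))
  obtain ⟨TQ, hQ1, hQ2⟩ := inv_exists RQ (Or.inr (by
    intro g g' hg
    apply hinj
    have := congrArg (fun x => T (pst π x)) hg
    simpa only [← cQ, h.hT'] using this))
  have hTB : ∀ γ, TB (pst i γ) = pst i (T γ) := by
    intro γ
    conv_lhs => rw [← h.hT γ, cB, hB2]
  have hTQ : ∀ γ, T (pst π γ) = pst π (TQ γ) := by
    intro γ
    conv_lhs => rw [← hQ1 γ, ← cQ, h.hT']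
  have hSB : SumT TB := by
    intro γ b
    obtain ⟨γ, rfl⟩ := hsurj γ
    simpa only [pst_pow i TB T hTB, pst_apply] using h.hS γ (i b)
  have hSQ : SumT TQ := by
    intro γ q
    obtain ⟨l, rfl⟩ := hπ q
    simpa only [pst_pow π T TQ hTQ, pst_apply] using h.hS (pst π γ) l
  have hexd : ∀ γ, pst i γ = 0 → ∃ γ', pst π γ' = γ := by
    intro γ hγ
    have hk : ∀ l l', π l = π l' → γ l = γ l' := by
      intro l l' hl
      obtain ⟨b, hb⟩ := hex (l - l') (by rw [map_sub, hl, sub_self])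
      have := LinearMap.congr_fun hγ b
      simp only [pst_apply, hb, map_sub, LinearMap.zero_apply] at this
      linarith
    let s := Function.surjInv hπ
    have hs : ∀ q, π (s q) = q := Function.surjInv_eq hπ
    let g : Q →+ ℝ := AddMonoidHom.mk' (fun q => γ (s q)) (by
      intro q q'
      rw [← map_add]
      apply hk
      simp [hs])
    refine ⟨g.toIntLinearMap, ?_⟩
    ext l
    exact hk _ _ (hs _)
  -- digits
  choose res hres hresu using fun a l => (h.hD a l)
  simp only at hres hresu
  let J1 : Type := Q ⧸ RQ.toAddMonoidHom.range
  let J2 : Type := B ⧸ RB.toAddMonoidHom.range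
  have eq1 : ∀ q q' : Q, ((q : J1) = (q' : J1)) ↔ ∃ k, q - q' = RQ k := by
    intro q q'
    rw [QuotientAddGroup.eq_iff_sub_mem]
    exact ⟨fun ⟨k, hk⟩ => ⟨k, hk.symm⟩, fun ⟨k, hk⟩ => ⟨k, hk.symm⟩⟩
  have eq2 : ∀ q q' : B, ((q : J2) = (q' : J2)) ↔ ∃ k, q - q' = RB k := by
    intro q q'
    rw [QuotientAddGroup.eq_iff_sub_mem]
    exact ⟨fun ⟨k, hk⟩ => ⟨k, hk.symm⟩, fun ⟨k, hk⟩ => ⟨k, hk.symm⟩⟩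
  let o1 : J1 → Q := fun c => Quotient.out c
  let o2 : J2 → B := fun c => Quotient.out c
  have ho1 : ∀ c, (QuotientAddGroup.mk (o1 c) : J1) = c := fun c => QuotientAddGroup.out_eq' c
  have ho2 : ∀ c, (QuotientAddGroup.mk (o2 c) : J2) = c := fun c => QuotientAddGroup.out_eq' c
  let rr : I → J1 → L := fun a c => D a (res a (Function.surjInv hπ (o1 c)))
  have hrr : ∀ a c, (QuotientAddGroup.mk (π (rr a c)) : J1) = c := by
    intro a c
    conv_rhs => rw [← ho1 c]
    rw [eq_comm, eq1]
    obtain ⟨k, hk⟩ := hres a (Function.surjInv hπ (o1 c))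
    refine ⟨π k, ?_⟩
    rw [hRQ, ← hk, map_sub, Function.surjInv_eq hπ]
  have hrrj : ∀ a c, ∃ j, rr a c = D a j := fun a c => ⟨_, rfl⟩
  let jj : I → J1 → J2 → J := fun a c β => res a (rr a c + i (o2 β))
  have hDB : ∀ a c β, ∃ b : B, i b = D a (jj a c β) - rr a c ∧ ∃ k, b - o2 β = RB k := by
    intro a c β
    obtain ⟨k, hk⟩ := hres a (rr a c + i (o2 β))
    change rr a c + i (o2 β) - D a (jj a c β) = R k at hk
    have h1 : π (rr a c) = π (D a (jj a c β)) := by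
      obtain ⟨j, hj⟩ := hrrj a c
      rw [hj]
      refine QP _ _ _ ⟨π k, ?_⟩
      rw [hRQ, ← hk, map_sub, map_add, hπi, hj]; abel
    obtain ⟨b, hb⟩ := hex (D a (jj a c β) - rr a c) (by rw [map_sub, h1, sub_self])
    refine ⟨b, hb, ?_⟩
    have h2 : R k = i (o2 β - b) := by rw [← hk, map_sub, hb]; abel
    obtain ⟨k', rfl⟩ := hex k (sat k (by rw [h2, hπi]))
    refine ⟨-k', hi ?_⟩
    rw [hRB, map_neg, map_neg, h2, ← map_neg, neg_sub]
  choose DB' hDB1 hDB2 using hDB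
  have hbij : ∀ a, Function.Bijective (fun p : J1 × J2 => jj a p.1 p.2) := by
    intro a
    have hc : ∀ c β, (QuotientAddGroup.mk (π (D a (jj a c β))) : J1) = c := by
      intro c β
      have := congrArg π (hDB1 a c β)
      rw [hπi, map_sub, eq_comm, sub_eq_zero] at this
      rw [this, hrr]
    constructor
    · rintro ⟨c, β⟩ ⟨c', β'⟩ hj
      simp only at hj
      have h1 : c = c' := by rw [← hc c β, hj, hc]
      subst h1
      have h2 : DB' a c β = DB' a c β' := hi (by rw [hDB1, hDB1, hj])
      have h3 : β = β' := by
        rw [← ho2 β, ← ho2 β', ← (eq2 _ _).2 (hDB2 a c β), ← (eq2 _ _).2 (hDB2 a c β'), h2]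
      rw [h3]
    · intro j
      let c : J1 := QuotientAddGroup.mk (π (D a j))
      have h1 : π (D a j) = π (rr a c) := by
        obtain ⟨j', hj'⟩ := hrrj a c
        rw [hj']
        apply QP
        rw [← hj', ← eq1, hrr]
      obtain ⟨b, hb⟩ := hex (D a j - rr a c) (by rw [map_sub, h1, sub_self])
      let β : J2 := QuotientAddGroup.mk b
      refine ⟨(c, β), ?_⟩
      obtain ⟨k, hk⟩ := (eq2 (o2 β) b).1 (ho2 β)
      refine (hresu a _ j ⟨i k, ?_⟩).symm
      rw [← hRB, ← hk, map_sub, hb]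
      simp only; abel
  let a0 : I := Classical.arbitrary I
  have : Finite (J1 × J2) := Finite.of_injective _ (hbij a0).1
  haveI : Nonempty J1 := ⟨QuotientAddGroup.mk 0⟩
  haveI : Nonempty J2 := ⟨QuotientAddGroup.mk 0⟩
  have f1 : Finite J1 := Finite.of_surjective (Prod.fst : J1 × J2 → J1) Prod.fst_surjective
  have f2 : Finite J2 := Finite.of_surjective (Prod.snd : J1 × J2 → J2) Prod.snd_surjective
  letI : Fintype J1 := Fintype.ofFinite _
  letI : Fintype J2 := Fintype.ofFinite _
  letI : MeasurableSpace J1 := ⊤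
  letI : MeasurableSpace J2 := ⊤
  haveI : DiscreteMeasurableSpace J1 := ⟨fun _ => trivial⟩
  haveI : DiscreteMeasurableSpace J2 := ⟨fun _ => trivial⟩
  let DB : I × J1 → J2 → B := fun p => DB' p.1 p.2
  let DQ : I → J1 → Q := fun a c => π (rr a c)
  have sQ : IsSys RQ TQ DQ := ⟨hQ1, hQ2, hSQ, by
    intro a q
    refine ⟨QuotientAddGroup.mk q, ?_, ?_⟩
    · exact (eq1 _ _).1 (hrr _ _).symm
    · intro c hc
      exact ((eq1 _ _).2 hc |>.trans (hrr _ _)).symm⟩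
  have sB : IsSys RB TB DB := ⟨hB1, hB2, hSB, by
    rintro ⟨a, c⟩ b
    have hm : ∀ β, (QuotientAddGroup.mk (DB' a c β) : J2) = β := by
      intro β
      rw [(eq2 _ _).2 (hDB2 a c β), ho2]
    refine ⟨QuotientAddGroup.mk b, ?_, ?_⟩
    · exact (eq2 _ _).1 (hm _).symm
    · intro c hc
      exact ((eq2 _ _).2 hc |>.trans (hm _)).symm⟩
  refine concl_glue π i T TQ TB h.hS hSQ hSB hTQ hTB hπi hinj hsurj hexd D DQ rr DB
    (fun a => Equiv.ofBijective _ (hbij a)) (fun _ _ => rfl) ?_ (HQ J1 TQ DQ sQ)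
    (HB J1 J2 TB DB sB ?_)
  · intro a c β
    show D a (jj a c β) = rr a c + i (DB' a c β)
    rw [hDB1]; abel
  · intro a j j' hjj
    obtain ⟨⟨c, β⟩, rfl⟩ := (hbij a).2 j
    obtain ⟨⟨c', β'⟩, rfl⟩ := (hbij a).2 j'
    have hc : ∀ c β, (QuotientAddGroup.mk (π (D a (jj a c β))) : J1) = c := by
      intro c β
      have := congrArg π (hDB1 a c β)
      rw [hπi, map_sub, eq_comm, sub_eq_zero] at this
      rw [this, hrr]
    simp only at hjj
    have : c = c' := by rw [← hc c β, hjj, hc]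
    subst this
    refine ⟨(a, c), β, β', ?_⟩
    show i (DB' a c β - DB' a c β') = _
    rw [map_sub, hDB1, hDB1]; abel
end
end FM

namespace FM

section
variable {L : Type} [AddCommGroup L]
  {I J : Type} [Fintype I] [Nonempty I] [MeasurableSpace I] [DiscreteMeasurableSpace I]
  [Fintype J] [Nonempty J] [MeasurableSpace J] [DiscreteMeasurableSpace J]

/-- digits of the power system -/
def pwD {L I J : Type} [AddCommGroup L] (R : L →ₗ[ℤ] L) (D : I → J → L) (m : ℕ) (i : Fin m → I)
    (j : Fin m → J) : L :=
  ∑ r : Fin m, (R ^ (m - 1 - (r : ℕ))) (D (i r) (j r))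

lemma pwD_succ (R : L →ₗ[ℤ] L) (D : I → J → L) (m : ℕ) (i : Fin (m + 1) → I)
    (j : Fin (m + 1) → J) : pwD R D (m + 1) i j =
    R (pwD R D m (fun r => i r.castSucc) (fun r => j r.castSucc)) + 
      D (i (Fin.last m)) (j (Fin.last m)) := by
  unfold pwD
  rw [Fin.sum_univ_castSucc, map_sum]
  congr 1
  · refine Finset.sum_congr rfl fun r _ => ?_
    rw [← Module.End.mul_apply, ← pow_succ']
    congr 2
    have := r.2
    simp; omega
  · simp

lemma IsSys.pow_hT {R : L →ₗ[ℤ] L} {T : Du L →ₗ[ℝ] Du L} {D : I → J → L} (h : IsSys R T D) (m : ℕ)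
    (γ : Du L) (l : L) : (T ^ m) γ ((R ^ m) l) = γ l := by
  induction m generalizing l with
  | zero => simp
  | succ m ih =>
    rw [pow_succ' T, pow_succ R, Module.End.mul_apply, Module.End.mul_apply]
    have : ∀ γ l, T γ (R l) = γ l := fun γ l => LinearMap.congr_fun (h.hT γ) l
    rw [← Module.End.mul_apply (R ^ m), ← pow_succ, pow_succ', Module.End.mul_apply, this, ih]

lemma IsSys.pow_hT2 {R : L →ₗ[ℤ] L} {T : Du L →ₗ[ℝ] Du L} {D : I → J → L} (h : IsSys R T D)
    (m k : ℕ) (γ : Du L) (l : L) : (T ^ (k + m)) γ ((R ^ m) l) = (T ^ k) γ l := by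
  rw [add_comm, pow_add, Module.End.mul_apply, h.pow_hT]

lemma IsSys.pow_hD {R : L →ₗ[ℤ] L} {T : Du L →ₗ[ℝ] Du L} {D : I → J → L} (h : IsSys R T D)
    (hR : Function.Injective R) (m : ℕ) (i : Fin m → I) (l : L) :
    ∃! j, ∃ k, l - pwD R D m i j = (R ^ m) k := by
  induction m generalizing l with
  | zero => 
    refine ⟨Fin.elim0, ⟨l, by simp [pwD]⟩, fun j _ => Subsingleton.elim _ _⟩
  | succ m ih =>
    obtain ⟨a, ⟨k, hk⟩, ha⟩ := h.hD (i (Fin.last m)) l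
    obtain ⟨w, ⟨k', hk'⟩, hw⟩ := ih (fun r => i r.castSucc) k
    refine ⟨Fin.snoc w a, ⟨k', ?_⟩, ?_⟩
    · rw [pwD_succ]
      simp only [Fin.snoc_castSucc, Fin.snoc_last]
      rw [pow_succ', Module.End.mul_apply, ← hk', map_sub, ← hk]; abel
    · rintro j ⟨k2, hk2⟩
      rw [pwD_succ, pow_succ', Module.End.mul_apply] at hk2
      have h1 : j (Fin.last m) = a := ha _ ⟨_, by
        rw [show l - D (i (Fin.last m)) (j (Fin.last m)) =
          R ((R ^ m) k2 + (pwD R D m (fun r => i r.castSucc) (fun r => j r.castSucc))) by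
            rw [map_add, ← hk2]; abel]⟩
      have h2 : (fun r : Fin m => j r.castSucc) = w := by
        refine hw _ ⟨k2, hR ?_⟩
        rw [← hk2, map_sub, ← hk, h1]; abel
      rw [← h1, ← h2]
      funext r
      refine Fin.lastCases ?_ (fun r => ?_) r <;> simp

lemma IsSys.pow {R : L →ₗ[ℤ] L} {T : Du L →ₗ[ℝ] Du L} {D : I → J → L} (h : IsSys R T D)
    (hR : Function.Injective R) (m : ℕ) [NeZero m] : IsSys (R ^ m) (T ^ m) (pwD R D m) := by
  refine ⟨fun γ => ?_, fun γ => ?_, ?_, h.pow_hD hR m⟩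
  · ext l; simp [h.pow_hT]
  · induction m generalizing γ with
    | zero => rfl
    | succ m ih =>
      by_cases hm : m = 0
      · subst hm; simpa using h.hT' γ
      · haveI : NeZero m := ⟨hm⟩
        have : pst (R ^ (m + 1)) γ = pst (R ^ m) (pst R γ) := by
          ext l; simp [pow_succ']
        rw [this, pow_succ', Module.End.mul_apply, ih, h.hT']
  · intro γ l
    have := (h.hS γ l).comp_injective (i := fun k : ℕ => m * k)
      (fun a b hab => Nat.eq_of_mul_eq_mul_left (NeZero.pos m) hab)
    simpa only [Function.comp_def, pow_mul] using this

lemma theta_pow {R : L →ₗ[ℤ] L} {T : Du L →ₗ[ℝ] Du L} {D : I → J → L} (h : IsSys R T D)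
    (m : ℕ) [NeZero m] (γ : Du L) (ω : ℕ → I) (j : ℕ → J) :
    theta (T ^ m) (pwD R D m) γ (blkE m I ω) (blkE m J j) = theta T D γ ω j := by
  unfold theta
  have hs := theta_summable h.hS D γ ω j
  rw [← (Nat.divModEquiv m).symm.tsum_eq (fun k => (T ^ (k + 1)) γ (D (ω k) (j k)))]
  have hs' := ((Nat.divModEquiv m).symm.summable_iff (f := fun k => (T ^ (k + 1)) γ (D (ω k) (j k)))).2 hs
  rw [Summable.tsum_prod (by exact hs')]
  refine tsum_congr fun q => ?_
  rw [tsum_fintype]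
  unfold pwD
  rw [map_sum]
  refine Finset.sum_congr rfl fun r _ => ?_
  show ((T ^ m) ^ (q + 1)) γ ((R ^ (m - 1 - (r : ℕ))) (D (ω (q * m + r)) (j (q * m + r)))) = 
    (T ^ (_ + 1)) γ (D (ω _) (j _))
  have e : (Nat.divModEquiv m).symm (q, r) = q * m + r := rfl
  rw [e, ← pow_mul, show m * (q + 1) = (q * m + r + 1) + (m - 1 - (r : ℕ)) by
    have := r.2; rw [mul_add, mul_comm m q]; omega, h.pow_hT2]

lemma concl_pow {R : L →ₗ[ℤ] L} {T : Du L →ₗ[ℝ] Du L} {D : I → J → L} (h : IsSys R T D)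
    (m : ℕ) [NeZero m] (hc : Concl (T ^ m) (pwD R D m)) : Concl T D := by
  obtain ⟨ι, _, b, hO, hC⟩ := hc
  refine ⟨ι, inferInstance, b, ?_, ?_⟩
  · intro ω z hz
    rw [← hO (blkE m I ω) z hz, ← (blkE_mp (J := J) m).integral_comp']
    simp only [theta_pow h]
  · filter_upwards [(blkE_mp (J := I) m).quasiMeasurePreserving.ae hC] with ω hω
    refine Compl.of_mp (blkE m J).symm (MeasurePreserving.symm _ (blkE_mp (J := J) m)) id ?_ hω
    intro z x
    obtain ⟨y, rfl⟩ := (blkE m J).surjective x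
    rw [theta_pow h, MeasurableEquiv.symm_apply_apply]
    rfl

lemma sep [Module.Free ℤ L] [Module.Finite ℤ L] (l : L) (hl : ∀ γ : Du L, γ l = 0) : l = 0 := by
  let b := Module.Free.chooseBasis ℤ L
  apply b.ext_elem
  intro a
  have := hl ((Int.castAddHom ℝ).toIntLinearMap ∘ₗ b.coord a)
  simpa using this

lemma IsSys.inj [Module.Free ℤ L] [Module.Finite ℤ L] {R : L →ₗ[ℤ] L} {T : Du L →ₗ[ℝ] Du L}
    {D : I → J → L} (h : IsSys R T D) : Function.Injective R := by
  rw [← LinearMap.ker_eq_bot, LinearMap.ker_eq_bot']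
  intro l hl
  refine sep l fun γ => ?_
  rw [← h.hT γ]; simp [hl]
end
end FM

namespace FM

lemma ee_exp (x : ℝ) : ee x = Complex.exp (2 * Real.pi * x * Complex.I) := by
  simp [ee, Real.fourierChar_apply]

lemma ee_eq_one (x : ℝ) : ee x = 1 ↔ ∃ n : ℤ, x = n := by
  rw [ee_exp, Complex.exp_eq_one_iff]
  constructor
  · rintro ⟨n, hn⟩
    refine ⟨n, ?_⟩
    have hpi : (2 * Real.pi * Complex.I : ℂ) ≠ 0 := Complex.two_pi_I_ne_zero
    have : (2 * Real.pi * Complex.I : ℂ) * (x : ℂ) = (2 * Real.pi * Complex.I : ℂ) * (n : ℂ) := by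
      rw [← mul_comm (n : ℂ), ← hn]; ring
    exact_mod_cast mul_left_cancel₀ hpi this
  · rintro ⟨n, rfl⟩
    exact ⟨n, by push_cast; ring⟩

section torus
variable {Ω ι : Type} [MeasurableSpace Ω] [StandardBorelSpace Ω] [Fintype ι]

lemma compl_torus (μ : Measure Ω) [IsProbabilityMeasure μ] (X : Ω → ι → UnitAddCircle)
    (hX : Measurable X) (S : Set Ω) (hS : MeasurableSet S) (hS1 : ∀ᵐ x ∂μ, x ∈ S)
    (hinj : Set.InjOn X S) :
    Compl μ (fun (z : ι → ℤ) x => UnitAddTorus.mFourier z (X x)) := by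
  intro F hF hz
  have hIntg : ∀ g : C(ι → UnitAddCircle, ℂ), Integrable (fun x => g (X x) * F x) μ := by
    intro g
    refine hF.bdd_mul (c := ‖g‖) ?_ (.of_forall fun x => g.norm_coe_le_norm _)
    exact (g.continuous.measurable.comp hX).aestronglyMeasurable
  let Λ : C(ι → UnitAddCircle, ℂ) →ₗ[ℂ] ℂ :=
    { toFun := fun g => ∫ x, g (X x) * F x ∂μ
      map_add' := fun g g' => by
        rw [← integral_add (hIntg g) (hIntg g')]
        simp [add_mul]
      map_smul' := fun c g => by
        simp only [ContinuousMap.smul_apply, smul_eq_mul, RingHom.id_apply, mul_assoc]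
        rw [integral_const_mul] }
  let Λ' : C(ι → UnitAddCircle, ℂ) →L[ℂ] ℂ := Λ.mkContinuous (∫ x, ‖F x‖ ∂μ) (by
    intro g
    refine (norm_integral_le_integral_norm _).trans ?_
    rw [mul_comm, ← integral_const_mul]
    refine integral_mono (hIntg g).norm (hF.norm.const_mul _) fun x => ?_
    simp only [norm_mul]
    gcongr
    exact g.norm_coe_le_norm _)
  have h0 : ∀ g : C(ι → UnitAddCircle, ℂ), ∫ x, g (X x) * F x ∂μ = 0 := by
    have h1 : Submodule.span ℂ (Set.range (UnitAddTorus.mFourier (d := ι))) ≤ LinearMap.ker Λ'.toLinearMap := by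
      rw [Submodule.span_le]
      rintro _ ⟨z, rfl⟩
      exact hz z
    have h2 := Submodule.topologicalClosure_minimal _ h1 Λ'.isClosed_ker
    rw [UnitAddTorus.span_mFourier_closure_eq_top] at h2
    intro g
    exact h2 (Submodule.mem_top (x := g))
  have hall : ∫ x, F x ∂μ = 0 := by simpa using h0 1
  have hK : ∀ K : Set (ι → UnitAddCircle), MeasurableSet K → ∫ x in X ⁻¹' K, F x ∂μ = 0 := by
    intro K hK
    refine MeasurableSpace.induction_on_inter (C := fun K _ => ∫ x in X ⁻¹' K, F x ∂μ = 0)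
      (BorelSpace.measurable_eq.trans borel_eq_generateFrom_isClosed) isPiSystem_isClosed ?_ ?_ ?_ ?_ K hK
    · simp
    · intro K hK
      have hK : IsClosed K := by simpa using hK
      have ht : Tendsto (fun n => ∫ x, ((hK.apprSeq n (X x) : ℝ) : ℂ) * F x ∂μ) atTop
          (nhds (∫ x, Set.indicator (X ⁻¹' K) F x ∂μ)) := by
        refine tendsto_integral_of_dominated_convergence (fun x => ‖F x‖) ?_ hF.norm ?_ ?_
        · intro n
          refine AEStronglyMeasurable.mul ?_ hF.1
          have : Continuous (fun y => ((hK.apprSeq n y : ℝ) : ℂ)) := by fun_prop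
          exact (this.measurable.comp hX).aestronglyMeasurable
        · intro n
          refine .of_forall fun x => ?_
          rw [norm_mul]
          refine mul_le_of_le_one_left (norm_nonneg _) ?_
          simpa using HasOuterApproxClosed.apprSeq_apply_le_one hK n (X x)
        · refine .of_forall fun x => ?_
          have := tendsto_pi_nhds.1 (HasOuterApproxClosed.tendsto_apprSeq hK) (X x)
          have h3 : Tendsto (fun n => ((hK.apprSeq n (X x) : ℝ) : ℂ)) atTop
            (nhds (((Set.indicator K (fun _ => (1 : NNReal)) (X x) : NNReal) : ℝ) : ℂ)) := by
            have hc : Continuous (fun y : NNReal => ((y : ℝ) : ℂ)) := by fun_prop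
            exact (hc.tendsto _).comp this
          have h4 := h3.mul_const (F x)
          convert h4 using 2
          by_cases hx : X x ∈ K <;> simp [hx]
      rw [integral_indicator (hX hK.measurableSet)] at ht
      refine tendsto_nhds_unique ht ?_
      have : ∀ n, ∫ x, ((hK.apprSeq n (X x) : ℝ) : ℂ) * F x ∂μ = 0 := by
        intro n
        exact h0 ⟨fun y => ((hK.apprSeq n y : ℝ) : ℂ), by fun_prop⟩
      simp [this]
    · intro K hK ih
      have := integral_add_compl (hX hK) hF
      rw [ih, zero_add, hall] at this
      exact this
    · intro f hd hf ih
      rw [Set.preimage_iUnion, integral_iUnion (fun n => hX (hf n))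
        (fun a b hab => (hd hab).preimage X) hF.integrableOn]
      simp [ih]
  refine hF.ae_eq_zero_of_forall_setIntegral_eq_zero ?_
  intro C hC _
  have hm : MeasurableSet (X '' (C ∩ S)) :=
    (hC.inter hS).image_of_measurable_injOn hX (hinj.mono Set.inter_subset_right)
  rw [← hK _ hm]
  refine setIntegral_congr_set ?_
  rw [Filter.eventuallyEq_set]
  filter_upwards [hS1] with x hx
  constructor
  · intro h; exact ⟨x, ⟨h, hx⟩, rfl⟩
  · rintro ⟨y, ⟨hy1, hy2⟩, hxy⟩
    rw [← hinj hy2 hx hxy]; exact hy1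
end torus
end FM

namespace FM

section
variable {L : Type} [AddCommGroup L] [Module.Free ℤ L] [Module.Finite ℤ L]
  {I J : Type} [Fintype I] [Nonempty I] [MeasurableSpace I] [DiscreteMeasurableSpace I]
  [Fintype J] [Nonempty J] [MeasurableSpace J] [DiscreteMeasurableSpace J]

lemma fin_bdd (c : Du L → ℝ) : Set.Finite {e : L | ∀ γ : Du L, |γ e| ≤ c γ} := by
  let b := Module.Free.chooseBasis ℤ L
  let f : Module.Free.ChooseBasisIndex ℤ L → Du L :=
    fun a => (Int.castAddHom ℝ).toIntLinearMap ∘ₗ b.coord a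
  have h : Set.Finite (Set.pi Set.univ (fun a => Set.Icc (-⌈c (f a)⌉) (⌈c (f a)⌉))) :=
    Set.Finite.pi fun a => Set.finite_Icc _ _
  refine Set.Finite.of_finite_image (f := fun e a => b.repr e a) (h.subset ?_) ?_
  · rintro _ ⟨e, he, rfl⟩ a _
    have := he (f a)
    have h2 : f a e = (b.repr e a : ℝ) := by simp [f]
    rw [h2, abs_le] at this
    have h3 := Int.le_ceil (c (f a))
    constructor
    · have : -((⌈c (f a)⌉ : ℤ) : ℝ) ≤ (b.repr e a : ℝ) := by linarith
      exact_mod_cast this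
    · have : (b.repr e a : ℝ) ≤ ((⌈c (f a)⌉ : ℤ) : ℝ) := by linarith
      exact_mod_cast this
  · intro e _ e' _ h
    exact b.ext_elem fun a => congrFun h a

variable {R : L →ₗ[ℤ] L} {T : Du L →ₗ[ℝ] Du L} {D : I → J → L}

lemma IsSys.T_R (h : IsSys R T D) (γ : Du L) (l : L) : T γ (R l) = γ l :=
  LinearMap.congr_fun (h.hT γ) l

lemma stp_ex (h : IsSys R T D) (p : I × J) (e : L) :
    ∃ e', ∃ j', R e' = e + D p.1 p.2 - D p.1 j' := by
  obtain ⟨j, ⟨k, hk⟩, _⟩ := h.hD p.1 (e + D p.1 p.2)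
  exact ⟨k, j, hk.symm⟩

/-- step map of the carry chain -/
def stp (h : IsSys R T D) (p : I × J) (e : L) : L := Classical.choose (stp_ex h p e)

lemma stp_spec (h : IsSys R T D) (p : I × J) (e : L) :
    ∃ j', R (stp h p e) = e + D p.1 p.2 - D p.1 j' := Classical.choose_spec (stp_ex h p e)

lemma stp_uniq (h : IsSys R T D) (p : I × J) (e e' : L) (j' : J)
    (he : R e' = e + D p.1 p.2 - D p.1 j') : stp h p e = e' := by
  obtain ⟨j, hj⟩ := stp_spec h p e
  have : j = j' := (h.hD p.1 (e + D p.1 p.2)).unique ⟨_, hj.symm⟩ ⟨_, he.symm⟩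
  subst this
  exact h.inj (hj.trans he.symm)

lemma stp_zero (h : IsSys R T D) (p : I × J) : stp h p 0 = 0 :=
  stp_uniq h p 0 0 p.2 (by simp)

lemma Bd_eq (h : IsSys R T D) (γ : Du L) : Bd T D γ = mx D (T γ) + Bd T D (T γ) := by
  unfold Bd
  rw [(mx_summable h.hS D γ).tsum_eq_zero_add]
  congr 1

/-- bound along the chain -/
def cB (T : Du L →ₗ[ℝ] Du L) (D : I → J → L) (e0 : L) (γ : Du L) : ℝ :=
  ∑' k : ℕ, |(T ^ k) γ e0| + 2 * Bd T D γ

lemma Bd_nonneg (γ : Du L) : 0 ≤ Bd T D γ := by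
  refine tsum_nonneg fun k => ?_
  unfold mx
  positivity

lemma cB_self (h : IsSys R T D) (e0 : L) (γ : Du L) : |γ e0| ≤ cB T D e0 γ := by
  unfold cB
  have := (h.hS γ e0).tsum_eq_zero_add
  have h2 : 0 ≤ ∑' k : ℕ, |(T ^ (k + 1)) γ e0| := tsum_nonneg fun _ => abs_nonneg _
  have h3 := Bd_nonneg (T := T) (D := D) γ
  simp only [pow_zero, Module.End.one_apply] at this
  linarith

lemma cB_step (h : IsSys R T D) (e0 e : L) (he : ∀ γ, |γ e| ≤ cB T D e0 γ) (p : I × J) (γ : Du L) :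
    |γ (stp h p e)| ≤ cB T D e0 γ := by
  obtain ⟨j', hj⟩ := stp_spec h p e
  rw [← h.T_R γ, hj, map_sub, map_add]
  have h1 := he (T γ)
  have h2 := le_mx D (T γ) p.1 p.2
  have h3 := le_mx D (T γ) p.1 j'
  have h4 := Bd_eq h γ
  unfold cB at h1 ⊢
  have h5 := (h.hS γ e0).tsum_eq_zero_add
  have h6 : ∑' k : ℕ, |(T ^ k) (T γ) e0| = ∑' k : ℕ, |(T ^ (k + 1)) γ e0| := rfl
  have h7 := abs_nonneg ((T ^ 0) γ e0)
  rw [abs_le] at *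
  constructor <;> linarith

/-- every carry can be killed -/
def Reach (h : IsSys R T D) : Prop :=
  ∀ e : L, ∃ w : List (I × J), w.foldl (fun e p => stp h p e) e = 0

lemma foldl_zero (h : IsSys R T D) (w : List (I × J)) : w.foldl (fun e p => stp h p e) 0 = 0 := by
  induction w with
  | nil => rfl
  | cons p w ih => simp [stp_zero, ih]

lemma sync (h : IsSys R T D) (hr : Reach h) (s : Finset L) :
    ∃ w : List (I × J), ∀ e ∈ s, w.foldl (fun e p => stp h p e) e = 0 := by
  induction s using Finset.induction_on with
  | empty => exact ⟨[], by simp⟩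
  | insert a s ha ih =>
    obtain ⟨w, hw⟩ := ih
    obtain ⟨w', hw'⟩ := hr (w.foldl (fun e p => stp h p e) a)
    refine ⟨w ++ w', fun e he => ?_⟩
    rw [List.foldl_append]
    rcases Finset.mem_insert.1 he with rfl | he
    · exact hw'
    · rw [hw e he, foldl_zero]

lemma theta_shift (h : IsSys R T D) (γ : Du L) (ω : ℕ → I) (j : ℕ → J) :
    theta T D (pst R γ) ω j = γ (D (ω 0) (j 0)) +
      theta T D γ (fun k => ω (k + 1)) (fun k => j (k + 1)) := by
  unfold theta
  rw [(theta_summable h.hS D _ ω j).tsum_eq_zero_add]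
  have : ∀ k, (T ^ (k + 1)) (pst R γ) = (T ^ k) γ := by
    intro k
    rw [pow_succ, Module.End.mul_apply, h.hT']
  simp only [this, pow_zero, Module.End.one_apply]

lemma carry (h : IsSys R T D) (ω : ℕ → I) (j j' : ℕ → J) (l : L)
    (hl : ∀ γ, theta T D γ ω j - theta T D γ ω j' = γ l) :
    ∃ e : ℕ → L, e 0 = l ∧ (∀ n γ, |γ (e n)| ≤ 2 * Bd T D γ) ∧
      ∀ n, R (e n) = e (n + 1) + D (ω n) (j n) - D (ω n) (j' n) := by
  let e : ℕ → L := fun n => Nat.rec l (fun n x => R x - D (ω n) (j n) + D (ω n) (j' n)) n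
  have he : ∀ n, e (n + 1) = R (e n) - D (ω n) (j n) + D (ω n) (j' n) := fun n => rfl
  have key : ∀ n γ, theta T D γ (fun k => ω (k + n)) (fun k => j (k + n)) -
      theta T D γ (fun k => ω (k + n)) (fun k => j' (k + n)) = γ (e n) := by
    intro n
    induction n with
    | zero => exact hl
    | succ n ih =>
      intro γ
      have h1 := ih (pst R γ)
      rw [theta_shift h, theta_shift h] at h1
      simp only [pst_apply, zero_add, add_assoc, add_comm 1 n] at h1
      rw [he, map_add, map_sub, ← h1]
      ring
  refine ⟨e, rfl, fun n γ => ?_, fun n => ?_⟩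
  · rw [← key]
    have h1 := theta_bound h.hS D γ (fun k => ω (k + n)) (fun k => j (k + n))
    have h2 := theta_bound h.hS D γ (fun k => ω (k + n)) (fun k => j' (k + n))
    rw [abs_le] at *
    constructor <;> linarith
  · rw [he]; abel

lemma carry_word (h : IsSys R T D) (e : ℕ → L) (ω : ℕ → I) (j j' : ℕ → J)
    (he : ∀ n, R (e n) = e (n + 1) + D (ω n) (j n) - D (ω n) (j' n)) (w : List (I × J)) (p : ℕ)
    (hw : ∀ r (hr : r < w.length), (ω (p + r), j (p + r)) = w[r]) :
    w.foldr (fun q x => stp h q x) (e (p + w.length)) = e p := by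
  induction w generalizing p with
  | nil => simp
  | cons q w ih =>
    have h0 := hw 0 (by simp)
    simp only [List.foldr_cons, List.length_cons]
    rw [← add_assoc, add_right_comm, ih (p + 1)]
    · simp only [List.getElem_cons_zero, add_zero] at h0
      rw [← h0]
      exact stp_uniq h _ _ _ _ (he p)
    · intro r hr
      have := hw (r + 1) (by simp; omega)
      rw [add_assoc, add_comm 1 r]
      simpa using this

lemma sync_inj (h : IsSys R T D) (hr : Reach h) : ∃ S : Set (ℕ → I × J), MeasurableSet S ∧
    (∀ᵐ x ∂UM (I × J), x ∈ S) ∧ ∀ (ω : ℕ → I) (j j' : ℕ → J) (l : L), (fun k => (ω k, j k)) ∈ S →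
      (∀ γ, theta T D γ ω j - theta T D γ ω j' = γ l) → j = j' := by
  obtain ⟨w0, hw0⟩ := sync h hr (fin_bdd (L := L) (fun γ => 2 * Bd T D γ)).toFinset
  let p0 : I × J := Classical.arbitrary _
  let w : List (I × J) := p0 :: w0.reverse
  haveI : NeZero w.length := ⟨by simp [w]⟩
  have hio := word_io w.length (fun r => w[r])
  refine ⟨{x | ∀ q, ∃ p ≥ q, ∀ r : Fin w.length, x (p + r) = w[r]}, ?_, hio, ?_⟩
  · simp only [Set.ofPred_forall, Set.ofPred_exists, Set.ofPred_and]
    refine MeasurableSet.iInter fun q => MeasurableSet.iUnion fun p => ?_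
    refine (MeasurableSet.const _).inter (MeasurableSet.iInter fun r => ?_)
    exact measurableSet_eq_fun (measurable_pi_apply _) measurable_const
  · intro ω j j' l hS hl
    obtain ⟨e, e0, eb, er⟩ := carry h ω j j' l hl
    have hz : ∀ n, e n = 0 := by
      intro n
      obtain ⟨p, hp, hW⟩ := hS n
      have h1 := carry_word h e ω j j' er w p (fun r hr => hW ⟨r, hr⟩)
      have h2 : e p = 0 := by
        rw [← h1]
        simp only [w, List.foldr_cons, List.foldr_reverse]
        rw [hw0, stp_zero]
        simp only [Set.Finite.mem_toFinset, Set.mem_ofPred_eq]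
        exact eb _
      obtain ⟨d, rfl⟩ := Nat.exists_eq_add_of_le hp
      clear h1 hW hp
      induction d with
      | zero => exact h2
      | succ d ih =>
        apply ih
        have := stp_uniq h (ω (n + d), j (n + d)) _ _ _ (er (n + d))
        rw [← this, add_assoc, h2, stp_zero]
    funext n
    have := er n
    rw [hz, hz, map_zero, zero_add, eq_comm, sub_eq_zero] at this
    exact (h.hD (ω n) (D (ω n) (j n))).unique ⟨0, by simp⟩ ⟨0, by simp [this]⟩

end
end FM

namespace FM

section
variable {L : Type} [AddCommGroup L] [Module.Free ℤ L] [Module.Finite ℤ L]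
  {I J : Type} [Fintype I] [Nonempty I] [MeasurableSpace I] [DiscreteMeasurableSpace I]
  [Fintype J] [Nonempty J] [MeasurableSpace J] [DiscreteMeasurableSpace J]
variable {R : L →ₗ[ℤ] L} {T : Du L →ₗ[ℝ] Du L} {D : I → J → L}

/-- integer valued functionals -/
def IntV (γ : Du L) : Prop := ∀ l, ∃ n : ℤ, γ l = n

lemma base_O (h : IsSys R T D) (γ : Du L) (hγ : IntV γ) (h0 : γ ≠ 0) (ω : ℕ → I) :
    ∫ j, ee (theta T D γ ω j) ∂(UM J) = 0 := by
  have hk : ∃ k, IntV ((T ^ k) γ) ∧ ¬ IntV ((T ^ (k + 1)) γ) := by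
    by_contra hcon
    push Not at hcon
    have hall : ∀ k, IntV ((T ^ k) γ) := by
      intro k
      induction k with
      | zero => simpa using hγ
      | succ k ih => exact hcon k ih
    let b := Module.Free.chooseBasis ℤ L
    have hev : ∀ a, ∀ᶠ k in atTop, (T ^ k) γ (b a) = 0 := by
      intro a
      have h1 := (h.hS γ (b a)).tendsto_atTop_zero
      filter_upwards [h1.eventually (gt_mem_nhds (one_pos))] with k hk
      obtain ⟨n, hn⟩ := hall k (b a)
      rw [hn] at hk ⊢
      have : |n| < 1 := by exact_mod_cast hk
      rw [Int.abs_lt_one_iff] at this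
      simp [this]
    obtain ⟨k, hk⟩ := (eventually_all.2 hev).exists
    have hz : (T ^ k) γ = 0 := b.ext hk
    apply h0
    ext l
    rw [← h.pow_hT k, hz]; simp
  obtain ⟨k, hk1, hk2⟩ := hk
  unfold IntV at hk2
  push Not at hk2
  obtain ⟨l, hl⟩ := hk2
  have hne : ee ((T ^ (k + 1)) γ l) ≠ 1 := by
    rw [Ne, ee_eq_one]; push Not; exact hl
  let i := ω k
  choose res hres hresu using fun l => (h.hD i l)
  simp only at hres hresu
  have hinj : Function.Injective (fun j => res (D i j + l)) := by
    intro j j' hj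
    simp only at hj
    obtain ⟨k1, h1⟩ := hres (D i j + l)
    obtain ⟨k2, h2⟩ := hres (D i j' + l)
    rw [hj] at h1
    refine (h.hD i (D i j)).unique ⟨0, by simp⟩ ⟨k1 - k2, ?_⟩
    rw [map_sub, ← h1, ← h2]; abel
  let τ : J ≃ J := Equiv.ofBijective _ (Finite.injective_iff_bijective.1 hinj)
  let e : ℕ → J ≃ J := fun n => if n = k then τ else Equiv.refl J
  have hth : ∀ j, ee (theta T D γ ω (relE e j)) = ee ((T ^ (k + 1)) γ l) * ee (theta T D γ ω j) := by
    intro j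
    obtain ⟨k1, h1⟩ := hres (D i (j k) + l)
    have hd : theta T D γ ω (relE e j) - theta T D γ ω j = (T ^ (k + 1)) γ l - (T ^ k) γ k1 := by
      unfold theta
      rw [← Summable.tsum_sub (theta_summable h.hS D γ ω _) (theta_summable h.hS D γ ω _),
        tsum_eq_single k]
      · have : relE e j k = τ (j k) := by simp [relE, e]
        rw [this, ← map_sub]
        have h2 : D (ω k) (τ (j k)) - D (ω k) (j k) = l - R k1 := by
          rw [← h1]; show D i (res _) - _ = _; abel
        rw [h2, map_sub, pow_succ' T k, Module.End.mul_apply, h.T_R]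
      · intro n hn
        have : relE e j n = j n := by simp [relE, e, hn]
        rw [this, sub_self]
    obtain ⟨n, hn⟩ := hk1 (-k1)
    rw [show theta T D γ ω (relE e j) = (T ^ (k + 1)) γ l + theta T D γ ω j + (n : ℝ) by
      rw [← hn, map_neg]; linarith]
    rw [ee_add, ee_add, (ee_eq_one (n : ℝ)).2 ⟨n, rfl⟩, mul_one]
  have := (relE_mp e).integral_comp' (fun j => ee (theta T D γ ω j))
  simp only [hth] at this
  rw [integral_const_mul] at this
  have h3 : (ee ((T ^ (k + 1)) γ l) - 1) * ∫ j, ee (theta T D γ ω j) ∂(UM J) = 0 := by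
    rw [sub_mul, this]; ring
  rcases mul_eq_zero.1 h3 with h4 | h4
  · exact absurd (sub_eq_zero.1 h4) hne
  · exact h4

theorem base_case (h : IsSys R T D) (hr : Reach h) : Concl T D := by
  let b := Module.Free.chooseBasis ℤ L
  let bb := (Pi.basisFun ℝ (Module.Free.ChooseBasisIndex ℤ L)).map (b.constr ℝ)
  have hlat : ∀ z l, lat bb z l = ∑ a, (z a : ℝ) * (b.repr l a : ℝ) := by
    intro z l
    simp only [lat, LinearMap.sum_apply, LinearMap.smul_apply, smul_eq_mul]
    refine Finset.sum_congr rfl fun a _ => ?_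
    congr 1
    simp [bb, Module.Basis.constr_apply_fintype, Pi.single_apply]
  have hlatb : ∀ z a, lat bb z (b a) = z a := by
    intro z a
    rw [hlat, Finset.sum_eq_single a]
    · simp
    · intro c _ hc
      simp [Finsupp.single_apply, hc.symm]
    · simp
  have hbb : ∀ a l, bb a l = (b.repr l a : ℝ) := by
    intro a l
    simp [bb, Module.Basis.constr_apply_fintype, Pi.single_apply]
  refine ⟨_, inferInstance, bb, ?_, ?_⟩
  · intro ω z hz
    refine base_O h _ ?_ ?_ ω
    · intro l
      exact ⟨∑ a, z a * b.repr l a, by rw [hlat]; push_cast; rfl⟩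
    · intro h0
      apply hz
      funext a
      have := hlatb z a
      rw [h0] at this
      simpa using this.symm
  · obtain ⟨S, hS, hS1, hSi⟩ := sync_inj h hr
    have h2 := Measure.ae_ae_of_ae_prod ((zipE_mp (J1 := I) (J2 := J)).quasiMeasurePreserving.ae hS1)
    filter_upwards [h2] with ω hω
    let X : (ℕ → J) → Module.Free.ChooseBasisIndex ℤ L → UnitAddCircle :=
      fun j a => ((theta T D (bb a) ω j : ℝ) : UnitAddCircle)
    have hX : Measurable X := by
      refine measurable_pi_lambda _ fun a => ?_
      exact AddCircle.measurable_mk'.comp (theta_meas' h.hS D (bb a) ω)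
    have hc := compl_torus (UM J) X hX {j | (fun k => (ω k, j k)) ∈ S}
      (hS.preimage (by fun_prop)) hω ?_
    · intro F hF hz
      refine hc F hF fun z => ?_
      rw [← hz z]
      refine integral_congr_ae (.of_forall fun j => ?_)
      simp only
      congr 1
      rw [lat, theta_sum h.hS]
      simp only [theta_smul, UnitAddTorus.mFourier, ContinuousMap.coe_mk, X, fourier_coe_apply]
      rw [ee_exp]
      push_cast
      rw [Finset.mul_sum, Finset.sum_mul, Complex.exp_sum]
      refine Finset.prod_congr rfl fun a _ => ?_
      congr 1
      simp; ring
    · intro j hj j' hj' hjj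
      have hn : ∀ a, ∃ n : ℤ, theta T D (bb a) ω j - theta T D (bb a) ω j' = n := by
        intro a
        have := congrFun hjj a
        simp only [X] at this
        rw [← sub_eq_zero, ← AddCircle.coe_sub, AddCircle.coe_eq_zero_iff] at this
        obtain ⟨n, hn⟩ := this
        exact ⟨n, by rw [← hn]; simp⟩
      choose n hn using hn
      refine hSi ω j j' (∑ a, n a • b a) hj ?_
      intro γ
      have hγ : γ = ∑ a, γ (b a) • bb a := by
        refine b.ext fun c => ?_
        simp [LinearMap.sum_apply, hbb, Finsupp.single_apply]
      conv_lhs => rw [hγ, theta_sum h.hS, theta_sum h.hS, ← Finset.sum_sub_distrib]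
      rw [map_sum]
      refine Finset.sum_congr rfl fun a _ => ?_
      rw [theta_smul, theta_smul, ← mul_sub, hn]
      simp [mul_comm]

end
end FM

namespace FM
open TopologicalSpace

lemma comp_perm {X : Type} [TopologicalSpace X] [NoetherianSpace X] [Nonempty X] (f : X → X)
    (hf : Continuous f) (hs : Function.Surjective f) :
    ∃ q : ℕ, 1 ≤ q ∧ ∃ (x : X) (Z : Set X), IsClosed Z ∧ IsIrreducible Z ∧
      ∀ n y, f^[q * n] y = x → y ∈ Z := by
  have hfin := NoetherianSpace.finite_irreducibleComponents (α := X)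
  have hF : Finite (irreducibleComponents X) := hfin
  have hσ : ∀ c : irreducibleComponents X, ∃ c' : irreducibleComponents X, f '' c ⊆ (c' : Set X) := by
    intro c
    obtain ⟨u, hu, h⟩ := exists_mem_irreducibleComponents_subset_of_isIrreducible (f '' (c : Set X))
      (IsIrreducible.image c.2.1 f hf.continuousOn)
    exact ⟨⟨u, hu⟩, h⟩
  choose σ hσ using hσ
  have hsurj : Function.Surjective σ := by
    intro c
    have h1 : (c : Set X) ∈ Set.range (fun d => (σ d : Set X)) := by
      refine mem_of_subset_sUnion_irreducibleComponents _ c.2 _ (Set.finite_range _) ?_ ?_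
      · rintro _ ⟨d, rfl⟩; exact (σ d).2
      · intro x _
        obtain ⟨y, rfl⟩ := hs x
        let d : irreducibleComponents X := ⟨_, irreducibleComponent_mem_irreducibleComponents y⟩
        exact ⟨_, ⟨d, rfl⟩, hσ d ⟨y, mem_irreducibleComponent, rfl⟩⟩
    obtain ⟨d, hd⟩ := h1
    exact ⟨d, Subtype.ext hd⟩
  have hbij : Function.Bijective σ := Finite.surjective_iff_bijective.1 hsurj
  let s : Equiv.Perm (irreducibleComponents X) := Equiv.ofBijective σ hbij
  have hq := pow_orderOf_eq_one s
  have hq0 : 1 ≤ orderOf s := orderOf_pos s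
  refine ⟨orderOf s, hq0, ?_⟩
  let Z : irreducibleComponents X :=
    ⟨_, irreducibleComponent_mem_irreducibleComponents (Classical.arbitrary X)⟩
  have hZ := closure_sUnion_irreducibleComponents_sdiff_singleton hfin Z Z.2
  have hne : ((⋃₀ (irreducibleComponents X \ {(Z : Set X)}))ᶜ).Nonempty := by
    rw [← closure_nonempty_iff, hZ]
    exact Z.2.1.1
  obtain ⟨x, hx⟩ := hne
  refine ⟨x, Z, isClosed_of_mem_irreducibleComponents _ Z.2, Z.2.1, ?_⟩
  intro n y hy
  have hit : ∀ n (c : irreducibleComponents X), y ∈ (c : Set X) → f^[n] y ∈ (((s ^ n) c) : Set X) := by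
    intro n
    induction n with
    | zero => intro c hc; exact hc
    | succ n ih =>
      intro c hc
      rw [Function.iterate_succ_apply', pow_succ', Equiv.Perm.mul_apply]
      exact hσ _ ⟨_, ih c hc, rfl⟩
  let d : irreducibleComponents X := ⟨_, irreducibleComponent_mem_irreducibleComponents y⟩
  have h1 := hit (orderOf s * n) d mem_irreducibleComponent
  rw [pow_mul, hq, one_pow, Equiv.Perm.one_apply, hy] at h1
  have h2 : (d : Set X) = Z := by
    by_contra hne
    exact hx ⟨d, ⟨d.2, hne⟩, h1⟩
  rw [← h2]
  exact mem_irreducibleComponent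

section
variable {X : Type} [TopologicalSpace X]

lemma open_iter {A : X → X} (hA : IsOpenMap A) (m : ℕ) : IsOpenMap (A^[m]) := by
  induction m with
  | zero => exact IsOpenMap.id
  | succ m ih => exact ih.comp hA

/-- paths of length `m` staying in `P` -/
def PosM (A : X → X) (P : Set X) (m : ℕ) : Set X := {x | ∀ k < m, A^[k] x ∈ P}

/-- backward closed -/
def BC (A : X → X) (P : Set X) (m : ℕ) (M : Set X) : Prop :=
  ∀ x ∈ PosM A P m, A^[m] x ∈ M → x ∈ M

lemma PosM_add {A : X → X} {P : Set X} {a b : ℕ} {x : X} :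
    x ∈ PosM A P (a + b) ↔ x ∈ PosM A P a ∧ A^[a] x ∈ PosM A P b := by
  constructor
  · intro h
    refine ⟨fun k hk => h k (by omega), fun k hk => ?_⟩
    rw [← Function.iterate_add_apply]
    exact h _ (by omega)
  · rintro ⟨h1, h2⟩ k hk
    by_cases hka : k < a
    · exact h1 k hka
    · have := h2 (k - a) (by omega)
      rw [← Function.iterate_add_apply] at this
      rwa [show k - a + a = k by omega] at this

lemma BC.mul {A : X → X} {P : Set X} {m : ℕ} {M : Set X} (h : BC A P m M) (n : ℕ) :
    BC A P (m * n) M := by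
  induction n with
  | zero => intro x _ hx; simpa using hx
  | succ n ih =>
    intro x hx hM
    rw [Nat.mul_succ, add_comm] at hx hM
    rw [PosM_add] at hx
    rw [add_comm, Function.iterate_add_apply] at hM
    exact h x hx.1 (ih _ hx.2 hM)

lemma PosM_open {A : X → X} {P : Set X} (hA : Continuous A) (hP : IsOpen P) (m : ℕ) :
    IsOpen (PosM A P m) := by
  have : PosM A P m = ⋂ k ∈ Finset.range m, (A^[k]) ⁻¹' P := by
    ext x; simp [PosM]
  rw [this]
  exact isOpen_biInter_finset fun k _ => hP.preimage (hA.iterate k)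

lemma BC.closure {A : X → X} {P : Set X} {m : ℕ} {M : Set X} (h : BC A P m M) (hA : Continuous A)
    (hAo : IsOpenMap A) (hP : IsOpen P) : BC A P m (closure M) := by
  intro x hx hM
  have hop : IsOpenMap (A^[m]) := open_iter hAo m
  have h1 := hop.preimage_closure_subset_closure_preimage hM
  have h2 := (PosM_open hA hP m).inter_closure ⟨hx, h1⟩
  exact closure_mono (fun y hy => h y hy.1 hy.2) h2

lemma PosM_surj {A : X → X} {P : Set X} (hs : ∀ x, ∃ y ∈ P, A y = x) (m : ℕ) (x : X) :
    ∃ y ∈ PosM A P m, A^[m] y = x := by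
  induction m generalizing x with
  | zero => exact ⟨x, fun k hk => by omega, rfl⟩
  | succ m ih =>
    obtain ⟨y, hy, hyx⟩ := ih x
    obtain ⟨w, hw, hwy⟩ := hs y
    refine ⟨w, ?_, ?_⟩
    · rw [add_comm, PosM_add]
      refine ⟨fun k hk => ?_, by simpa [hwy] using hy⟩
      obtain rfl : k = 0 := by omega
      exact hw
    · rw [Function.iterate_succ_apply, hwy, hyx]

/-- backward tree -/
def Tre (A : X → X) (P : Set X) (m n0 : ℕ) (x : X) : Set X :=
  {y | ∃ n ≥ n0, y ∈ PosM A P (m * n) ∧ A^[m * n] y = x}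

lemma Tre_BC (A : X → X) (P : Set X) (m n0 : ℕ) (x : X) : BC A P m (Tre A P m n0 x) := by
  rintro y hy ⟨n, hn, h1, h2⟩
  refine ⟨n + 1, by omega, ?_, ?_⟩
  · rw [Nat.mul_succ, add_comm, PosM_add]; exact ⟨hy, h1⟩
  · rw [Nat.mul_succ, Function.iterate_add_apply, h2]

theorem top_lemma [NoetherianSpace X] {A : X → X} {P : Set X} (hA : Continuous A)
    (hAo : IsOpenMap A) (hP : IsOpen P) (hs : ∀ x, ∃ y ∈ P, A y = x) (M0 : Set X) (hc : IsClosed M0)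
    (hne : M0.Nonempty) (hB : BC A P 1 M0) :
    ∃ m : ℕ, 1 ≤ m ∧ ∃ M ⊆ M0, IsClosed M ∧ IsIrreducible M ∧ (∀ x ∈ M, A^[m] x ∈ M) ∧
      BC A P m M := by
  have hwf : WellFounded (fun a b : Closeds X => a < b) := (inferInstance : WellFoundedLT (Closeds X)).wf
  let 𝓢 : Set (Closeds X) := {M | (M : Set X) ⊆ M0 ∧ (M : Set X).Nonempty ∧
    ∃ m, 1 ≤ m ∧ BC A P m (M : Set X)}
  have h𝓢 : 𝓢.Nonempty := ⟨⟨M0, hc⟩, subset_rfl, hne, 1, le_rfl, hB⟩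
  let M := hwf.min 𝓢 h𝓢
  obtain ⟨hM0, hMne, m, hm, hBC⟩ := hwf.min_mem 𝓢 h𝓢
  change (M : Set X) ⊆ M0 at hM0
  change (M : Set X).Nonempty at hMne
  change BC A P m (M : Set X) at hBC
  have hmin : ∀ S : Set X, S ⊆ M → S.Nonempty → (∃ m, 1 ≤ m ∧ BC A P m S) → closure S = M := by
    rintro S hSM hSn ⟨m', hm', hS⟩
    have hcl : closure S ⊆ M := closure_minimal hSM M.isClosed
    by_contra hneq
    have hlt : (⟨closure S, isClosed_closure⟩ : Closeds X) < M := by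
      refine lt_of_le_of_ne hcl ?_
      intro h
      exact hneq (congrArg (fun Z : Closeds X => (Z : Set X)) h)
    exact hwf.not_lt_min 𝓢 (x := ⟨closure S, isClosed_closure⟩)
      ⟨hcl.trans hM0, hSn.closure, m', hm', hS.closure hA hAo hP⟩ hlt
  have htM : ∀ q n0 x, x ∈ (M : Set X) → Tre A P (m * q) n0 x ⊆ M := by
    rintro q n0 x hx y ⟨n, hn, h1, h2⟩
    rw [mul_assoc] at h1 h2
    exact hBC.mul (q * n) y h1 (by rw [h2]; exact hx)
  have htn : ∀ m n0 x, (Tre A P m n0 x).Nonempty := by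
    intro m n0 x
    obtain ⟨y, h1, h2⟩ := PosM_surj hs (m * n0) x
    exact ⟨y, n0, le_rfl, h1, h2⟩
  have hAM : ∀ x ∈ (M : Set X), A^[m] x ∈ (M : Set X) := by
    intro x hx
    have hd := hmin (Tre A P m 1 x) (by simpa using htM 1 1 x hx) (htn _ _ _) ⟨m, hm, Tre_BC _ _ _ _ _⟩
    have h1 : x ∈ closure (Tre A P m 1 x) := by rw [hd]; exact hx
    have h2 := image_closure_subset_closure_image (hA.iterate m) ⟨x, h1, rfl⟩
    refine closure_minimal ?_ M.isClosed h2
    rintro _ ⟨y, ⟨n, hn, h3, h4⟩, rfl⟩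
    obtain ⟨n, rfl⟩ := Nat.exists_eq_add_of_le' hn
    rw [Nat.mul_succ, add_comm, PosM_add] at h3
    rw [Nat.mul_succ, Function.iterate_add_apply] at h4
    exact hBC.mul n _ h3.2 (by rw [h4]; exact hx)
  haveI : Nonempty (M : Set X) := hMne.to_subtype
  let f : ↥(M : Set X) → ↥(M : Set X) := fun x => ⟨A^[m] x, hAM x x.2⟩
  have hfc : Continuous f := by
    refine Continuous.subtype_mk ?_ _
    exact (hA.iterate m).comp continuous_subtype_val
  have hfs : Function.Surjective f := by
    rintro ⟨x, hx⟩
    obtain ⟨y, hy, hyx⟩ := PosM_surj hs m x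
    exact ⟨⟨y, hBC y hy (by rw [hyx]; exact hx)⟩, Subtype.ext hyx⟩
  obtain ⟨q, hq, x, Z, hZc, hZi, hZ⟩ := comp_perm f hfc hfs
  have hfit : ∀ n (y : ↥(M : Set X)), ((f^[n] y : ↥(M : Set X)) : X) = A^[m * n] y := by
    intro n
    induction n with
    | zero => intro y; simp
    | succ n ih =>
      intro y
      rw [Function.iterate_succ_apply, ih, Nat.mul_succ, Function.iterate_add_apply]
  have hZX : IsClosed ((↑) '' Z : Set X) := M.isClosed.isClosedEmbedding_subtypeVal.isClosedMap _ hZc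
  have hsub : Tre A P (m * q) 0 x ⊆ ((↑) '' Z : Set X) := by
    intro y hy
    have hyM := htM q 0 x x.2 hy
    obtain ⟨n, hn, h1, h2⟩ := hy
    refine ⟨⟨y, hyM⟩, hZ n ⟨y, hyM⟩ (Subtype.ext ?_), rfl⟩
    rw [hfit, ← mul_assoc, h2]
  have hd := hmin _ (htM q 0 x x.2) (htn _ _ _) ⟨m * q, Nat.mul_pos hm hq, Tre_BC _ _ _ _ _⟩
  have hMZ : (M : Set X) = ((↑) '' Z : Set X) := by
    apply subset_antisymm
    · exact hd.symm.subset.trans (closure_minimal hsub hZX)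
    · rintro _ ⟨y, _, rfl⟩; exact y.2
  refine ⟨m, hm, M, hM0, M.isClosed, ?_, hAM, hBC⟩
  have hi : IsIrreducible ((↑) '' Z : Set X) := hZi.image _ continuous_subtype_val.continuousOn
  exact hMZ.symm ▸ hi
end
end FM

namespace FM

open TopologicalSpace

/-- the torus dual to a lattice -/
def Tor (L : Type) [AddCommGroup L] := AddChar L Circle

section
variable {L : Type} [AddCommGroup L]

instance : CommGroup (Tor L) := inferInstanceAs (CommGroup (AddChar L Circle))

/-- the underlying character -/
def ad (χ : Tor L) : AddChar L Circle := χ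

/-- value of a character -/
def cv (χ : Tor L) (l : L) : ℂ := (ad χ l : ℂ)

lemma cv_add (χ : Tor L) (l m : L) : cv χ (l + m) = cv χ l * cv χ m := by
  simp [cv, AddChar.map_add_eq_mul]
lemma cv_zero (χ : Tor L) : cv χ 0 = 1 := by simp [cv]
lemma cv_norm (χ : Tor L) (l : L) : ‖cv χ l‖ = 1 := Circle.norm_coe _
lemma cv_ne (χ : Tor L) (l : L) : cv χ l ≠ 0 := by simp [cv]
lemma cv_neg (χ : Tor L) (l : L) : cv χ (-l) = (cv χ l)⁻¹ := by
  refine eq_inv_of_mul_eq_one_left ?_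
  rw [← cv_add]; simp [cv_zero]
lemma cv_conj (χ : Tor L) (l : L) : starRingEnd ℂ (cv χ l) = cv χ (-l) := by
  rw [cv_neg, Complex.inv_def, Complex.normSq_eq_norm_sq, cv_norm]; simp
lemma cv_mul (χ ψ : Tor L) (l : L) : cv (χ * ψ) l = cv χ l * cv ψ l := by
  have : ad (χ * ψ) l = ad χ l * ad ψ l := AddChar.mul_apply (ad χ) (ad ψ) l
  simp [cv, this]
lemma cv_one (l : L) : cv (1 : Tor L) l = 1 := by
  have : ad (1 : Tor L) l = 1 := AddChar.one_apply l
  simp [cv, this]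
lemma cv_inv (χ : Tor L) (l : L) : cv χ⁻¹ l = (cv χ l)⁻¹ := by
  refine eq_inv_of_mul_eq_one_left ?_
  rw [← cv_mul]; simp [cv_one]
lemma cv_ext {χ ψ : Tor L} (h : ∀ l, cv χ l = cv ψ l) : χ = ψ := by
  refine DFunLike.ext (F := AddChar L Circle) _ _ fun l => ?_
  exact Circle.ext (h l)

/-- evaluation homomorphism of Laurent polynomials -/
def evh (χ : Tor L) : AddMonoidAlgebra ℂ L →ₐ[ℂ] ℂ :=
  AddMonoidAlgebra.lift ℂ ℂ L (Circle.coeHom.comp (AddChar.toMonoidHom (ad χ)))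

lemma evh_single (χ : Tor L) (l : L) (c : ℂ) : evh χ (AddMonoidAlgebra.single l c) = c * cv χ l := by
  simp only [evh, AddMonoidAlgebra.lift_single, cv]
  rfl

lemma evh_apply (χ : Tor L) (f : AddMonoidAlgebra ℂ L) :
    evh χ f = ∑ l ∈ f.coeff.support, f.coeff l * cv χ l := by
  simp only [evh, AddMonoidAlgebra.lift_apply, Finsupp.sum]
  rfl

/-- kernel of the evaluation -/
def tsp (χ : Tor L) : PrimeSpectrum (AddMonoidAlgebra ℂ L) :=
  ⟨RingHom.ker (evh χ).toRingHom, RingHom.ker_isPrime _⟩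

instance : TopologicalSpace (Tor L) := TopologicalSpace.induced tsp inferInstance

instance [Module.Finite ℤ L] : NoetherianSpace (Tor L) := by
  have : AddMonoid.FG L := by
    have : AddGroup.FG L := AddGroup.fg_iff_addMonoid_fg.2 (by
      rw [← AddGroup.fg_iff_addMonoid_fg]
      exact Module.Finite.iff_addGroup_fg.1 inferInstance)
    exact AddGroup.fg_iff_addMonoid_fg.1 this
  have : IsNoetherianRing (AddMonoidAlgebra ℂ L) :=
    Algebra.FiniteType.isNoetherianRing ℂ _
  exact Topology.IsInducing.noetherianSpace (i := (tsp : Tor L → _)) ⟨rfl⟩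

lemma tz_evh (f : AddMonoidAlgebra ℂ L) : IsClosed {χ : Tor L | evh χ f = 0} := by
  have h : IsClosed (PrimeSpectrum.zeroLocus ({f} : Set (AddMonoidAlgebra ℂ L))) :=
    PrimeSpectrum.isClosed_zeroLocus _
  have hc : Continuous (tsp : Tor L → _) := continuous_induced_dom
  have := h.preimage hc
  convert this using 1
  ext χ
  simp only [Set.mem_ofPred_eq, Set.mem_preimage, PrimeSpectrum.mem_zeroLocus,
    Set.singleton_subset_iff, tsp]
  exact Iff.rfl

lemma tz {α : Type} (s : Finset α) (c : α → ℂ) (e : α → L) :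
    IsClosed {χ : Tor L | ∑ a ∈ s, c a * cv χ (e a) = 0} := by
  convert tz_evh (∑ a ∈ s, AddMonoidAlgebra.single (e a) (c a)) using 4 with χ
  simp [map_sum, evh_single]

lemma tsep {C : Set (Tor L)} (hC : IsClosed C) {χ : Tor L} (hχ : χ ∉ C) :
    ∃ (s : Finset L) (c : L → ℂ), (∀ ψ ∈ C, ∑ l ∈ s, c l * cv ψ l = 0) ∧
      ∑ l ∈ s, c l * cv χ l ≠ 0 := by
  obtain ⟨t, ht, rfl⟩ := isClosed_induced_iff.1 hC
  obtain ⟨S, rfl⟩ := (PrimeSpectrum.isClosed_iff_zeroLocus t).1 ht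
  rw [Set.mem_preimage, PrimeSpectrum.mem_zeroLocus, Set.not_subset] at hχ
  obtain ⟨f, hf, hfχ⟩ := hχ
  refine ⟨f.coeff.support, f.coeff, ?_, ?_⟩
  · intro ψ hψ
    rw [← evh_apply]
    exact hψ hf
  · rw [← evh_apply]
    exact hfχ

lemma tcont (g : Tor L → Tor L)
    (h : ∀ (s : Finset L) (c : L → ℂ), IsClosed {χ | ∑ l ∈ s, c l * cv (g χ) l = 0}) :
    Continuous g := by
  rw [continuous_iff_isClosed]
  intro C hC
  rw [← isOpen_compl_iff, isOpen_iff_forall_mem_open]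
  intro χ hχ
  obtain ⟨s, c, h1, h2⟩ := tsep hC hχ
  refine ⟨{χ | ∑ l ∈ s, c l * cv (g χ) l = 0}ᶜ, ?_, (h s c).isOpen_compl, h2⟩
  intro ψ hψ hψC
  exact hψ (h1 _ hψC)

lemma tmul_cont (κ : Tor L) : Continuous (fun χ : Tor L => κ * χ) := by
  refine tcont _ fun s c => ?_
  convert tz s (fun l => c l * cv κ l) id using 5 with χ l hl
  rw [cv_mul]; simp; ring

/-- dual endomorphism -/
def dA (R : L →ₗ[ℤ] L) (χ : Tor L) : Tor L :=
  AddChar.compAddMonoidHom (ad χ) R.toAddMonoidHom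

lemma cv_dA (R : L →ₗ[ℤ] L) (χ : Tor L) (l : L) : cv (dA R χ) l = cv χ (R l) := rfl

lemma dA_cont (R : L →ₗ[ℤ] L) : Continuous (dA R) := by
  refine tcont _ fun s c => ?_
  exact tz s c R

lemma dA_mul (R : L →ₗ[ℤ] L) (χ ψ : Tor L) : dA R (χ * ψ) = dA R χ * dA R ψ :=
  cv_ext fun l => by simp [cv_dA, cv_mul]

lemma dA_iter (R : L →ₗ[ℤ] L) (m : ℕ) (χ : Tor L) : (dA R)^[m] χ = dA (R ^ m) χ := by
  induction m generalizing χ with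
  | zero => rfl
  | succ m ih =>
    rw [Function.iterate_succ_apply, ih]
    refine cv_ext fun l => ?_
    rw [cv_dA, cv_dA, cv_dA, pow_succ']
    rfl

/-- character from a functional -/
def tch (γ : Du L) : Tor L :=
  AddChar.compAddMonoidHom Real.fourierChar γ.toAddMonoidHom

lemma cv_tch (γ : Du L) (l : L) : cv (tch γ) l = ee (γ l) := rfl

lemma ee_surj {z : ℂ} (hz : ‖z‖ = 1) : ∃ x : ℝ, ee x = z := by
  refine ⟨z.arg / (2 * Real.pi), ?_⟩
  rw [ee_exp]
  conv_rhs => rw [← Complex.norm_mul_exp_arg_mul_I z, hz]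
  have : (Real.pi : ℂ) ≠ 0 := by exact_mod_cast Real.pi_ne_zero
  push_cast
  field_simp

lemma tch_surj [Module.Free ℤ L] [Module.Finite ℤ L] (χ : Tor L) : ∃ γ : Du L, tch γ = χ := by
  let b := Module.Free.chooseBasis ℤ L
  choose x hx using fun a => ee_surj (cv_norm χ (b a))
  let γ : Du L := b.constr ℤ x
  refine ⟨γ, cv_ext fun l => ?_⟩
  let φ : L →+ Additive Circle := MonoidHom.toAdditiveRight (AddChar.toMonoidHom (ad χ))
  let φ' : L →+ Additive Circle := MonoidHom.toAdditiveRight (AddChar.toMonoidHom (ad (tch γ)))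
  have : φ'.toIntLinearMap = φ.toIntLinearMap := by
    refine b.ext fun a => ?_
    have h1 : cv (tch γ) (b a) = cv χ (b a) := by
      rw [cv_tch, ← hx a]; simp [γ]
    exact Circle.ext h1
  have h2 : φ' l = φ l := LinearMap.congr_fun this l
  exact congrArg (fun z : Circle => (z : ℂ)) h2

end
end FM

namespace FM

open TopologicalSpace

section
variable {L : Type} [AddCommGroup L]

/-- annihilator of `R L` as a finite set -/
structure IsK (R : L →ₗ[ℤ] L) (K : Finset (Tor L)) : Prop where
  one : 1 ∈ K
  ann : ∀ κ ∈ K, ∀ l, cv κ (R l) = 1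
  sum : ∀ l, ∑ κ ∈ K, cv κ l = if ∃ k, l = R k then (K.card : ℂ) else 0
  mul : ∀ κ ∈ K, ∀ κ' ∈ K, κ * κ' ∈ K

lemma IsK.card_ne {R : L →ₗ[ℤ] L} {K : Finset (Tor L)} (hK : IsK R K) : (K.card : ℂ) ≠ 0 := by
  have : K.card ≠ 0 := Finset.card_ne_zero_of_mem hK.one
  exact_mod_cast this

lemma IsK.dA {R : L →ₗ[ℤ] L} {K : Finset (Tor L)} (hK : IsK R K) {κ : Tor L} (h : κ ∈ K)
    (χ : Tor L) : dA R (κ * χ) = dA R χ :=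
  cv_ext fun l => by rw [cv_dA, cv_mul, hK.ann κ h, one_mul]; rfl

lemma kinv {R : L →ₗ[ℤ] L} {K : Finset (Tor L)} (hK : IsK R K) {α : Type} (s : Finset α)
    (c : α → ℂ) (e : α → L) (d : L) (y : Tor L) :
    ∑ κ ∈ K, cv κ (-d) * ∑ a ∈ s, c a * cv (κ * y) (e a) =
      K.card * ∑ a ∈ s with (∃ k, e a - d = R k), c a * cv y (e a) := by
  simp_rw [Finset.mul_sum]
  rw [Finset.sum_comm, Finset.sum_filter]
  refine Finset.sum_congr rfl fun a _ => ?_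
  have : ∀ κ ∈ K, cv κ (-d) * (c a * cv (κ * y) (e a)) = c a * cv y (e a) * cv κ (e a - d) := by
    intro κ _
    rw [cv_mul, sub_eq_add_neg, cv_add]; ring
  rw [Finset.sum_congr rfl this, ← Finset.mul_sum, hK.sum]
  split_ifs
  · ring
  · simp

lemma kap_exists {R : L →ₗ[ℤ] L} {I J : Type} [Nonempty I] [Finite J] {D : I → J → L}
    (hD : ∀ i l, ∃! j, ∃ k, l - D i j = R k) : ∃ K, IsK R K := by
  let H : AddSubgroup L := R.toAddMonoidHom.range
  have hH : ∀ l, l ∈ H ↔ ∃ k, l = R k := fun l =>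
    ⟨fun ⟨k, hk⟩ => ⟨k, hk.symm⟩, fun ⟨k, hk⟩ => ⟨k, hk.symm⟩⟩
  have i0 : I := Classical.arbitrary I
  have : Finite (L ⧸ H) := by
    refine Finite.of_surjective (fun j : J => (D i0 j : L ⧸ H)) ?_
    intro q
    obtain ⟨l, rfl⟩ := QuotientAddGroup.mk_surjective q
    obtain ⟨j, ⟨k, hk⟩, _⟩ := hD i0 l
    refine ⟨j, ?_⟩
    rw [QuotientAddGroup.eq]
    rw [hH]
    exact ⟨k, by rw [← hk]; abel⟩
  have := Fintype.ofFinite (L ⧸ H)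
  let f : AddChar (L ⧸ H) ℂ → Tor L := fun ψ =>
    (AddChar.circleEquivComplex.symm ψ).compAddMonoidHom (QuotientAddGroup.mk' H)
  have hcv : ∀ ψ l, cv (f ψ) l = ψ (l : L ⧸ H) := by
    intro ψ l
    have : ψ = AddChar.circleEquivComplex (AddChar.circleEquivComplex.symm ψ) := by simp
    conv_rhs => rw [this]
    rfl
  have hinj : Function.Injective f := by
    intro ψ ψ' h
    refine DFunLike.ext _ _ fun q => ?_
    obtain ⟨l, rfl⟩ := QuotientAddGroup.mk_surjective q
    rw [← hcv, ← hcv, h]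
  refine ⟨Finset.univ.image f, ⟨?_, ?_, ?_, ?_⟩⟩
  · refine Finset.mem_image.2 ⟨1, Finset.mem_univ _, cv_ext fun l => ?_⟩
    rw [hcv, cv_one]; rfl
  · intro κ hκ l
    obtain ⟨ψ, _, rfl⟩ := Finset.mem_image.1 hκ
    rw [hcv]
    have : ((R l : L) : L ⧸ H) = 0 := (QuotientAddGroup.eq_zero_iff _).2 ((hH _).2 ⟨l, rfl⟩)
    rw [this]; simp
  · intro l
    rw [Finset.sum_image (fun a _ b _ h => hinj h), Finset.card_image_of_injective _ hinj]
    simp_rw [hcv]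
    rw [AddChar.sum_apply_eq_ite]
    have : ((l : L ⧸ H) = 0) ↔ ∃ k, l = R k := by
      rw [QuotientAddGroup.eq_zero_iff, hH]
    simp only [this]
    have hc : Fintype.card (L ⧸ H) = (Finset.univ : Finset (AddChar (L ⧸ H) ℂ)).card := by
      rw [Finset.card_univ, AddChar.card_eq]
    rw [hc]
  · intro κ hκ κ' hκ'
    obtain ⟨ψ, _, rfl⟩ := Finset.mem_image.1 hκ
    obtain ⟨ψ', _, rfl⟩ := Finset.mem_image.1 hκ'
    refine Finset.mem_image.2 ⟨ψ * ψ', Finset.mem_univ _, cv_ext fun l => ?_⟩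
    rw [hcv, cv_mul, hcv, hcv]; rfl

variable [Module.Free ℤ L] [Module.Finite ℤ L]
  {I J : Type} [Fintype I] [Nonempty I] [MeasurableSpace I] [DiscreteMeasurableSpace I]
  [Fintype J] [Nonempty J] [MeasurableSpace J] [DiscreteMeasurableSpace J]
  {R : L →ₗ[ℤ] L} {T : Du L →ₗ[ℝ] Du L} {D : I → J → L}

lemma dA_surj (h : IsSys R T D) (χ : Tor L) : ∃ y, dA R y = χ := by
  obtain ⟨γ, rfl⟩ := tch_surj χ
  refine ⟨tch (T γ), cv_ext fun l => ?_⟩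
  rw [cv_dA, cv_tch, cv_tch, h.T_R]

lemma dA_open (h : IsSys R T D) : IsOpenMap (dA R) := by
  obtain ⟨K, hK⟩ := kap_exists h.hD
  have i0 : I := Classical.arbitrary I
  intro U hU
  rw [isOpen_iff_forall_mem_open]
  rintro _ ⟨ψ, hψ, rfl⟩
  obtain ⟨s, c, h1, h2⟩ := tsep hU.isClosed_compl (χ := ψ) (by simpa using hψ)
  choose res hres _ using fun l => h.hD i0 l
  choose k hk using hres
  have hre : ∀ l j, res l = j ↔ ∃ k, l - D i0 j = R k := by
    intro l j
    constructor
    · rintro rfl; exact ⟨_, hk l⟩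
    · intro hj
      exact (h.hD i0 l).unique ⟨_, hk l⟩ hj
  have h3 : ∃ j, ∑ l ∈ s with res l = j, c l * cv ψ l ≠ 0 := by
    by_contra hcon
    push Not at hcon
    apply h2
    rw [← Finset.sum_fiberwise_of_maps_to (t := Finset.univ) (g := res) (fun _ _ => Finset.mem_univ _)]
    exact Finset.sum_eq_zero fun j _ => hcon j
  obtain ⟨j, hj⟩ := h3
  have key : ∀ y : Tor L, ∑ l ∈ s with res l = j, c l * cv y l =
      cv y (D i0 j) * ∑ l ∈ s with res l = j, c l * cv (dA R y) (k l) := by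
    intro y
    rw [Finset.mul_sum]
    refine Finset.sum_congr rfl fun l hl => ?_
    rw [cv_dA]
    have hl' : res l = j := (Finset.mem_filter.1 hl).2
    have : l = D i0 j + R (k l) := by rw [← hk l, hl']; abel
    conv_lhs => rw [this, cv_add]
    rw [← this]; ring
  refine ⟨{χ | ∑ l ∈ s with res l = j, c l * cv χ (k l) = 0}ᶜ, ?_, (tz _ c k).isOpen_compl, ?_⟩
  · intro χ hχ
    obtain ⟨y, rfl⟩ := dA_surj h χ
    have hy : ∑ l ∈ s with res l = j, c l * cv y l ≠ 0 := by
      rw [key]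
      exact mul_ne_zero (cv_ne _ _) hχ
    have h4 := kinv hK s c id (D i0 j) y
    have h5 : ∑ κ ∈ K, cv κ (-(D i0 j)) * ∑ a ∈ s, c a * cv (κ * y) (id a) ≠ 0 := by
      rw [h4]
      refine mul_ne_zero hK.card_ne ?_
      simp_rw [id, ← hre]
      exact hy
    obtain ⟨κ, hκ, h6⟩ := Finset.exists_ne_zero_of_sum_ne_zero h5
    refine ⟨κ * y, ?_, hK.dA hκ y⟩
    by_contra hU'
    exact h6 (by simp only [id]; rw [h1 _ hU', mul_zero])
  · intro h0
    apply hj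
    rw [key]
    have h0' : ∑ l ∈ s with res l = j, c l * cv (dA R ψ) (k l) = 0 := h0
    rw [h0', mul_zero]

/-- digit masks -/
def mm (D : I → J → L) (i : I) (ψ : Tor L) : ℂ := ∑ j, cv ψ (D i j)

/-- points with positive transition weight -/
def Pos (D : I → J → L) : Set (Tor L) := {ψ | ∃ i, mm D i ψ ≠ 0}

lemma Pos_open (D : I → J → L) : IsOpen (Pos D) := by
  have : Pos D = ⋃ i, {ψ | ∑ j, (1 : ℂ) * cv ψ (D i j) = 0}ᶜ := by
    ext ψ; simp [Pos, mm]
  rw [this]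
  exact isOpen_iUnion fun i => (tz _ _ _).isOpen_compl

lemma mm_inv (h : IsSys R T D) {K : Finset (Tor L)} (hK : IsK R K) (i : I) (j : J) (y : Tor L) :
    ∑ κ ∈ K, cv κ (-(D i j)) * mm D i (κ * y) = K.card * cv y (D i j) := by
  have := kinv hK Finset.univ (fun _ => 1) (D i) (D i j) y
  simp only [one_mul] at this
  rw [show (∑ κ ∈ K, cv κ (-(D i j)) * mm D i (κ * y)) = _ from this]
  congr 1
  have hf : (Finset.univ.filter fun a => ∃ k, D i a - D i j = R k) = {j} := by
    ext a
    simp only [Finset.mem_filter, Finset.mem_univ, true_and, Finset.mem_singleton]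
    constructor
    · intro ⟨k, hk⟩
      exact (h.hD i (D i a)).unique ⟨0, by simp⟩ ⟨k, hk⟩
    · rintro rfl; exact ⟨0, by simp⟩
  rw [hf]; simp

lemma Pos_surj (h : IsSys R T D) (χ : Tor L) : ∃ y ∈ Pos D, dA R y = χ := by
  obtain ⟨K, hK⟩ := kap_exists h.hD
  obtain ⟨y, rfl⟩ := dA_surj h χ
  have i : I := Classical.arbitrary I
  have j : J := Classical.arbitrary J
  have h1 : ∑ κ ∈ K, cv κ (-(D i j)) * mm D i (κ * y) ≠ 0 := by
    rw [mm_inv h hK]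
    exact mul_ne_zero hK.card_ne (cv_ne _ _)
  obtain ⟨κ, hκ, h6⟩ := Finset.exists_ne_zero_of_sum_ne_zero h1
  exact ⟨κ * y, ⟨i, right_ne_zero_of_mul h6⟩, hK.dA hκ y⟩

lemma mm_pow (R : L →ₗ[ℤ] L) (D : I → J → L) (m : ℕ) (i : Fin m → I) (χ : Tor L) :
    mm (pwD R D m) i χ = ∏ r : Fin m, mm D (i r) ((dA R)^[m - 1 - r] χ) := by
  unfold mm
  rw [Finset.prod_univ_sum, Fintype.piFinset_univ]
  refine Finset.sum_congr rfl fun j _ => ?_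
  have : ∀ s : Finset (Fin m), ∀ f : Fin m → L, cv χ (∑ r ∈ s, f r) = ∏ r ∈ s, cv χ (f r) := by
    intro s f
    induction s using Finset.induction_on with
    | empty => simp [cv_zero]
    | insert a s ha ih => rw [Finset.sum_insert ha, Finset.prod_insert ha, cv_add, ih]
  rw [pwD, this]
  refine Finset.prod_congr rfl fun r _ => ?_
  rw [dA_iter, cv_dA]

lemma Pos_pow (R : L →ₗ[ℤ] L) (D : I → J → L) (m : ℕ) : Pos (pwD R D m) ⊆ PosM (dA R) (Pos D) m := by
  rintro χ ⟨i, hi⟩ k hk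
  rw [mm_pow] at hi
  have := Finset.prod_ne_zero_iff.1 hi ⟨m - 1 - k, by omega⟩ (Finset.mem_univ _)
  refine ⟨i ⟨m - 1 - k, by omega⟩, ?_⟩
  convert this using 3
  simp only
  omega

end
end FM

namespace FM

open TopologicalSpace

section
variable {L : Type} [AddCommGroup L] [Module.Free ℤ L] [Module.Finite ℤ L]

lemma cv_sep (l : L) (h : ∀ χ : Tor L, cv χ l = 1) : l = 0 := by
  refine sep l fun γ => ?_
  by_contra hγ
  have h1 := h (tch ((2 * γ l)⁻¹ • γ))
  rw [cv_tch, ee_eq_one] at h1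
  obtain ⟨n, hn⟩ := h1
  have : (2 * γ l)⁻¹ * γ l = n := by simpa using hn
  rw [mul_inv, mul_assoc, inv_mul_cancel₀ hγ, mul_one] at this
  have h2 : (1 : ℝ) = 2 * n := by rw [← this]; norm_num
  have h3 : (1 : ℤ) = 2 * n := by exact_mod_cast h2
  omega

lemma cv_li (s : Finset L) (c : L → ℂ) (h : ∀ χ : Tor L, ∑ l ∈ s, c l * cv χ l = 0) :
    ∀ l ∈ s, c l = 0 := by
  let f : L → (Tor L →* ℂ) := fun l =>
    { toFun := fun χ => cv χ l
      map_one' := cv_one l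
      map_mul' := fun χ ψ => cv_mul χ ψ l }
  have hf : Function.Injective f := by
    intro l l' hl
    rw [← sub_eq_zero]
    refine cv_sep _ fun χ => ?_
    have : cv χ l = cv χ l' := DFunLike.congr_fun hl χ
    rw [sub_eq_add_neg, cv_add, cv_neg, this, mul_inv_cancel₀ (cv_ne _ _)]
  have hl := (linearIndependent_monoidHom (Tor L) ℂ).comp f hf
  refine linearIndependent_iff'.1 hl s c ?_
  ext χ
  simp only [Finset.sum_apply, Function.comp, Pi.smul_apply, smul_eq_mul, Pi.zero_apply]
  exact h χ

lemma tor_max (q : (L → Circle) → ℝ) (hq : Continuous q) :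
    ∃ χ : Tor L, ∀ ψ : Tor L, q (ad ψ) ≤ q (ad χ) := by
  let X : Set (L → Circle) := {x | x 0 = 1 ∧ ∀ l m, x (l + m) = x l * x m}
  have hX : IsCompact X := by
    refine IsClosed.isCompact ?_
    have : X = {x | x 0 = 1} ∩ ⋂ l, ⋂ m, {x | x (l + m) = x l * x m} := by
      ext x; simp [X]
    rw [this]
    refine IsClosed.inter (isClosed_eq (continuous_apply 0) continuous_const) ?_
    refine isClosed_iInter fun l => isClosed_iInter fun m => ?_
    exact isClosed_eq (continuous_apply _) ((continuous_apply l).mul (continuous_apply m))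
  have hmem : ∀ ψ : Tor L, (ad ψ : L → Circle) ∈ X := fun ψ =>
    ⟨(ad ψ).map_zero_eq_one, fun l m => (ad ψ).map_add_eq_mul l m⟩
  obtain ⟨x, hx, hmax⟩ := hX.exists_isMaxOn ⟨_, hmem 1⟩ hq.continuousOn
  refine ⟨(⟨x, hx.1, hx.2⟩ : AddChar L Circle), fun ψ => ?_⟩
  exact hmax (hmem ψ)

variable {I J : Type} [Fintype I] [Nonempty I] [MeasurableSpace I] [DiscreteMeasurableSpace I]
  [Fintype J] [Nonempty J] [MeasurableSpace J] [DiscreteMeasurableSpace J]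
  {R : L →ₗ[ℤ] L} {T : Du L →ₗ[ℝ] Du L} {D : I → J → L}

/-- transition weight -/
def Uw (D : I → J → L) (w : Tor L) : ℝ := ∑ i, ‖mm D i w‖ ^ 2

lemma Uw_nonneg (D : I → J → L) (w : Tor L) : 0 ≤ Uw D w :=
  Finset.sum_nonneg fun i _ => by positivity

lemma Uw_pos {D : I → J → L} {w : Tor L} (h : w ∈ Pos D) : 0 < Uw D w := by
  obtain ⟨i, hi⟩ := h
  refine Finset.sum_pos' (fun i _ => by positivity) ⟨i, Finset.mem_univ _, ?_⟩
  have := norm_pos_iff.2 hi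
  positivity

lemma Uw_mul (D : I → J → L) (w : Tor L) (e : L) : (Uw D w : ℂ) * cv w e =
    ∑ t : (I × J) × J, 1 * cv w (e + D t.1.1 t.1.2 - D t.1.1 t.2) := by
  rw [Fintype.sum_prod_type, Fintype.sum_prod_type]
  unfold Uw
  push_cast
  rw [Finset.sum_mul]
  refine Finset.sum_congr rfl fun i _ => ?_
  rw [← Complex.conj_mul' (mm D i w)]
  unfold mm
  rw [map_sum, Finset.sum_mul_sum, Finset.sum_comm, Finset.sum_mul]
  refine Finset.sum_congr rfl fun j _ => ?_
  rw [Finset.sum_mul]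
  refine Finset.sum_congr rfl fun j' _ => ?_
  rw [cv_conj, sub_eq_add_neg, cv_add, cv_add]; ring

lemma Uw_sum (h : IsSys R T D) {K : Finset (Tor L)} (hK : IsK R K) (y : Tor L) (e : L) :
    ∑ κ ∈ K, (Uw D (κ * y) : ℂ) * cv (κ * y) e = K.card * ∑ p : I × J, cv (dA R y) (stp h p e) := by
  have := kinv hK Finset.univ (fun _ => 1)
    (fun t : (I × J) × J => e + D t.1.1 t.1.2 - D t.1.1 t.2) 0 y
  simp only [neg_zero, cv_zero, sub_zero] at this
  simp_rw [Uw_mul]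
  simp only [one_mul] at this ⊢
  rw [this]
  congr 1
  rw [Finset.sum_filter, Fintype.sum_prod_type]
  refine Finset.sum_congr rfl fun p _ => ?_
  obtain ⟨j', hj'⟩ := stp_spec h p e
  rw [Finset.sum_eq_single j']
  · rw [if_pos ⟨_, hj'.symm⟩, cv_dA, hj']
  · intro b _ hb
    rw [if_neg]
    rintro ⟨k, hk⟩
    exact hb ((h.hD p.1 (e + D p.1 p.2)).unique ⟨k, hk⟩ ⟨_, hj'.symm⟩)
  · simp

lemma ν_exists (h : IsSys R T D) (hnr : ¬ Reach h) : ∃ (S : Finset L) (ν : S → ℂ), 0 ∉ S ∧ ν ≠ 0 ∧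
    ∀ χ : Tor L, ∑ e : S, ν e * ∑ p : I × J, cv χ (stp h p e) =
      (Fintype.card (I × J) : ℂ) * ∑ e : S, ν e * cv χ e := by
  unfold Reach at hnr
  push Not at hnr
  obtain ⟨e0, he0⟩ := hnr
  let f : List (I × J) → L := fun w => w.foldl (fun e p => stp h p e) e0
  have hfin : (Set.range f).Finite := by
    refine (fin_bdd (cB T D e0)).subset ?_
    rintro _ ⟨w, rfl⟩
    induction w using List.reverseRecOn with
    | nil => exact fun γ => cB_self h e0 γ
    | append_singleton w p ih =>
      simp only [f, List.foldl_append, List.foldl_cons, List.foldl_nil] at ih ⊢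
      exact fun γ => cB_step h e0 _ ih p γ
  have hstp : ∀ p, ∀ e ∈ hfin.toFinset, stp h p e ∈ hfin.toFinset := by
    intro p e he
    rw [Set.Finite.mem_toFinset] at he ⊢
    obtain ⟨w, rfl⟩ := he
    exact ⟨w ++ [p], by simp [f]⟩
  have hne : e0 ∈ hfin.toFinset := by
    rw [Set.Finite.mem_toFinset]; exact ⟨[], rfl⟩
  have h0 : 0 ∉ hfin.toFinset := by
    rw [Set.Finite.mem_toFinset]
    rintro ⟨w, hw⟩
    exact he0 w hw
  generalize hfin.toFinset = S at hstp hne h0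
  let st : I × J → S → S := fun p e => ⟨stp h p e, hstp p e e.2⟩
  let P : Matrix S S ℂ := fun e e' => ∑ p : I × J, if st p e = e' then 1 else 0
  have hP : ∀ (g : S → ℂ) e, (P *ᵥ g) e = ∑ p : I × J, g (st p e) := by
    intro g e
    simp only [Matrix.mulVec, dotProduct, P]
    simp_rw [Finset.sum_mul]
    rw [Finset.sum_comm]
    refine Finset.sum_congr rfl fun p _ => ?_
    simp
  let N : ℂ := (Fintype.card (I × J) : ℂ)
  have hdet : (P - N • (1 : Matrix S S ℂ)).det = 0 := by
    refine Matrix.exists_mulVec_eq_zero_iff.1 ⟨fun _ => 1, ?_, ?_⟩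
    · intro hh
      have := congrFun hh ⟨e0, hne⟩
      simp at this
    · rw [Matrix.sub_mulVec, Matrix.smul_mulVec, Matrix.one_mulVec]
      ext e
      rw [Pi.sub_apply, hP]
      simp [N]
  obtain ⟨ν, hν, hν2⟩ := Matrix.exists_vecMul_eq_zero_iff.2 hdet
  refine ⟨S, ν, h0, hν, fun χ => ?_⟩
  have h3 : ν ᵥ* P = N • ν := by
    rw [Matrix.vecMul_sub, Matrix.vecMul_smul, Matrix.vecMul_one, sub_eq_zero] at hν2
    exact hν2
  have h4 : ν ⬝ᵥ (P *ᵥ fun e : S => cv χ e) = N * (ν ⬝ᵥ fun e : S => cv χ e) := by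
    rw [Matrix.dotProduct_mulVec, h3, smul_dotProduct, smul_eq_mul]
  simp only [dotProduct] at h4
  simp_rw [hP] at h4
  exact h4

lemma M0_exists (h : IsSys R T D) (hnr : ¬ Reach h) : ∃ M0 : Set (Tor L), IsClosed M0 ∧
    M0.Nonempty ∧ BC (dA R) (Pos D) 1 M0 ∧ 1 ∉ M0 := by
  obtain ⟨S, ν, h0, hν, hS⟩ := ν_exists h hnr
  obtain ⟨K, hK⟩ := kap_exists h.hD
  let Q : Tor L → ℂ := fun χ => ∑ e : S, ν e * cv χ e
  have hQ : ∃ χ0, Q χ0 ≠ Q 1 := by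
    by_contra hcon
    push Not at hcon
    apply hν
    let c : L → ℂ := fun l => if hl : l ∈ S then ν ⟨l, hl⟩ else - Q 1
    have h1 := cv_li (insert 0 S) c (by
      intro χ
      rw [Finset.sum_insert h0, ← Finset.sum_coe_sort S]
      have : ∑ i : S, c i * cv χ i = Q χ := by
        refine Finset.sum_congr rfl fun e _ => ?_
        simp [c]
      rw [this, hcon]
      simp [c, h0, cv_zero])
    ext e
    have := h1 e (Finset.mem_insert_of_mem e.2)
    simpa [c] using this
  obtain ⟨χ0, hχ0⟩ := hQ
  let c : ℂ := starRingEnd ℂ (Q χ0 - Q 1)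
  let q : Tor L → ℝ := fun χ => (c * Q χ).re
  obtain ⟨χm, hm⟩ := tor_max (L := L) (fun x => (c * ∑ e : S, ν e * (x e : ℂ)).re) (by fun_prop)
  have hm' : ∀ ψ, q ψ ≤ q χm := hm
  clear hm
  refine ⟨{χ | q χ = q χm}, ?_, ⟨χm, rfl⟩, ?_, ?_⟩
  · let a : Option (S ⊕ S) → ℂ := fun o => match o with
      | none => - (q χm : ℂ)
      | some (Sum.inl e) => c * ν e / 2
      | some (Sum.inr e) => starRingEnd ℂ (c * ν e) / 2
    let b : Option (S ⊕ S) → L := fun o => match o with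
      | none => 0
      | some (Sum.inl e) => e
      | some (Sum.inr e) => - e
    have := tz Finset.univ a b
    convert this using 1
    ext χ
    simp only [Set.mem_ofPred_eq]
    rw [Fintype.sum_option, Fintype.sum_sum_type]
    simp only [a, b, cv_zero]
    have e1 : ∑ e : S, c * ν e / 2 * cv χ e = (c * Q χ) / 2 := by
      simp only [Q, Finset.mul_sum, Finset.sum_div]
      exact Finset.sum_congr rfl fun e _ => by ring
    have e2 : ∑ e : S, starRingEnd ℂ (c * ν e) / 2 * cv χ (-(e : L)) = starRingEnd ℂ (c * Q χ) / 2 := by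
      simp only [Q, Finset.mul_sum, map_sum, Finset.sum_div]
      exact Finset.sum_congr rfl fun e _ => by
        rw [← cv_conj, ← mul_assoc, map_mul (starRingEnd ℂ) (c * ν e)]; ring
    rw [e1, e2]
    have e3 : c * Q χ / 2 + starRingEnd ℂ (c * Q χ) / 2 = (q χ : ℂ) := by
      rw [← add_div, Complex.add_conj]; simp [q]
    rw [e3]
    constructor
    · intro hh; rw [hh]; ring
    · intro hh
      have : (q χ : ℂ) = q χm := by linear_combination hh
      exact_mod_cast this
  · intro x hx hAx
    have hxP : x ∈ Pos D := hx 0 (by omega)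
    have hAx' : q (dA R x) = q χm := hAx
    -- averaging
    have av : ∀ y, ∑ κ ∈ K, (Uw D (κ * y) : ℂ) * Q (κ * y) =
        K.card * (Fintype.card (I × J) : ℂ) * Q (dA R y) := by
      intro y
      simp only [Q]
      simp_rw [Finset.mul_sum]
      rw [Finset.sum_comm]
      have : ∀ e : S, ∑ κ ∈ K, (Uw D (κ * y) : ℂ) * (ν e * cv (κ * y) e) =
          K.card * (ν e * ∑ p : I × J, cv (dA R y) (stp h p e)) := by
        intro e
        rw [mul_left_comm, ← Uw_sum h hK, Finset.mul_sum]
        exact Finset.sum_congr rfl fun κ _ => by ring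
      simp_rw [this]
      rw [← Finset.mul_sum, hS, Finset.mul_sum, Finset.mul_sum]
      exact Finset.sum_congr rfl fun e _ => by ring
    have tot : ∑ κ ∈ K, Uw D (κ * x) = K.card * (Fintype.card (I × J) : ℝ) := by
      have := Uw_sum h hK x 0
      simp only [stp_zero, cv_zero, mul_one] at this
      simp only [Finset.sum_const, Finset.card_univ, nsmul_eq_mul, mul_one] at this
      exact_mod_cast this
    have av' : ∑ κ ∈ K, Uw D (κ * x) * q (κ * x) = K.card * (Fintype.card (I × J) : ℝ) * q χm := by
      rw [← hAx']
      have h1 := congrArg (fun z => (c * z).re) (av x)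
      simp only [Finset.mul_sum, Complex.re_sum] at h1
      have h2 : ∀ κ, (c * ((Uw D (κ * x) : ℂ) * Q (κ * x))).re = Uw D (κ * x) * q (κ * x) := by
        intro κ
        rw [mul_left_comm, Complex.re_ofReal_mul]
      simp_rw [h2] at h1
      rw [h1]
      have : c * (K.card * (Fintype.card (I × J) : ℂ) * Q (dA R x)) =
          ((K.card * (Fintype.card (I × J) : ℝ) : ℝ) : ℂ) * (c * Q (dA R x)) := by
        push_cast; ring
      rw [this, Complex.re_ofReal_mul]
    have z : ∑ κ ∈ K, Uw D (κ * x) * (q χm - q (κ * x)) = 0 := by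
      simp_rw [mul_sub]
      rw [Finset.sum_sub_distrib, av', ← Finset.sum_mul, tot, sub_self]
    rw [Finset.sum_eq_zero_iff_of_nonneg (fun κ _ =>
      mul_nonneg (Uw_nonneg _ _) (sub_nonneg.2 (hm' _)))] at z
    have z1 := z 1 hK.one
    rw [one_mul] at z1
    have := (mul_eq_zero.1 z1).resolve_left (Uw_pos hxP).ne'
    show q x = q χm
    linarith
  · intro h1
    have h1' : q 1 = q χm := h1
    have h2 := hm' χ0
    have h3 : q χ0 - q 1 = ‖Q χ0 - Q 1‖ ^ 2 := by
      simp only [q]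
      rw [← Complex.sub_re, ← mul_sub, Complex.conj_mul']
      norm_cast
    have h4 : 0 < ‖Q χ0 - Q 1‖ := norm_pos_iff.2 (sub_ne_zero.2 hχ0)
    have : 0 < ‖Q χ0 - Q 1‖ ^ 2 := by positivity
    linarith

end
end FM

namespace FM

open TopologicalSpace

section
variable {L : Type} [AddCommGroup L] [Module.Free ℤ L] [Module.Finite ℤ L]
  {I J : Type} [Fintype I] [Nonempty I] [MeasurableSpace I] [DiscreteMeasurableSpace I]
  [Fintype J] [Nonempty J] [MeasurableSpace J] [DiscreteMeasurableSpace J]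
  {R : L →ₗ[ℤ] L} {T : Du L →ₗ[ℝ] Du L} {D : I → J → L}

/-- invariant irreducible closed sets -/
structure Gd (R : L →ₗ[ℤ] L) (D : I → J → L) (M : Set (Tor L)) : Prop where
  cl : IsClosed M
  irr : IsIrreducible M
  fwd : ∀ x ∈ M, dA R x ∈ M
  bwd : ∀ x ∈ Pos D, dA R x ∈ M → x ∈ M

/-- generating condition on the differences of digits -/
def Nrm (R : L →ₗ[ℤ] L) (D : I → J → L) : Prop :=
  ∀ H : AddSubgroup L, (∀ i j j' k, (R ^ k) (D i j - D i j') ∈ H) → H = ⊤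

lemma Nrm.pow (hn : Nrm R D) (m : ℕ) (hm : 1 ≤ m) : Nrm (R ^ m) (pwD R D m) := by
  intro H hH
  refine hn H fun i j j' k => ?_
  have hk : k % m < m := Nat.mod_lt _ (by omega)
  let r0 : Fin m := ⟨m - 1 - k % m, by omega⟩
  have := hH (fun _ => i) (fun r => if r = r0 then j else j) (fun r => if r = r0 then j' else j) (k / m)
  convert this using 1
  rw [pwD, pwD, ← Finset.sum_sub_distrib, Finset.sum_eq_single r0]
  · simp only [if_true, ← map_sub]
    rw [← pow_mul, ← Module.End.mul_apply, ← pow_add]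
    congr 2
    simp only [r0]
    have := Nat.div_add_mod k m
    omega
  · intro b _ hb
    simp [hb]
  · simp

lemma Gd.pow {M : Set (Tor L)} (g : Gd R D M) (m : ℕ) : Gd (R ^ m) (pwD R D m) M := by
  refine ⟨g.cl, g.irr, ?_, ?_⟩
  · intro x hx
    rw [← dA_iter]
    exact Set.MapsTo.iterate (s := M) (f := dA R) g.fwd m hx
  · intro x hx hA
    have h1 : BC (dA R) (Pos D) 1 M := fun y hy hyA => g.bwd y (hy 0 (by omega)) hyA
    have h2 := h1.mul m
    rw [one_mul] at h2
    rw [← dA_iter] at hA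
    exact h2 x (Pos_pow R D m hx) hA

lemma Gd_of_BC {M : Set (Tor L)} {m : ℕ} (cl : IsClosed M) (irr : IsIrreducible M)
    (fwd : ∀ x ∈ M, (dA R)^[m] x ∈ M) (hb : BC (dA R) (Pos D) m M) : Gd (R ^ m) (pwD R D m) M := by
  refine ⟨cl, irr, ?_, ?_⟩
  · intro x hx
    rw [← dA_iter]; exact fwd x hx
  · intro x hx hA
    rw [← dA_iter] at hA
    exact hb x (Pos_pow R D m hx) hA

lemma Gd.fi {M : Set (Tor L)} (g : Gd R D M) {K : Finset (Tor L)} (hK : IsK R K) {κ : Tor L}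
    (hκ : κ ∈ K) {z : Tor L} (hz : z ∈ M) {i : I} (hi : mm D i (κ * z) ≠ 0) :
    ∀ w ∈ M, κ * w ∈ M := by
  have hU : IsOpen ((fun w => κ * w) ⁻¹' (Pos D)) := (Pos_open D).preimage (tmul_cont κ)
  have h1 := subset_closure_inter_of_isPreirreducible_of_isOpen g.irr.2 hU ⟨z, hz, i, hi⟩
  have hC : IsClosed ((fun w => κ * w) ⁻¹' M) := g.cl.preimage (tmul_cont κ)
  intro w hw
  refine (closure_minimal ?_ hC) (h1 hw)
  rintro v ⟨hv, hv2⟩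
  refine g.bwd _ hv2 ?_
  rw [hK.dA hκ]
  exact g.fwd v hv

lemma Gd.fi2 {M : Set (Tor L)} (h : IsSys R T D) (g : Gd R D M) {K : Finset (Tor L)} (hK : IsK R K)
    (i : I) (j j' : J) (hst : ∀ κ ∈ K, (∀ w ∈ M, κ * w ∈ M) → cv κ (D i j) = cv κ (D i j'))
    {z : Tor L} (hz : z ∈ M) : cv z (D i j) = cv z (D i j') := by
  have h1 := mm_inv h hK i j z
  have h2 := mm_inv h hK i j' z
  have h3 : ∑ κ ∈ K, cv κ (-(D i j)) * mm D i (κ * z) = ∑ κ ∈ K, cv κ (-(D i j')) * mm D i (κ * z) := by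
    refine Finset.sum_congr rfl fun κ hκ => ?_
    by_cases h0 : mm D i (κ * z) = 0
    · rw [h0, mul_zero, mul_zero]
    · rw [cv_neg, cv_neg, hst κ hκ (g.fi hK hκ hz h0)]
  rw [h1, h2] at h3
  exact mul_left_cancel₀ hK.card_ne h3

/-- functions constant on `M` -/
def cst (M : Set (Tor L)) : AddSubgroup L where
  carrier := {n | ∀ z ∈ M, ∀ z' ∈ M, cv z n = cv z' n}
  zero_mem' := by intro z _ z' _; rw [cv_zero, cv_zero]
  add_mem' := by
    intro a b ha hb z hz z' hz'
    rw [cv_add, cv_add, ha z hz z' hz', hb z hz z' hz']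
  neg_mem' := by
    intro a ha z hz z' hz'
    rw [cv_neg, cv_neg, ha z hz z' hz']

lemma mem_cst {M : Set (Tor L)} {n : L} : n ∈ cst M ↔ ∀ z ∈ M, ∀ z' ∈ M, cv z n = cv z' n := Iff.rfl

lemma mem_cst_of {M : Set (Tor L)} {a b : L} (h : ∀ z ∈ M, cv z a = cv z b) : a - b ∈ cst M := by
  have : ∀ z ∈ M, cv z (a - b) = 1 := by
    intro z hz
    rw [sub_eq_add_neg, cv_add, cv_neg, h z hz, mul_inv_cancel₀ (cv_ne _ _)]
  intro z hz z' hz'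
  rw [this z hz, this z' hz']

lemma cst_stab {M : Set (Tor L)} {b : L} (hb : b ∈ cst M) {κ : Tor L} (hne : M.Nonempty)
    (hst : ∀ w ∈ M, κ * w ∈ M) : cv κ b = 1 := by
  obtain ⟨z, hz⟩ := hne
  have := hb _ (hst z hz) z hz
  rw [cv_mul] at this
  exact mul_right_cancel₀ (cv_ne z b) (by rw [this, one_mul])

lemma Gd.cst_R {M : Set (Tor L)} (g : Gd R D M) {n : L} (hn : n ∈ cst M) : R n ∈ cst M := by
  intro z hz z' hz'
  rw [← cv_dA, ← cv_dA]
  exact hn _ (g.fwd z hz) _ (g.fwd z' hz')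

lemma Gd.cst_sat {M : Set (Tor L)} (h : IsSys R T D) (g : Gd R D M) {n : L} (hn : R n ∈ cst M) :
    n ∈ cst M := by
  intro z hz z' hz'
  obtain ⟨y, hy, rfl⟩ := Pos_surj h z
  obtain ⟨y', hy', rfl⟩ := Pos_surj h z'
  rw [cv_dA, cv_dA]
  exact hn _ (g.bwd y hy hz) _ (g.bwd y' hy' hz')

lemma cv_nsmul (χ : Tor L) (k : ℕ) (n : L) : cv χ (k • n) = cv χ n ^ k := by
  induction k with
  | zero => simp [cv_zero]
  | succ k ih => rw [succ_nsmul, cv_add, ih, pow_succ]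

lemma Gd.cst_prim {M : Set (Tor L)} (g : Gd R D M) {n : L} {k : ℕ} (hk : k ≠ 0)
    (hn : k • n ∈ cst M) : n ∈ cst M := by
  obtain ⟨z0, hz0⟩ := g.irr.1
  let t : Finset (Set (Tor L)) := (Polynomial.nthRoots k (cv z0 n ^ k)).toFinset.image
    (fun ζ => {χ : Tor L | cv χ n = ζ})
  obtain ⟨C, hC, hMC⟩ := isIrreducible_iff_sUnion_isClosed.1 g.irr t (by
    intro C hC
    obtain ⟨ζ, _, rfl⟩ := Finset.mem_image.1 hC
    have := tz (Finset.univ : Finset Bool) (fun b => if b then 1 else -ζ) (fun b => if b then n else 0)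
    convert this using 1
    ext χ
    simp [cv_zero, ← sub_eq_add_neg, sub_eq_zero]) (by
    intro w hw
    refine Set.mem_sUnion.2 ⟨{χ | cv χ n = cv w n}, ?_, rfl⟩
    refine Finset.mem_coe.2 (Finset.mem_image.2 ⟨cv w n, ?_, rfl⟩)
    rw [Multiset.mem_toFinset, Polynomial.mem_nthRoots (Nat.pos_of_ne_zero hk)]
    rw [← cv_nsmul, ← cv_nsmul]
    exact hn w hw z0 hz0)
  obtain ⟨ζ, _, rfl⟩ := Finset.mem_image.1 hC
  intro z hz z' hz'
  exact (hMC hz).trans (hMC hz').symm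

lemma Gd.cst_QP {M : Set (Tor L)} (h : IsSys R T D) (g : Gd R D M) (i : I) (j j' : J) (k : L)
    (hd : D i j - D i j' - R k ∈ cst M) : D i j - D i j' ∈ cst M := by
  obtain ⟨K, hK⟩ := kap_exists h.hD
  refine mem_cst_of fun z hz => g.fi2 h hK i j j' ?_ hz
  intro κ hκ hst
  have h1 := cst_stab hd g.irr.1 hst
  have : D i j = (D i j - D i j' - R k) + D i j' + R k := by abel
  rw [this, cv_add, cv_add, h1, hK.ann κ hκ]; ring

lemma Gd.cst_ne_top {M : Set (Tor L)} (h : IsSys R T D) (g : Gd R D M) (h1 : 1 ∉ M)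
    (hn : Nrm R D) : cst M ≠ ⊤ := by
  intro htop
  obtain ⟨K, hK⟩ := kap_exists h.hD
  obtain ⟨z, hz⟩ := g.irr.1
  have huniq : ∀ w ∈ M, w = z := fun w hw => cv_ext fun l =>
    (show l ∈ cst M by rw [htop]; trivial) w hw z hz
  have hd : ∀ i j j', cv z (D i j) = cv z (D i j') := by
    intro i j j'
    refine g.fi2 h hK i j j' ?_ hz
    intro κ hκ hst
    have : κ = 1 := mul_right_cancel (b := z) (by rw [huniq _ (hst z hz), one_mul])
    rw [this, cv_one, cv_one]
  have hR : ∀ k l, cv z ((R ^ k) l) = cv z l := by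
    intro k
    induction k with
    | zero => intro l; rfl
    | succ k ih =>
      intro l
      rw [pow_succ, Module.End.mul_apply, ih, ← cv_dA, huniq _ (g.fwd z hz)]
  let H : AddSubgroup L :=
    { carrier := {l | cv z l = 1}
      zero_mem' := cv_zero z
      add_mem' := by
        intro a b ha hb
        have ha' : cv z a = 1 := ha
        have hb' : cv z b = 1 := hb
        show cv z (a + b) = 1
        rw [cv_add, ha', hb', one_mul]
      neg_mem' := by
        intro a ha
        have ha' : cv z a = 1 := ha
        show cv z (-a) = 1
        rw [cv_neg, ha', inv_one] }
  have hH := hn H (by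
    intro i j j' k
    show cv z _ = 1
    rw [hR, sub_eq_add_neg, cv_add, cv_neg, hd i j j', mul_inv_cancel₀ (cv_ne _ _)])
  apply h1
  have : z = 1 := cv_ext fun l => by
    rw [cv_one]
    exact (show l ∈ H by rw [hH]; trivial)
  rwa [← this]

lemma Gd.cst_ne_bot_aux {M : Set (Tor L)} (h : IsSys R T D) (g : Gd R D M)
    (s : Finset L) (c : L → ℂ) (hf : ∀ ψ ∈ M, ∑ l ∈ s, c l * cv ψ l = 0) (l0 : L) (hl0 : l0 ∈ s)
    (hc : c l0 ≠ 0) (hs : ∀ l ∈ s, l ≠ l0 → ¬ ∃ k, l - l0 = R k) : cst M ≠ ⊥ := by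
  obtain ⟨K, hK⟩ := kap_exists h.hD
  let S := K.filter fun κ => ∀ w ∈ M, κ * w ∈ M
  have hS1 : 1 ∈ S := Finset.mem_filter.2 ⟨hK.one, fun w hw => by rwa [one_mul]⟩
  have hSm : ∀ κ ∈ S, ∀ κ' ∈ S, κ * κ' ∈ S := by
    intro κ hκ κ' hκ'
    rw [Finset.mem_filter] at *
    exact ⟨hK.mul _ hκ.1 _ hκ'.1, fun w hw => by rw [mul_assoc]; exact hκ.2 _ (hκ'.2 w hw)⟩
  have hSs : ∀ b, (∃ κ ∈ S, cv κ b ≠ 1) → ∑ κ ∈ S, cv κ b = 0 := by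
    rintro b ⟨κ0, hκ0, hb⟩
    have h1 : S.image (fun κ => κ0 * κ) = S := by
      refine Finset.eq_of_subset_of_card_le ?_ ?_
      · intro κ hκ
        obtain ⟨κ', hκ', rfl⟩ := Finset.mem_image.1 hκ
        exact hSm _ hκ0 _ hκ'
      · rw [Finset.card_image_of_injective _ (mul_right_injective κ0)]
    have h2 : ∑ κ ∈ S, cv κ b = cv κ0 b * ∑ κ ∈ S, cv κ b := by
      conv_lhs => rw [← h1]
      rw [Finset.sum_image (fun a _ b _ hh => mul_right_injective κ0 hh), Finset.mul_sum]
      exact Finset.sum_congr rfl fun κ _ => cv_mul _ _ _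
    have h3 : (1 - cv κ0 b) * ∑ κ ∈ S, cv κ b = 0 := by linear_combination h2
    exact (mul_eq_zero.1 h3).resolve_left (sub_ne_zero.2 (Ne.symm hb))
  obtain ⟨z, hz⟩ := g.irr.1
  have hb : ∃ b, (¬ ∃ k, b = R k) ∧ ∀ κ ∈ S, cv κ b = 1 := by
    by_contra hcon
    push Not at hcon
    have h1 : ∑ κ ∈ S, cv κ (-l0) * ∑ l ∈ s, c l * cv (κ * z) l = 0 := by
      refine Finset.sum_eq_zero fun κ hκ => ?_
      rw [hf _ ((Finset.mem_filter.1 hκ).2 z hz), mul_zero]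
    simp_rw [Finset.mul_sum] at h1
    rw [Finset.sum_comm] at h1
    have h2 : ∀ l ∈ s, ∑ κ ∈ S, cv κ (-l0) * (c l * cv (κ * z) l) =
        c l * cv z l * ∑ κ ∈ S, cv κ (l - l0) := by
      intro l _
      rw [Finset.mul_sum]
      refine Finset.sum_congr rfl fun κ _ => ?_
      rw [cv_mul, sub_eq_add_neg, cv_add]; ring
    rw [Finset.sum_congr rfl h2, Finset.sum_eq_single_of_mem l0 hl0] at h1
    · simp only [sub_self, cv_zero, Finset.sum_const, nsmul_eq_mul, mul_one] at h1
      refine mul_ne_zero (mul_ne_zero hc (cv_ne _ _)) ?_ h1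
      have : S.card ≠ 0 := Finset.card_ne_zero_of_mem hS1
      exact_mod_cast this
    · intro l hl hne
      rw [hSs, mul_zero]
      refine hcon _ fun k hk => hs l hl hne ⟨k, hk⟩
  obtain ⟨b, hb1, hb2⟩ := hb
  have i : I := Classical.arbitrary I
  have j' : J := Classical.arbitrary J
  obtain ⟨j, ⟨k, hk⟩, _⟩ := h.hD i (b + D i j')
  have hd : D i j - D i j' ∈ cst M := by
    refine mem_cst_of fun z hz => g.fi2 h hK i j j' ?_ hz
    intro κ hκ hst
    have h1 := hb2 κ (Finset.mem_filter.2 ⟨hκ, hst⟩)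
    have h2 : b + D i j' = D i j + R k := by rw [← hk]; abel
    have h3 := congrArg (cv κ) h2
    rw [cv_add, cv_add, h1, hK.ann κ hκ, one_mul, mul_one] at h3
    exact h3.symm
  intro hbot
  rw [hbot, AddSubgroup.mem_bot, sub_eq_zero] at hd
  apply hb1
  exact ⟨k, by rw [← hk, hd]; abel⟩

lemma not_range (h : IsSys R T D) (v : L) (hv : v ≠ 0) :
    ∀ᶠ t in atTop, ¬ ∃ k, v = (R ^ t) k := by
  let b := Module.Free.chooseBasis ℤ L
  let f : Module.Free.ChooseBasisIndex ℤ L → Du L :=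
    fun a => (Int.castAddHom ℝ).toIntLinearMap ∘ₗ b.coord a
  have h1 : ∀ᶠ t in atTop, ∀ a, |(T ^ t) (f a) v| < 1 := by
    rw [Filter.eventually_all]
    intro a
    have := (h.hS (f a) v).tendsto_atTop_zero
    exact this.eventually (gt_mem_nhds one_pos)
  filter_upwards [h1] with t ht
  rintro ⟨k, rfl⟩
  apply hv
  have : k = 0 := by
    apply b.ext_elem
    intro a
    have h2 := ht a
    rw [h.pow_hT] at h2
    have h3 : f a k = (b.repr k a : ℝ) := by simp [f]
    rw [h3] at h2
    have h4 : |b.repr k a| < 1 := by exact_mod_cast h2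
    simpa using Int.abs_lt_one_iff.1 h4
  rw [this, map_zero]

lemma Gd.cst_ne_bot {M : Set (Tor L)} (h : IsSys R T D) (g : Gd R D M) (h1 : 1 ∉ M) :
    cst M ≠ ⊥ := by
  obtain ⟨s, c, hf, hne⟩ := tsep g.cl h1
  obtain ⟨l0, hl0, hc⟩ := Finset.exists_ne_zero_of_sum_ne_zero hne
  have ev : ∀ᶠ t in atTop, ∀ l ∈ s, l ≠ l0 → ¬ ∃ k, l - l0 = (R ^ t) k := by
    rw [Filter.eventually_all_finset]
    intro l hl
    by_cases h0 : l = l0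
    · simp [h0]
    · filter_upwards [not_range h (l - l0) (sub_ne_zero.2 h0)] with t ht _
      exact ht
  obtain ⟨t, ht, ht1⟩ := (ev.and (eventually_ge_atTop 1)).exists
  have : NeZero t := ⟨by omega⟩
  exact (g.pow t).cst_ne_bot_aux (h.pow h.inj t) s c hf l0 hl0 (left_ne_zero_of_mul hc) ht

lemma struct_lemma (h : IsSys R T D) (hnr : ¬ Reach h) (hn : Nrm R D) :
    ∃ m : ℕ, 1 ≤ m ∧ ∃ B : AddSubgroup L, B ≠ ⊥ ∧ B ≠ ⊤ ∧ (∀ n ∈ B, (R ^ m) n ∈ B) ∧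
      (∀ n, (R ^ m) n ∈ B → n ∈ B) ∧ (∀ (k : ℕ) n, k ≠ 0 → k • n ∈ B → n ∈ B) ∧
      (∀ i j j' k, pwD R D m i j - pwD R D m i j' - (R ^ m) k ∈ B →
        pwD R D m i j - pwD R D m i j' ∈ B) := by
  obtain ⟨M0, cl, ne, bc, h1⟩ := M0_exists h hnr
  obtain ⟨m, hm, M, hM, Mcl, Mirr, Mf, Mb⟩ := top_lemma (dA_cont R) (dA_open h) (Pos_open D)
    (Pos_surj h) M0 cl ne bc
  have : NeZero m := ⟨by omega⟩
  have g := Gd_of_BC Mcl Mirr Mf Mb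
  have hp := h.pow h.inj m
  have h1M : 1 ∉ M := fun hh => h1 (hM hh)
  exact ⟨m, hm, cst M, g.cst_ne_bot hp h1M, g.cst_ne_top hp h1M (hn.pow m hm), fun n => g.cst_R,
    fun n => g.cst_sat hp, fun k n hk => g.cst_prim hk, fun i j j' k => g.cst_QP hp i j j' k⟩

end
end FM

namespace FM

section
variable {L : Type} [AddCommGroup L] [Module.Free ℤ L] [Module.Finite ℤ L]
  {I J : Type} [Fintype I] [Nonempty I] [MeasurableSpace I] [DiscreteMeasurableSpace I]
  [Fintype J] [Nonempty J] [MeasurableSpace J] [DiscreteMeasurableSpace J]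
  {R : L →ₗ[ℤ] L} {T : Du L →ₗ[ℝ] Du L} {D : I → J → L}

/-- projection -/
def prj (B : AddSubgroup L) : L →ₗ[ℤ] L ⧸ B := (QuotientAddGroup.mk' B).toIntLinearMap
/-- inclusion -/
def inc (B : AddSubgroup L) : B →ₗ[ℤ] L := B.subtype.toIntLinearMap
/-- restriction -/
def resR (B : AddSubgroup L) (f : L →ₗ[ℤ] L) (h : ∀ n ∈ B, f n ∈ B) : B →ₗ[ℤ] B :=
  (AddMonoidHom.mk' (fun b : B => (⟨f b, h b b.2⟩ : B)) (by intro a b; ext; simp)).toIntLinearMap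
/-- induced map -/
def quR (B : AddSubgroup L) (f : L →ₗ[ℤ] L) (h : ∀ n ∈ B, f n ∈ B) : L ⧸ B →ₗ[ℤ] L ⧸ B :=
  (QuotientAddGroup.map B B f.toAddMonoidHom h).toIntLinearMap

lemma prj_surj (B : AddSubgroup L) : Function.Surjective (prj B) := QuotientAddGroup.mk_surjective
lemma inc_inj (B : AddSubgroup L) : Function.Injective (inc B) := Subtype.val_injective
lemma prj_eq (B : AddSubgroup L) (l : L) : prj B l = 0 ↔ l ∈ B := QuotientAddGroup.eq_zero_iff l
lemma inc_resR (B : AddSubgroup L) (f : L →ₗ[ℤ] L) (h) (b : B) : inc B (resR B f h b) = f (inc B b) := rfl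
lemma quR_prj (B : AddSubgroup L) (f : L →ₗ[ℤ] L) (h) (l : L) : quR B f h (prj B l) = prj B (f l) := rfl

lemma fin_B (B : AddSubgroup L) : Module.Finite ℤ B := Module.Finite.of_injective (inc B) (inc_inj B)
lemma fin_Q (B : AddSubgroup L) : Module.Finite ℤ (L ⧸ B) := Module.Finite.of_surjective (prj B) (prj_surj B)
lemma free_of (M : Type) [AddCommGroup M] [Module.Finite ℤ M]
    (h : ∀ (k : ℕ) (x : M), k ≠ 0 → k • x = 0 → x = 0) : Module.Free ℤ M := by
  have : IsAddTorsionFree M := by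
    refine ⟨fun k hk x y hxy => ?_⟩
    have hxy' : k • x = k • y := hxy
    rw [← sub_eq_zero] at hxy' ⊢
    rw [← smul_sub] at hxy'
    exact h k _ hk hxy'
  infer_instance

lemma free_tf {M : Type} [AddCommGroup M] [Module.Free ℤ M] [Module.Finite ℤ M] (k : ℕ) (x : M)
    (hk : k ≠ 0) (h : k • x = 0) : x = 0 := by
  refine sep x fun γ => ?_
  have := congrArg γ h
  rw [map_nsmul, map_zero, nsmul_eq_mul] at this
  exact (mul_eq_zero.1 this).resolve_left (by exact_mod_cast hk)

lemma free_B (B : AddSubgroup L) : Module.Free ℤ B := by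
  have := fin_B B
  refine free_of B fun k x hk hx => ?_
  apply inc_inj B
  rw [map_zero]
  refine free_tf k _ hk ?_
  rw [← map_nsmul, hx, map_zero]

lemma rank_add (B : AddSubgroup L) :
    Module.finrank ℤ (L ⧸ B) + Module.finrank ℤ B = Module.finrank ℤ L := by
  have := fin_B B
  have := fin_Q B
  have h1 := Submodule.finrank_quotient_add_finrank (LinearMap.ker (prj B))
  rw [((prj B).quotKerEquivOfSurjective (prj_surj B)).finrank_eq] at h1
  have h2 : LinearMap.ker (prj B) = LinearMap.range (inc B) := by
    ext l
    rw [LinearMap.mem_ker, prj_eq]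
    exact ⟨fun h => ⟨⟨l, h⟩, rfl⟩, by rintro ⟨b, rfl⟩; exact b.2⟩
  rw [h2, LinearMap.finrank_range_of_inj (inc_inj B)] at h1
  exact h1

/-- induction hypothesis -/
def IHyp (n : ℕ) : Prop := ∀ (L : Type) [AddCommGroup L] [Module.Free ℤ L] [Module.Finite ℤ L],
  Module.finrank ℤ L < n → ∀ (I J : Type) [Fintype I] [Nonempty I] [MeasurableSpace I]
  [DiscreteMeasurableSpace I] [Fintype J] [Nonempty J] [MeasurableSpace J]
  [DiscreteMeasurableSpace J] (R : L →ₗ[ℤ] L) (T : Du L →ₗ[ℝ] Du L) (D : I → J → L),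
  IsSys R T D → Concl T D

lemma concl_nrm (ih : IHyp (Module.finrank ℤ L)) (h : IsSys R T D) (hn : Nrm R D) : Concl T D := by
  by_cases hr : Reach h
  · exact base_case h hr
  obtain ⟨m, hm, B, hbot, htop, hRB, hsat, hprim, hQP⟩ := struct_lemma h hr hn
  have : NeZero m := ⟨by omega⟩
  refine concl_pow h m ?_
  have := fin_B B
  have := fin_Q B
  have := free_B B
  have : Module.Free ℤ (L ⧸ B) := by
    refine free_of _ fun k x hk hx => ?_
    obtain ⟨l, rfl⟩ := prj_surj B x
    rw [← map_nsmul, prj_eq] at hx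
    rw [prj_eq]
    exact hprim k l hk hx
  have hadd := rank_add B
  have hB0 : 0 < Module.finrank ℤ B := by
    have : Nontrivial B := (AddSubgroup.nontrivial_iff_ne_bot B).2 hbot
    exact Module.finrank_pos
  have hQ0 : 0 < Module.finrank ℤ (L ⧸ B) := by
    have : Nontrivial (L ⧸ B) := by
      obtain ⟨l, hl⟩ : ∃ l, l ∉ B := by
        by_contra hcon
        push Not at hcon
        exact htop (eq_top_iff.2 fun x _ => hcon x)
      exact ⟨⟨prj B l, 0, fun hh => hl ((prj_eq B l).1 hh)⟩⟩
    exact Module.finrank_pos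
  refine concl_QP (h.pow h.inj m) (prj B) (inc B) (prj_surj B) (inc_inj B)
    (fun b => (prj_eq B _).2 b.2) (fun l hl => ⟨⟨l, (prj_eq B l).1 hl⟩, rfl⟩)
    (resR B (R ^ m) hRB) (fun b => inc_resR B _ _ b) (quR B (R ^ m) hRB) (fun l => quR_prj B _ _ l)
    (fun l hl => (prj_eq B l).2 (hsat l ((prj_eq B _).1 hl))) ?_ ?_ ?_
  · rintro i j j' ⟨k, hk⟩
    obtain ⟨k, rfl⟩ := prj_surj B k
    rw [quR_prj, ← sub_eq_zero, ← map_sub, ← map_sub, prj_eq] at hk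
    rw [← sub_eq_zero, ← map_sub, prj_eq]
    exact hQP i j j' k hk
  · intro J1 _ _ _ _ TQ DQ hsys
    exact ih (L ⧸ B) (by omega) _ _ _ _ _ hsys
  · intro J1 J2 _ _ _ _ _ _ _ _ TB DB hsys _
    exact ih B (by omega) _ _ _ _ _ hsys

lemma du_zero {Q : Type} [AddCommGroup Q] [Module.Finite ℤ Q] {RQ : Q →ₗ[ℤ] Q}
    {TQ : Du Q →ₗ[ℝ] Du Q} {DQ : I → J → Q} (h : IsSys RQ TQ DQ) (hs : Function.Surjective RQ)
    (γ : Du Q) : γ = 0 := by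
  -- integer valued functionals vanish
  have key : ∀ φ : Du Q, (∀ q, ∃ n : ℤ, φ q = n) → φ = 0 := by
    intro φ hφ
    obtain ⟨n, f, hf⟩ := Module.Finite.exists_fin' ℤ Q
    have hst : ∀ t : ℕ, Function.Surjective (RQ ^ t) := by
      intro t
      rw [Module.End.coe_pow]; exact hs.iterate t
    have ev : ∀ᶠ t in atTop, ∀ a : Fin n, |(TQ ^ t) φ (f (Pi.single a 1))| < 1 := by
      rw [Filter.eventually_all]
      intro a
      exact (h.hS φ _).tendsto_atTop_zero.eventually (gt_mem_nhds one_pos)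
    obtain ⟨t, ht⟩ := ev.exists
    have h0 : (TQ ^ t) φ ∘ₗ f = 0 := by
      refine (Pi.basisFun ℤ (Fin n)).ext fun a => ?_
      simp only [Pi.basisFun_apply, LinearMap.comp_apply, LinearMap.zero_apply]
      have h1 := ht a
      obtain ⟨q, hq⟩ := hst t (f (Pi.single a 1))
      rw [← hq, h.pow_hT] at h1 ⊢
      obtain ⟨k, hk⟩ := hφ q
      rw [hk] at h1 ⊢
      have h4 : |k| < 1 := by exact_mod_cast h1
      exact_mod_cast Int.abs_lt_one_iff.1 h4
    ext q
    rw [← h.pow_hT t φ q]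
    obtain ⟨x, hx⟩ := hf ((RQ ^ t) q)
    rw [← hx]
    exact LinearMap.congr_fun h0 x
  have : Module.Finite ℤ (LinearMap.range γ) := Module.Finite.range γ
  have : Module.Free ℤ (LinearMap.range γ) := by
    refine free_of _ fun k x hk hx => ?_
    have := congrArg Subtype.val hx
    ext
    simp only [AddSubmonoidClass.coe_nsmul, nsmul_eq_mul, ZeroMemClass.coe_zero] at this
    exact (mul_eq_zero.1 this).resolve_left (by exact_mod_cast hk)
  let b := Module.Free.chooseBasis ℤ (LinearMap.range γ)
  ext q
  have : γ.rangeRestrict q = 0 := by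
    apply b.ext_elem
    intro a
    have := key ((Int.castAddHom ℝ).toIntLinearMap ∘ₗ b.coord a ∘ₗ γ.rangeRestrict)
      (fun q => ⟨_, rfl⟩)
    have h2 := LinearMap.congr_fun this q
    simpa using h2
  have h3 := congrArg Subtype.val this
  simpa using h3

lemma concl_triv {Q : Type} [AddCommGroup Q] [Module.Finite ℤ Q] {RQ : Q →ₗ[ℤ] Q}
    {TQ : Du Q →ₗ[ℝ] Du Q} {DQ : I → J → Q} (h : IsSys RQ TQ DQ) (hs : Function.Surjective RQ) :
    Concl TQ DQ := by
  have hsub : Subsingleton (Du Q) := ⟨fun a b => by rw [du_zero h hs a, du_zero h hs b]⟩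
  have hJ : Subsingleton J := ⟨fun j j' => by
    have i : I := Classical.arbitrary I
    obtain ⟨k, hk⟩ := hs (0 - DQ i j)
    obtain ⟨k', hk'⟩ := hs (0 - DQ i j')
    exact (h.hD i 0).unique ⟨k, hk.symm⟩ ⟨k', hk'.symm⟩⟩
  refine ⟨Empty, inferInstance, Module.Basis.empty _, ?_, ?_⟩
  · intro ω z hz
    exact absurd (Subsingleton.elim z 0) hz
  · refine Filter.Eventually.of_forall fun ω => ?_
    intro F _ hz
    have h1 := hz 0
    have j0 : ℕ → J := Classical.arbitrary _
    have h2 : ∀ x, F x = F j0 := fun x => by rw [Subsingleton.elim x j0]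
    have h3 : lat (Module.Basis.empty (Du Q) : Module.Basis Empty ℝ (Du Q)) 0 = 0 :=
      Subsingleton.elim _ _
    simp only [h3, theta_zero, ee_zero, one_mul] at h1
    rw [integral_congr_ae (Filter.Eventually.of_forall h2), integral_const] at h1
    refine Filter.Eventually.of_forall fun x => ?_
    rw [h2]
    simpa using h1

lemma concl_step (ih : IHyp (Module.finrank ℤ L)) (h : IsSys R T D) : Concl T D := by
  let S : Set L := {l | ∃ i j j' k, l = (R ^ k) (D i j - D i j')}
  let B : AddSubgroup L := AddSubgroup.closure S
  have hS : ∀ i j j' k, (R ^ k) (D i j - D i j') ∈ B := fun i j j' k =>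
    AddSubgroup.subset_closure ⟨i, j, j', k, rfl⟩
  have hd : ∀ i j j', D i j - D i j' ∈ B := fun i j j' => hS i j j' 0
  have hRB : ∀ n ∈ B, R n ∈ B := by
    intro n hn
    induction hn using AddSubgroup.closure_induction with
    | mem x hx =>
      obtain ⟨i, j, j', k, rfl⟩ := hx
      have := hS i j j' (k + 1)
      rwa [pow_succ', Module.End.mul_apply] at this
    | zero => rw [map_zero]; exact B.zero_mem
    | add x y _ _ hx hy => rw [map_add]; exact B.add_mem hx hy
    | neg x _ hx => rw [map_neg]; exact B.neg_mem hx
  have := fin_B B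
  have := fin_Q B
  have := free_B B
  have hsurj : Function.Surjective (quR B R hRB) := by
    intro q
    obtain ⟨l, rfl⟩ := prj_surj B q
    have i : I := Classical.arbitrary I
    have j0 : J := Classical.arbitrary J
    obtain ⟨j, ⟨k, hk⟩, _⟩ := h.hD i (l + D i j0)
    refine ⟨prj B k, ?_⟩
    rw [quR_prj, ← sub_eq_zero, ← map_sub, prj_eq, ← hk]
    convert hd i j0 j using 1
    abel
  have hinj : Function.Injective (quR B R hRB) :=
    IsNoetherian.injective_of_surjective_endomorphism _ hsurj
  refine concl_QP h (prj B) (inc B) (prj_surj B) (inc_inj B)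
    (fun b => (prj_eq B _).2 b.2) (fun l hl => ⟨⟨l, (prj_eq B l).1 hl⟩, rfl⟩)
    (resR B R hRB) (fun b => inc_resR B _ _ b) (quR B R hRB) (fun l => quR_prj B _ _ l)
    ?_ ?_ ?_ ?_
  · intro l hl
    apply hinj
    rw [quR_prj, hl, map_zero]
  · intro i j j' _
    rw [← sub_eq_zero, ← map_sub, prj_eq]
    exact hd i j j'
  · intro J1 _ _ _ _ TQ DQ hsys
    exact concl_triv hsys hsurj
  · intro J1 J2 _ _ _ _ _ _ _ _ TB DB hsys hex
    have hle : Module.finrank ℤ B ≤ Module.finrank ℤ L := by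
      have := rank_add B; omega
    refine concl_nrm (fun L' _ _ _ hL' => ih L' (by omega)) hsys ?_
    intro H hH
    have hpow : ∀ k (b : B), inc B ((resR B R hRB ^ k) b) = (R ^ k) (inc B b) := by
      intro k
      induction k with
      | zero => intro b; rfl
      | succ k ihk =>
        intro b
        rw [pow_succ, pow_succ, Module.End.mul_apply, Module.End.mul_apply, ihk, inc_resR]
    have hsub : B ≤ H.map B.subtype := by
      refine (AddSubgroup.closure_le _).2 ?_
      rintro _ ⟨i, j, j', k, rfl⟩
      obtain ⟨p, β, β', hp⟩ := hex i j j' (by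
        rw [← sub_eq_zero, ← map_sub, prj_eq]; exact hd i j j')
      refine ⟨(resR B R hRB ^ k) (DB p β - DB p β'), hH p β β' k, ?_⟩
      rw [← hp]
      exact hpow k _
    rw [eq_top_iff]
    intro b _
    obtain ⟨b', hb', hbb⟩ := hsub b.2
    have : b' = b := Subtype.ext hbb
    rwa [← this]

theorem concl_all (n : ℕ) : IHyp n := by
  induction n using Nat.strong_induction_on with
  | _ n ih =>
    intro L _ _ _ hL I J _ _ _ _ _ _ _ _ R T D h
    exact concl_step (ih _ hL) h

end
end FM

namespace FM
section
attribute [local instance] Matrix.linftyOpNormedRing Matrix.linftyOpNormedAlgebra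

lemma det_ne_of_exp {s : ℕ} {R : Matrix (Fin s) (Fin s) ℤ} (h : IsExpanding R) : R.det ≠ 0 := by
  intro h0
  have h1 : (0 : ℂ) ∉ spectrum ℂ (R.map (Int.cast : ℤ → ℂ)) := by
    intro hm
    have := h 0 hm
    norm_num at this
  rw [spectrum.zero_notMem_iff, Matrix.isUnit_iff_isUnit_det] at h1
  have h2 : (R.map (Int.cast : ℤ → ℂ)).det = ((R.det : ℤ) : ℂ) :=
    ((Int.castRingHom ℂ).map_det R).symm
  rw [h2, h0] at h1
  simp at h1

lemma intMat_det {s : ℕ} {R : Matrix (Fin s) (Fin s) ℤ} (h : IsExpanding R) :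
    IsUnit (intMatCast R).det := by
  have h2 : (intMatCast R).det = ((R.det : ℤ) : ℝ) :=
    ((Int.castRingHom ℝ).map_det R).symm
  rw [h2, isUnit_iff_ne_zero]
  exact_mod_cast det_ne_of_exp h

lemma norm_entry_le {s : ℕ} (A : Matrix (Fin s) (Fin s) ℂ) (a c : Fin s) : ‖A a c‖ ≤ ‖A‖ := by
  have h1 : ‖A a c‖₊ ≤ ∑ j, ‖A a j‖₊ :=
    Finset.single_le_sum (f := fun j => ‖A a j‖₊) (fun _ _ => zero_le) (Finset.mem_univ c)
  have h2 : ∑ j, ‖A a j‖₊ ≤ ‖A‖₊ := by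
    rw [Matrix.linfty_opNNNorm_def]
    exact Finset.le_sup (f := fun i => ∑ j, ‖A i j‖₊) (Finset.mem_univ a)
  exact_mod_cast h1.trans h2

lemma pow_summable {s : ℕ} (A : Matrix (Fin s) (Fin s) ℂ)
    (h : ∀ z ∈ spectrum ℂ A, ‖z‖ < 1) (a c : Fin s) : Summable (fun k : ℕ => ‖(A ^ k) a c‖) := by
  haveI : CompleteSpace (Matrix (Fin s) (Fin s) ℂ) := FiniteDimensional.complete ℂ _
  have hr : spectralRadius ℂ A < 1 := by
    by_cases hne : (spectrum ℂ A).Nonempty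
    · have := spectrum.spectralRadius_lt_of_forall_lt_of_nonempty (𝕜 := ℂ) (a := A) hne (r := 1)
        (fun z hz => by have := h z hz; exact_mod_cast this)
      simpa using this
    · rw [Set.not_nonempty_iff_eq_empty] at hne
      simp [spectralRadius, hne]
  obtain ⟨q, hq1, hq2⟩ := ENNReal.lt_iff_exists_nnreal_btwn.1 hr
  have ht := spectrum.pow_nnnorm_pow_one_div_tendsto_nhds_spectralRadius A
  have hev := (ht.eventually_lt_const hq1).and (eventually_ge_atTop 1)
  have hev2 : ∀ᶠ n : ℕ in atTop, ‖(A ^ n) a c‖ ≤ (q : ℝ) ^ n := by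
    filter_upwards [hev] with n hn
    have hn0 : (0 : ℝ) < n := by exact_mod_cast hn.2
    have h3 : (‖A ^ n‖₊ : ℝ≥0∞) ≤ (q : ℝ≥0∞) ^ n := by
      have := ENNReal.rpow_le_rpow hn.1.le hn0.le
      rw [← ENNReal.rpow_mul, one_div, inv_mul_cancel₀ hn0.ne', ENNReal.rpow_one,
        ENNReal.rpow_natCast] at this
      exact this
    refine (norm_entry_le _ a c).trans ?_
    exact_mod_cast h3
  have hq : (q : ℝ) < 1 := by exact_mod_cast hq2
  exact Summable.of_norm_bounded_eventually_nat (summable_geometric_of_lt_one q.2 hq) (by simpa using hev2)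

lemma inv_pow_summable {s : ℕ} {R : Matrix (Fin s) (Fin s) ℤ} (h : IsExpanding R) (a c : Fin s) :
    Summable (fun k : ℕ => |(((intMatCast R)⁻¹) ^ k) a c|) := by
  have hu := intMat_det h
  set S := (intMatCast R)⁻¹ with hS
  let φ : Matrix (Fin s) (Fin s) ℝ →+* Matrix (Fin s) (Fin s) ℂ := (Complex.ofRealHom).mapMatrix
  have hM : φ (intMatCast R) = R.map (Int.cast : ℤ → ℂ) := by
    ext i j; simp [φ, intMatCast]
  have h1 : φ S * φ (intMatCast R) = 1 := by
    rw [← map_mul, hS, Matrix.nonsing_inv_mul _ hu, map_one]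
  have h2 : φ (intMatCast R) * φ S = 1 := by
    rw [← map_mul, hS, Matrix.mul_nonsing_inv _ hu, map_one]
  let v : (Matrix (Fin s) (Fin s) ℂ)ˣ := ⟨φ S, φ (intMatCast R), h1, h2⟩
  have hs : ∀ z ∈ spectrum ℂ (φ S), ‖z‖ < 1 := by
    intro z hz
    have hz0 : z ≠ 0 := by
      rintro rfl
      exact (spectrum.zero_notMem_iff ℂ).2 v.isUnit hz
    have hz' : z⁻¹ ∈ spectrum ℂ (R.map (Int.cast : ℤ → ℂ)) := by
      rw [← hM]
      have := (spectrum.inv₀_mem_inv_iff (a := v) (r := z)).2 hz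
      exact this
    have h3 := h _ hz'
    rw [norm_inv] at h3
    exact (one_lt_inv₀ (norm_pos_iff.2 hz0)).1 h3
  have := pow_summable (φ S) hs a c
  refine this.congr fun k => ?_
  rw [← map_pow]
  simp [φ]

end
end FM

namespace FM
section
variable {s : ℕ}

/-- coordinates on the dual of the integer lattice -/
def PhiE (s : ℕ) : (Fin s → ℝ) ≃ₗ[ℝ] Du (Fin s → ℤ) where
  toFun x :=
    { toFun := fun l => rdot x (intVecCast l)
      map_add' := fun l m => by
        simp [rdot, intVecCast, mul_add, Finset.sum_add_distrib]
      map_smul' := fun c l => by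
        simp only [rdot, intVecCast, Pi.smul_apply, smul_eq_mul, Int.cast_mul, zsmul_eq_mul,
          Finset.mul_sum, eq_intCast, Int.cast_id]
        exact Finset.sum_congr rfl fun i _ => by ring }
  map_add' x y := by
    ext l; simp [rdot, add_mul, Finset.sum_add_distrib]
  map_smul' c x := by
    ext l; simp [rdot, Finset.mul_sum, mul_assoc]
  invFun γ := fun a => γ (Pi.single a 1)
  left_inv x := by
    funext a
    simp [rdot, intVecCast, Pi.single_apply]
  right_inv γ := by
    refine LinearMap.pi_ext' fun a => LinearMap.ext_ring ?_
    simp [rdot, intVecCast, Pi.single_apply]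

lemma PhiE_apply (x : Fin s → ℝ) (l : Fin s → ℤ) : PhiE s x l = rdot x (intVecCast l) := rfl

lemma rdot_eq (x y : Fin s → ℝ) : rdot x y = x ⬝ᵥ y := rfl

lemma rdot_tr (A : Matrix (Fin s) (Fin s) ℝ) (x y : Fin s → ℝ) :
    rdot (Aᵀ *ᵥ x) y = rdot x (A *ᵥ y) := by
  rw [rdot_eq, rdot_eq, Matrix.mulVec_transpose, Matrix.dotProduct_mulVec]

/-- dual inverse map -/
def sysT (R : Matrix (Fin s) (Fin s) ℤ) : Du (Fin s → ℤ) →ₗ[ℝ] Du (Fin s → ℤ) :=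
  (PhiE s).toLinearMap ∘ₗ (((intMatCast R)⁻¹)ᵀ).mulVecLin ∘ₗ (PhiE s).symm.toLinearMap

lemma sysT_apply (R : Matrix (Fin s) (Fin s) ℤ) (x : Fin s → ℝ) :
    sysT R (PhiE s x) = PhiE s (((intMatCast R)⁻¹)ᵀ *ᵥ x) := by
  simp only [sysT, LinearMap.comp_apply, LinearEquiv.coe_coe, LinearEquiv.symm_apply_apply,
    Matrix.mulVecLin_apply]

lemma sysT_pow (R : Matrix (Fin s) (Fin s) ℤ) (k : ℕ) (x : Fin s → ℝ) :
    (sysT R ^ k) (PhiE s x) = PhiE s ((((intMatCast R)⁻¹) ^ k)ᵀ *ᵥ x) := by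
  induction k generalizing x with
  | zero => simp
  | succ k ih =>
    rw [pow_succ, Module.End.mul_apply, sysT_apply, ih, Matrix.mulVec_mulVec, pow_succ' (intMatCast R)⁻¹,
      Matrix.transpose_mul]

lemma sysT_pow_apply (R : Matrix (Fin s) (Fin s) ℤ) (k : ℕ) (x : Fin s → ℝ) (l : Fin s → ℤ) :
    (sysT R ^ k) (PhiE s x) l = rdot x ((((intMatCast R)⁻¹) ^ k) *ᵥ (intVecCast l)) := by
  rw [sysT_pow, PhiE_apply, rdot_tr]

lemma pst_Phi (R : Matrix (Fin s) (Fin s) ℤ) (x : Fin s → ℝ) :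
    pst (R.mulVecLin) (PhiE s x) = PhiE s ((intMatCast R)ᵀ *ᵥ x) := by
  refine LinearMap.ext fun l => ?_
  rw [pst_apply, PhiE_apply, PhiE_apply, rdot_tr]
  congr 1
  funext a
  simp [intVecCast, intMatCast, Matrix.mulVec, dotProduct]

lemma sysT_sum {R : Matrix (Fin s) (Fin s) ℤ} (h : IsExpanding R) : SumT (sysT R) := by
  intro γ l
  obtain ⟨x, rfl⟩ := (PhiE s).surjective γ
  simp only [sysT_pow_apply]
  have : Summable fun k : ℕ => ∑ a, ∑ c, |x a| * (|((((intMatCast R)⁻¹) ^ k) a c)| * |(l c : ℝ)|) := by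
    refine summable_sum fun a _ => summable_sum fun c _ => ?_
    exact ((inv_pow_summable h a c).mul_right _).mul_left _
  refine Summable.of_nonneg_of_le (fun _ => abs_nonneg _) (fun k => ?_) this
  unfold rdot Matrix.mulVec dotProduct
  refine (Finset.abs_sum_le_sum_abs _ _).trans (Finset.sum_le_sum fun a _ => ?_)
  rw [abs_mul, ← Finset.mul_sum]
  refine mul_le_mul_of_nonneg_left ?_ (abs_nonneg _)
  refine (Finset.abs_sum_le_sum_abs _ _).trans (Finset.sum_le_sum fun c _ => ?_)
  rw [abs_mul]; rfl

lemma sysT_isSys {R : Matrix (Fin s) (Fin s) ℤ} (h : IsExpanding R) {I J : Type}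
    (dd : I → J → Fin s → ℤ)
    (hdd : ∀ i, ∀ w : Fin s → ℤ, ∃! j, ∃ k : Fin s → ℤ, w - dd i j = R.mulVec k) :
    IsSys R.mulVecLin (sysT R) dd where
  hT γ := by
    obtain ⟨x, rfl⟩ := (PhiE s).surjective γ
    rw [sysT_apply, pst_Phi, Matrix.mulVec_mulVec, ← Matrix.transpose_mul,
      Matrix.nonsing_inv_mul _ (intMat_det h)]
    simp
  hT' γ := by
    obtain ⟨x, rfl⟩ := (PhiE s).surjective γ
    rw [pst_Phi, sysT_apply, Matrix.mulVec_mulVec, ← Matrix.transpose_mul,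
      Matrix.mul_nonsing_inv _ (intMat_det h)]
    simp
  hS := sysT_sum h
  hD i l := by simpa using hdd i l

variable {I J : Type} [Fintype I] [Nonempty I] [MeasurableSpace I] [DiscreteMeasurableSpace I]
  [Fintype J] [Nonempty J] [MeasurableSpace J] [DiscreteMeasurableSpace J]

/-- the random series -/
def XX (R : Matrix (Fin s) (Fin s) ℤ) (dd : I → J → Fin s → ℤ) (ω : ℕ → I) (j : ℕ → J) : Fin s → ℝ :=
  ∑' k : ℕ, (((intMatCast R)⁻¹) ^ (k + 1)).mulVec (intVecCast (dd (ω k) (j k)))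

lemma rdot_single (a : Fin s) (y : Fin s → ℝ) : rdot (Pi.single a 1) y = y a := by
  simp [rdot, Pi.single_apply]

lemma XX_apply {R : Matrix (Fin s) (Fin s) ℤ} (h : IsExpanding R) (dd : I → J → Fin s → ℤ)
    (ω : ℕ → I) (j : ℕ → J) (a : Fin s) :
    XX R dd ω j a = theta (sysT R) dd (PhiE s (Pi.single a 1)) ω j := by
  have hs : ∀ a : Fin s, Summable fun k : ℕ =>
      ((((intMatCast R)⁻¹) ^ (k + 1)).mulVec (intVecCast (dd (ω k) (j k)))) a := by
    intro a
    refine (theta_summable (sysT_sum h) dd (PhiE s (Pi.single a 1)) ω j).congr fun k => ?_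
    rw [sysT_pow_apply, rdot_single]
  unfold XX theta
  rw [tsum_apply (Pi.summable.2 hs)]
  refine tsum_congr fun k => ?_
  rw [sysT_pow_apply, rdot_single]

lemma XX_meas {R : Matrix (Fin s) (Fin s) ℤ} (h : IsExpanding R) (dd : I → J → Fin s → ℤ)
    (ω : ℕ → I) : Measurable (XX R dd ω) := by
  refine measurable_pi_lambda _ fun a => ?_
  simp only [XX_apply h]
  exact theta_meas' (sysT_sum h) dd _ ω

lemma rdot_XX {R : Matrix (Fin s) (Fin s) ℤ} (h : IsExpanding R) (dd : I → J → Fin s → ℤ)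
    (x : Fin s → ℝ) (ω : ℕ → I) (j : ℕ → J) :
    rdot x (XX R dd ω j) = theta (sysT R) dd (PhiE s x) ω j := by
  have hx : PhiE s x = ∑ a, x a • PhiE s (Pi.single a 1) := by
    simp only [← map_smul, ← map_sum]
    congr 1
    funext c
    simp [Pi.single_apply]
  rw [hx, theta_sum (sysT_sum h)]
  simp only [theta_smul, ← XX_apply h]
  rfl

lemma expv_ee (x y : Fin s → ℝ) : expv x y = ee (rdot x y) := by
  rw [ee_exp, expv]; congr 1; ring

lemma conj_ee (x : ℝ) : (starRingEnd ℂ) (ee x) = ee (-x) := by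
  rw [ee_exp, ee_exp, ← Complex.exp_conj]
  congr 1
  have h2 : (starRingEnd ℂ) 2 = 2 := Complex.conj_ofNat 2
  simp [h2]

lemma rdot_sub (x y w : Fin s → ℝ) : rdot (x - y) w = rdot x w + - rdot y w := by
  rw [rdot_eq, rdot_eq, rdot_eq, sub_dotProduct, sub_eq_add_neg]

lemma rdot_neg (x w : Fin s → ℝ) : rdot (-x) w = - rdot x w := by
  rw [rdot_eq, rdot_eq, neg_dotProduct]

end
end FM

namespace FM
section
variable {s : ℕ} {I J : Type} [Fintype I] [Nonempty I] [MeasurableSpace I] [DiscreteMeasurableSpace I]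
  [Fintype J] [Nonempty J] [MeasurableSpace J] [DiscreteMeasurableSpace J]

/-- spectrum property from orthogonality and completeness -/
lemma isSpectrum_of {R : Matrix (Fin s) (Fin s) ℤ} (h : IsExpanding R) (dd : I → J → Fin s → ℤ)
    (G : Matrix (Fin s) (Fin s) ℝ) (hG : IsUnit G.det) (ω : ℕ → I)
    (h1 : ∀ z : Fin s → ℤ, z ≠ 0 →
      ∫ j, ee (rdot (G *ᵥ intVecCast z) (XX R dd ω j)) ∂(UM J) = 0)
    (h2 : Compl (UM J) (fun (z : Fin s → ℤ) j => ee (rdot (G *ᵥ intVecCast z) (XX R dd ω j)))) :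
    IsSpectrum ((UM J).map (XX R dd ω))
      (Set.range (fun z : Fin s → ℤ => G.mulVec (intVecCast z))) := by
  have hX := XX_meas h dd ω
  have hr : ∀ x : Fin s → ℝ, Measurable (fun y => rdot x y) := fun x => by
    unfold rdot; fun_prop
  have he : ∀ x : Fin s → ℝ, Measurable (fun y => expv x y) := fun x => by
    simp only [expv_ee]; exact ee_meas.comp (hr x)
  have hc : ∀ z z' : Fin s → ℤ, G *ᵥ intVecCast (z - z') = G *ᵥ intVecCast z - G *ᵥ intVecCast z' := by
    intro z z'
    rw [← Matrix.mulVec_sub]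
    congr 1
    funext a
    simp [intVecCast]
  have hn : ∀ z : Fin s → ℤ, G *ᵥ intVecCast (-z) = - (G *ᵥ intVecCast z) := by
    intro z
    rw [← Matrix.mulVec_neg]
    congr 1
    funext a
    simp [intVecCast]
  haveI : IsProbabilityMeasure ((UM J).map (XX R dd ω)) :=
    Measure.isProbabilityMeasure_map hX.aemeasurable
  refine ⟨Set.countable_range _, ?_, ?_⟩
  · rintro _ ⟨z, rfl⟩ _ ⟨z', rfl⟩
    have hm : Measurable fun y : Fin s → ℝ => expv (G *ᵥ intVecCast z) y *
        (starRingEnd ℂ) (expv (G *ᵥ intVecCast z') y) :=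
      (he _).mul (Complex.continuous_conj.measurable.comp (he _))
    rw [integral_map hX.aemeasurable hm.aestronglyMeasurable]
    have hh : ∀ j, expv (G *ᵥ intVecCast z) (XX R dd ω j) *
        (starRingEnd ℂ) (expv (G *ᵥ intVecCast z') (XX R dd ω j)) =
        ee (rdot (G *ᵥ intVecCast (z - z')) (XX R dd ω j)) := by
      intro j
      rw [hc, rdot_sub, ee_add, expv_ee, expv_ee, conj_ee]
    simp only [hh]
    by_cases hz : z = z'
    · subst hz
      simp [intVecCast, rdot, ee_zero, Matrix.mulVec, dotProduct]
    · rw [h1 _ (sub_ne_zero.2 hz), if_neg]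
      intro heq
      apply hz
      have := Matrix.mulVec_injective_of_isUnit ((Matrix.isUnit_iff_isUnit_det _).2 hG) heq
      funext a
      have h3 := congrFun this a
      simpa [intVecCast] using h3
  · intro f hf
    have hfi : Integrable (f : (Fin s → ℝ) → ℂ) ((UM J).map (XX R dd ω)) :=
      (Lp.memLp f).integrable (by norm_num)
    have hFi : Integrable (fun j => f (XX R dd ω j)) (UM J) := hfi.comp_measurable hX
    have h3 := h2 (fun j => f (XX R dd ω j)) hFi ?_
    · rw [Lp.eq_zero_iff_ae_eq_zero]
      have hms : MeasurableSet {y | f y = 0} :=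
        (Lp.stronglyMeasurable f).measurable (measurableSet_singleton 0)
      exact (ae_map_iff hX.aemeasurable hms).2 h3
    · intro z
      have h4 := hf _ ⟨-z, rfl⟩
      have hm : Measurable fun y : Fin s → ℝ =>
          (starRingEnd ℂ) (expv (G *ᵥ intVecCast (-z)) y) * f y :=
        (Complex.continuous_conj.measurable.comp (he _)).mul (Lp.stronglyMeasurable f).measurable
      rw [integral_map hX.aemeasurable hm.aestronglyMeasurable] at h4
      rw [← h4]
      refine integral_congr_ae (Eventually.of_forall fun j => ?_)
      simp only [expv_ee, conj_ee, hn, rdot_neg, neg_neg]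

theorem fiber_main {R : Matrix (Fin s) (Fin s) ℤ} (h : IsExpanding R) (dd : I → J → Fin s → ℤ)
    (hdd : ∀ i, ∀ w : Fin s → ℤ, ∃! j, ∃ k : Fin s → ℤ, w - dd i j = R.mulVec k) :
    ∃ G : Matrix (Fin s) (Fin s) ℝ, IsUnit G.det ∧ ∀ᵐ ω ∂(UM I),
      IsSpectrum ((UM J).map (XX R dd ω))
        (Set.range (fun z : Fin s → ℤ => G.mulVec (intVecCast z))) := by
  obtain ⟨ι, hι, b, hb1, hb2⟩ := concl_all (Module.finrank ℤ (Fin s → ℤ) + 1) (Fin s → ℤ)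
    (Nat.lt_succ_self _) I J _ _ dd (sysT_isSys h dd hdd)
  let b' : Module.Basis ι ℝ (Fin s → ℝ) := b.map (PhiE s).symm
  have hcard : Fintype.card ι = Fintype.card (Fin s) := by
    rw [← Module.finrank_eq_card_basis b', Module.finrank_fintype_fun_eq_card]
  let e : ι ≃ Fin s := Fintype.equivOfCardEq hcard
  let b2 := b'.reindex e
  let G : Matrix (Fin s) (Fin s) ℝ := (Pi.basisFun ℝ (Fin s)).toMatrix b2
  have hGu : IsUnit G.det := by
    have := (Pi.basisFun ℝ (Fin s)).isUnit_det b2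
    rwa [Module.Basis.det_apply] at this
  have hG : ∀ z : Fin s → ℤ, PhiE s (G *ᵥ intVecCast z) = lat b (z ∘ e) := by
    intro z
    have : G *ᵥ intVecCast z = ∑ c, (z c : ℝ) • b2 c := by
      funext a
      simp [Matrix.mulVec, dotProduct, G, intVecCast, Module.Basis.toMatrix_apply, mul_comm]
    rw [this, map_sum, lat]
    rw [← Equiv.sum_comp e]
    simp [b2, b']
  refine ⟨G, hGu, ?_⟩
  filter_upwards [hb2] with ω hω
  refine isSpectrum_of h dd G hGu ω ?_ ?_
  · intro z hz
    simp only [rdot_XX h, hG]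
    refine hb1 ω _ fun h0 => hz ?_
    funext c
    have := congrFun h0 (e.symm c)
    simpa using this
  · intro F hF hz
    refine hω F hF fun z => ?_
    have := hz (z ∘ e.symm)
    simp only [rdot_XX h, hG] at this
    simpa [Function.comp_assoc] using this

end
end FM


/-- For a quasi-product digit system, there is one fixed full-rank lattice
`Γ₂` in `ℝ^{d-r}` which is a spectrum of the fiber measure `μ_ω²` for almost every
sequence `ω` of first-component digits. -/
theorem fiber_measures_common_spectrum {r s N₁ : ℕ} (hN₁ : 1 ≤ N₁)
    (R₁ : Matrix (Fin r) (Fin r) ℤ) (R₂ : Matrix (Fin s) (Fin s) ℤ)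
    (C : Matrix (Fin s) (Fin r) ℤ)
    (R : Matrix (Fin r ⊕ Fin s) (Fin r ⊕ Fin s) ℤ)
    (hRdef : R = Matrix.fromBlocks R₁ 0 C R₂)
    (hR : IsExpanding R) (hR₂ : IsExpanding R₂)
    (u : Fin N₁ → Fin r → ℤ) (hu : Function.Injective u)
    (dd : Fin N₁ → Fin R₂.det.natAbs → Fin s → ℤ)
    (hdd : ∀ i : Fin N₁, ∀ w : Fin s → ℤ, ∃! j : Fin R₂.det.natAbs,
      ∃ k : Fin s → ℤ, w - dd i j = R₂.mulVec k)
    (B : Finset (Fin r ⊕ Fin s → ℤ))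
    (hB : B = Finset.image (fun p : Fin N₁ × Fin R₂.det.natAbs =>
        Sum.elim (u p.1) (dd p.1 p.2)) Finset.univ) :
    ∃ G : Matrix (Fin s) (Fin s) ℝ, IsUnit G.det ∧
      ∀ (P₁ : Measure (ℕ → Fin N₁)) (P₂ : Measure (ℕ → Fin R₂.det.natAbs)),
        IsProbabilityMeasure P₁ → IsProbabilityMeasure P₂ →
        (∀ (n : ℕ) (c : Fin n → Fin N₁),
          P₁ {ω | ∀ i : Fin n, ω (i : ℕ) = c i} = ((N₁ : ℝ≥0∞))⁻¹ ^ n) →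
        (∀ (n : ℕ) (c : Fin n → Fin R₂.det.natAbs),
          P₂ {j | ∀ i : Fin n, j (i : ℕ) = c i} = ((R₂.det.natAbs : ℝ≥0∞))⁻¹ ^ n) →
        ∀ᵐ ω ∂P₁,
          IsSpectrum
            (P₂.map (fun j : ℕ → Fin R₂.det.natAbs =>
              ∑' k : ℕ, (((intMatCast R₂)⁻¹) ^ (k + 1)).mulVec
                (intVecCast (dd (ω k) (j k)))))
            (Set.range (fun z : Fin s → ℤ => G.mulVec (intVecCast z))) := by
  have hJ : R₂.det.natAbs ≠ 0 := Int.natAbs_ne_zero.2 (FM.det_ne_of_exp hR₂)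
  haveI : Nonempty (Fin N₁) := ⟨⟨0, hN₁⟩⟩
  haveI : Nonempty (Fin R₂.det.natAbs) := ⟨⟨0, Nat.pos_of_ne_zero hJ⟩⟩
  obtain ⟨G, hG, hω⟩ := FM.fiber_main hR₂ dd hdd
  refine ⟨G, hG, fun P₁ P₂ hP₁ hP₂ h₁ h₂ => ?_⟩
  have e₁ : P₁ = FM.UM (Fin N₁) := FM.UM_ext P₁ (by simpa using h₁)
  have e₂ : P₂ = FM.UM (Fin R₂.det.natAbs) := FM.UM_ext P₂ (by simpa using h₂)
  rw [e₁, e₂]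
  exact hω

end
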